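/- There exists a constant c > 0 such that for every sufficiently large n there is an n-point metric space (X, d) of negative type such that every embedding of (X, d) into L₁ (into ℝ^m with the ℓ¹ norm, for any m) has distortion at least c·√(log n). -/

import Mathlib

namespace NY
open Finset
noncomputable section
set_option linter.all false

def bad3 (A B C : ℤ → Bool) (p m : ℤ) : Prop := A p = C (2 * m - p) ∧ B m ≠ A p
instance (A B C : ℤ → Bool) (p m : ℤ) : Decidable (bad3 A B C p m) := by
  unfold bad3; infer_instance

def Phi (K : ℤ) (A B C : ℤ → Bool) : ℕ :=
  #{x ∈ Ico (-K) K ×ˢ Ico (-K) K | bad3 A B C x.1 x.2}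

def Tail (P H : ℤ) (A : ℤ → Bool) : Prop :=
  16 * (#{t ∈ Ico P (P + H) | A t = false} : ℤ) ≤ H ∧
  16 * (#{t ∈ Ico (-P - H + 1) (-P + 1) | A t = true} : ℤ) ≤ H

theorem window (q : ℤ → Prop) [DecidablePred q] (P H d : ℤ) (hd : 0 < d) (hH : 2 * d ≤ H)
    (h : 16 * (#{t ∈ Ico P (P + H) | q t} : ℤ) ≤ H) :
    ∃ r, P ≤ r ∧ r + d ≤ P + H ∧ 4 * (#{t ∈ Ico r (r + d) | q t} : ℤ) ≤ d := by
  by_contra hcon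
  push Not at hcon
  have key : ∀ k : ℕ, (k : ℤ) * d ≤ H → (k : ℤ) * d ≤ 4 * (#{t ∈ Ico P (P + k * d) | q t} : ℤ) := by
    intro k
    induction k with
    | zero => intro _; simp
    | succ k ih =>
      intro hk
      push_cast at hk ⊢
      have h1 := ih (by nlinarith)
      have h2 := hcon (P + k * d) (by nlinarith [Int.natCast_nonneg k]) (by nlinarith)
      have h3 : (#{t ∈ Ico P (P + (k + 1) * d) | q t} : ℤ) =
          #{t ∈ Ico P (P + k * d) | q t} + #{t ∈ Ico (P + k * d) (P + k * d + d) | q t} := by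
        rw [← Nat.cast_add, ← card_union_of_disjoint]
        · congr 2
          rw [← filter_union]
          congr 1
          ext t
          simp only [mem_Ico, mem_union]
          constructor
          · intro ⟨a, b⟩
            by_cases c : t < P + k * d
            · left; exact ⟨a, c⟩
            · right; constructor <;> linarith
          · rintro (⟨a, b⟩ | ⟨a, b⟩)
            · constructor <;> nlinarith
            · constructor <;> nlinarith [Int.natCast_nonneg k]
        · rw [disjoint_left]
          intro t ht ht'
          simp only [mem_filter, mem_Ico] at ht ht'
          linarith
      nlinarith
  obtain ⟨k, hk⟩ := Int.eq_ofNat_of_zero_le (Int.ediv_nonneg (by linarith : 0 ≤ H) hd.le)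
  have e1 := Int.emod_add_mul_ediv H d
  have e2 := Int.emod_lt_of_pos H hd
  have e3 := Int.emod_nonneg H hd.ne'
  rw [hk] at e1
  have h1 := key k (by nlinarith)
  have h2 : (#{t ∈ Ico P (P + k * d) | q t} : ℤ) ≤ #{t ∈ Ico P (P + H) | q t} := by
    exact_mod_cast card_le_card (filter_subset_filter _ (Ico_subset_Ico le_rfl (by nlinarith)))
  nlinarith

theorem tele (A : ℤ → Bool) (d : ℤ) (hd : 0 ≤ d) (l : ℤ) (r : ℤ) (h : l ≤ r) :
    (#{t ∈ Ico r (r + d) | A t = true} : ℤ) ≤ #{t ∈ Ico l (l + d) | A t = true} +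
      #{t ∈ Ico l r | A t = false ∧ A (t + d) = true} := by
  induction r, h using Int.leInduction with
  | base => simp
  | succ r hr ih =>
    have e1 : (#{t ∈ Ico (r+1) (r + 1 + d) | A t = true} : ℤ) + (if A r = true then 1 else 0) =
        #{t ∈ Ico r (r + d) | A t = true} + (if A (r + d) = true then 1 else 0) := by
      simp only [card_filter, Nat.cast_sum]
      have s1 : (if A r = true then (1:ℤ) else 0) = ∑ t ∈ Ico r (r+1), ((if A t = true then 1 else 0 : ℕ) : ℤ) := by
        rw [show Ico r (r+1) = {r} by ext; simp; omega, sum_singleton]; simp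
      have s2 : (if A (r + d) = true then (1:ℤ) else 0) = ∑ t ∈ Ico (r + d) (r+d+1), ((if A t = true then 1 else 0 : ℕ) : ℤ) := by
        rw [show Ico (r + d) (r+d+1) = {r + d} by ext; simp; omega, sum_singleton]; simp
      rw [s1, s2, add_comm]
      rw [← sum_union, ← sum_union]
      · congr 1; ext t; simp; omega
      · rw [disjoint_left]; intro t; simp; omega
      · rw [disjoint_left]; intro t; simp; omega
    have e2 : (#{t ∈ Ico l (r + 1) | A t = false ∧ A (t + d) = true} : ℤ) =
       #{t ∈ Ico l r | A t = false ∧ A (t + d) = true} + (if A r = false ∧ A (r + d) = true then 1 else 0) := by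
      simp only [card_filter, Nat.cast_sum]
      have s1 : (if A r = false ∧ A (r + d) = true then (1:ℤ) else 0) =
         ∑ t ∈ Ico r (r+1), ((if A t = false ∧ A (t + d) = true then 1 else 0 : ℕ) : ℤ) := by
        rw [show Ico r (r+1) = {r} by ext; simp; omega, sum_singleton]; simp
      rw [s1, ← sum_union]
      · congr 1; ext t; simp; omega
      · rw [disjoint_left]; intro t; simp; omega
    rw [e2]
    cases hr : A r <;> cases hrd : A (r+d) <;> simp [hr, hrd] at e1 ⊢ <;> linarith

theorem compl_card (A : ℤ → Bool) (a d : ℤ) (hd : 0 ≤ d) :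
    (#{t ∈ Ico a (a + d) | A t = true} : ℤ) + #{t ∈ Ico a (a + d) | A t = false} = d := by
  have := card_filter_add_card_filter_not (s := Ico a (a + d)) (p := fun t => A t = true)
  simp only [Bool.not_eq_true, Int.card_Ico] at this
  have h2 : ((#{t ∈ Ico a (a + d) | A t = true} + #{t ∈ Ico a (a + d) | A t = false} : ℕ) : ℤ)
     = ((a + d - a).toNat : ℕ) := by rw [this]
  push_cast at h2
  omega

/-- many `2g`-steps from 0 to 1 -/
theorem steps (A : ℤ → Bool) (P H g : ℤ) (hP : 0 < P) (hg : 0 < g) (hH : 4 * g ≤ H)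
    (hT : Tail P H A) :
    g ≤ #{t ∈ Ico (-(P + H)) (P + H) | A t = false ∧ A (t + 2 * g) = true} := by
  obtain ⟨r, hr1, hr2, hr3⟩ := window _ P H (2 * g) (by linarith) (by linarith) hT.1
  obtain ⟨l, hl1, hl2, hl3⟩ := window _ (-P - H + 1) H (2 * g) (by linarith) (by linarith)
    (by rw [show -P - H + 1 + H = -P + 1 by ring]; exact hT.2)
  have h1 := tele A (2 * g) (by linarith) l r (by linarith)
  have h2 := compl_card A r (2 * g) (by linarith)
  have h3 : (#{t ∈ Ico l r | A t = false ∧ A (t + 2 * g) = true} : ℤ) ≤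
     #{t ∈ Ico (-(P + H)) (P + H) | A t = false ∧ A (t + 2 * g) = true} := by
    exact_mod_cast card_le_card (filter_subset_filter _ (Ico_subset_Ico (by linarith) (by linarith)))
  omega

def phi (K : ℤ) (A : ℤ → Bool) (m : ℤ) : ℕ := #{p ∈ Ico (-K) K | bad3 A A A p m}

theorem invgap (A : ℤ → Bool) (P H x y : ℤ) (hP : 0 < P) (hxy : x < y) (hH : 4 * (y - x) ≤ H)
    (hT : Tail P H A) (hx : A x = true) (hy : A y = false) (hx1 : -(P + H) ≤ x) (hx2 : x < P + H) :
    y - x ≤ phi (4 * (P + H)) A x + phi (4 * (P + H)) A y := by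
  have h := steps A P H (y - x) hP (by linarith) hH hT
  refine h.trans ?_
  rw [← Nat.cast_add, Nat.cast_le]
  have : ({t ∈ Ico (-(P + H)) (P + H) | A t = false ∧ A (t + 2 * (y - x)) = true} : Finset ℤ) ⊆
     {p ∈ Ico (-(4 * (P + H))) (4 * (P + H)) | bad3 A A A p x} ∪
     ({p ∈ Ico (-(4 * (P + H))) (4 * (P + H)) | bad3 A A A p y}).image (fun p => 2 * x - p) := by
    intro t
    simp only [mem_filter, mem_union, mem_image, mem_Ico]
    rintro ⟨⟨h1, h2⟩, h3, h4⟩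
    by_cases h5 : A (2 * x - t) = false
    · left
      refine ⟨⟨by linarith, by linarith⟩, ?_, ?_⟩
      · rw [h3, h5]
      · rw [hx, h3]; simp
    · right
      refine ⟨2 * x - t, ⟨⟨by linarith, by linarith⟩, ?_, ?_⟩, by ring⟩
      · rw [show 2 * y - (2 * x - t) = t + 2 * (y - x) by ring, h4]; simpa using h5
      · rw [hy]; intro h; exact h5 h.symm
  exact (card_le_card this).trans ((card_union_le _ _).trans (add_le_add le_rfl card_image_le))

theorem Phi_eq (K : ℤ) (A : ℤ → Bool) : Phi K A A A = ∑ m ∈ Ico (-K) K, phi K A m := by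
  unfold Phi phi
  simp only [card_filter, sum_product_right]

/-- inversions in `Ico (-L) L` with gap at most `G` -/
def Inv (L G : ℤ) (A : ℤ → Bool) : Finset (ℤ × ℤ) :=
  {z ∈ Ico (-L) L ×ˢ Ico (-L) L | z.1 < z.2 ∧ z.2 - z.1 ≤ G ∧ A z.1 = true ∧ A z.2 = false}

theorem gapcount (S : Finset ℤ) (f : ℤ → ℕ) (T : Finset ℤ) :
    #{z ∈ S ×ˢ T | z.1 < z.2 ∧ z.2 - z.1 ≤ 2 * (f z.1 : ℤ)} ≤ 2 * ∑ x ∈ S, f x := by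
  rw [card_filter, sum_product, mul_sum]
  refine sum_le_sum fun x _ => ?_
  rw [← card_filter]
  calc _ ≤ #(Ioc x (x + 2 * f x)) := card_le_card fun y => by simp; omega
    _ = _ := by simp; omega

theorem gapcount' (S : Finset ℤ) (f : ℤ → ℕ) (T : Finset ℤ) :
    #{z ∈ S ×ˢ T | z.1 < z.2 ∧ z.2 - z.1 ≤ 2 * (f z.2 : ℤ)} ≤ 2 * ∑ x ∈ T, f x := by
  rw [card_filter, sum_product_right, mul_sum]
  refine sum_le_sum fun x _ => ?_
  rw [← card_filter]
  calc _ ≤ #(Ico (x - 2 * f x) x) := card_le_card fun y => by simp; omega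
    _ = _ := by simp; omega

theorem Inv_small (A : ℤ → Bool) (P H G : ℤ) (hP : 0 < P) (hH0 : 0 < H) (hG : 4 * G ≤ H) (hT : Tail P H A) :
    #(Inv (P + H) G A) ≤ 4 * Phi (4 * (P + H)) A A A := by
  have hsub : Ico (-(P + H)) (P + H) ⊆ Ico (-(4 * (P + H))) (4 * (P + H)) :=
    Ico_subset_Ico (by linarith) (by linarith)
  have hs : ∑ x ∈ Ico (-(P + H)) (P + H), phi (4 * (P + H)) A x ≤ Phi (4 * (P + H)) A A A := by
    rw [Phi_eq]; exact sum_le_sum_of_subset hsub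
  have : Inv (P + H) G A ⊆
    {z ∈ Ico (-(P + H)) (P + H) ×ˢ Ico (-(P + H)) (P + H) | z.1 < z.2 ∧ z.2 - z.1 ≤ 2 * phi (4 * (P + H)) A z.1} ∪
    {z ∈ Ico (-(P + H)) (P + H) ×ˢ Ico (-(P + H)) (P + H) | z.1 < z.2 ∧ z.2 - z.1 ≤ 2 * phi (4 * (P + H)) A z.2} := by
    rintro ⟨x, y⟩
    simp only [Inv, mem_filter, mem_union, mem_product, mem_Ico]
    rintro ⟨⟨⟨h1, h2⟩, h3, h4⟩, h5, h6, h7, h8⟩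
    have := invgap A P H x y hP h5 (by linarith) hT h7 h8 h1 h2
    by_cases h9 : y - x ≤ 2 * phi (4 * (P + H)) A x
    · left; exact ⟨⟨⟨h1, h2⟩, h3, h4⟩, h5, h9⟩
    · right; exact ⟨⟨⟨h1, h2⟩, h3, h4⟩, h5, by linarith⟩
  have h1 := (card_le_card this).trans (card_union_le _ _)
  have h2 := gapcount (Ico (-(P + H)) (P + H)) (phi (4 * (P + H)) A) (Ico (-(P + H)) (P + H))
  have h3 := gapcount' (Ico (-(P + H)) (P + H)) (phi (4 * (P + H)) A) (Ico (-(P + H)) (P + H))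
  linarith

theorem Inv_double (A : ℤ → Bool) (L G : ℤ) (hG : 1 ≤ G) :
    #(Inv L (2 * G) A) ≤ 4 * #(Inv L G A) := by
  have : Inv L (2 * G) A ⊆
     (((Inv L G A).image (fun z => (z.1, 2 * z.2 - z.1))) ∪ ((Inv L G A).image (fun z => (z.1, 2 * z.2 - z.1 + 1)))) ∪
     (((Inv L G A).image (fun z => (2 * z.1 - z.2, z.2))) ∪ ((Inv L G A).image (fun z => (2 * z.1 - z.2 + 1, z.2)))) := by
    rintro ⟨x, y⟩ h
    simp only [Inv, mem_filter, mem_product, mem_Ico] at h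
    obtain ⟨⟨⟨h1, h2⟩, h3, h4⟩, h5, h6, h7, h8⟩ := h
    have hz : ∃ z, x + y = 2 * z ∨ x + y = 2 * z + 1 := ⟨(x + y) / 2, by omega⟩
    obtain ⟨z, hz⟩ := hz
    simp only [mem_union, mem_image, Prod.mk.injEq, Prod.exists, Inv, mem_filter, mem_product, mem_Ico]
    cases hAz : A z
    · left
      have hne : x ≠ z := by rintro rfl; simp [h7] at hAz
      rcases hz with hz | hz
      · left; exact ⟨x, z, ⟨⟨⟨h1, h2⟩, by omega, by omega⟩, by omega, by omega, h7, hAz⟩, rfl, by omega⟩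
      · right; exact ⟨x, z, ⟨⟨⟨h1, h2⟩, by omega, by omega⟩, by omega, by omega, h7, hAz⟩, rfl, by omega⟩
    · right
      rcases hz with hz | hz
      · left; exact ⟨z, y, ⟨⟨by omega, by omega, by omega⟩, by omega, by omega, hAz, h8⟩, by omega, rfl⟩
      · right; exact ⟨z, y, ⟨⟨by omega, by omega, by omega⟩, by omega, by omega, hAz, h8⟩, by omega, rfl⟩
  have h1 := (card_le_card this).trans ((card_union_le _ _).trans (add_le_add (card_union_le _ _) (card_union_le _ _)))
  have h2 : ∀ f : ℤ × ℤ → ℤ × ℤ, #((Inv L G A).image f) ≤ #(Inv L G A) := fun f => card_image_le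
  linarith [h2 (fun z => (z.1, 2 * z.2 - z.1)), h2 (fun z => (z.1, 2 * z.2 - z.1 + 1)), h2 (fun z => (2 * z.1 - z.2, z.2)), h2 (fun z => (2 * z.1 - z.2 + 1, z.2))]

theorem Inv_pow (A : ℤ → Bool) (L G : ℤ) (hG : 1 ≤ G) (k : ℕ) :
    #(Inv L (2 ^ k * G) A) ≤ 4 ^ k * #(Inv L G A) := by
  induction k with
  | zero => simp
  | succ k ih =>
    have := Inv_double A L (2 ^ k * G) (by nlinarith [one_le_pow₀ (n := k) (show (1:ℤ) ≤ 2 by norm_num)])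
    rw [pow_succ, pow_succ, show (2:ℤ) ^ k * 2 * G = 2 * (2 ^ k * G) by ring]
    linarith
end
end NY

namespace NY
open Finset
noncomputable section

def NT (L : ℤ) (A : ℤ → Bool) (ψ : ℤ) (η : ℕ) : Prop :=
  #{t ∈ Ico (-L) ψ | A t = true} ≤ η ∧ #{t ∈ Ico ψ L | A t = false} ≤ η

theorem exists_NT (A : ℤ → Bool) (P H G : ℤ) (k e : ℕ) (hP : 0 < P) (hG : 1 ≤ G) (hGH : 4 * G ≤ H)
    (hk : 2 * (P + H) ≤ 2 ^ k * G) (hT : Tail P H A) (hΦ : Phi (4 * (P + H)) A A A ≤ e ^ 2) :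
    ∃ ψ, NT (P + H) A ψ (2 ^ (k + 1) * e) ∧ -(16 * P + H) ≤ 16 * ψ ∧ 16 * ψ ≤ 16 * P + H := by
  set L := P + H with hL
  obtain ⟨z, hz⟩ : ∃ z, z = #{t ∈ Ico (-L) L | A t = false} := ⟨_, rfl⟩
  have c0 := compl_card A (-L) (2 * L) (by linarith)
  rw [show -L + 2 * L = L by ring, ← hz] at c0
  have c1 := compl_card A P H (by linarith)
  have c2 := compl_card A (-P - H + 1) H (by linarith)
  rw [show -P - H + 1 + H = -P + 1 by ring] at c2
  have i1 : (#{t ∈ Ico P (P + H) | A t = true} : ℤ) ≤ #{t ∈ Ico (-L) L | A t = true} := by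
    exact_mod_cast card_le_card (filter_subset_filter _ (Ico_subset_Ico (by linarith) (by linarith)))
  have i2 : (#{t ∈ Ico (-P - H + 1) (-P + 1) | A t = false} : ℤ) ≤ z := by
    rw [hz]
    exact_mod_cast card_le_card (filter_subset_filter _ (Ico_subset_Ico (by linarith) (by linarith)))
  have t1 := hT.1
  have t2 := hT.2
  have hzL : -L + z ≤ L := by omega
  refine ⟨-L + z, ?_, by omega, by omega⟩
  have s0 : (z : ℤ) = #{t ∈ Ico (-L) (-L + z) | A t = false} + #{t ∈ Ico (-L + z) L | A t = false} := by
    nth_rw 1 [hz]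
    rw [← Nat.cast_add, ← card_union_of_disjoint]
    · congr 2
      rw [← filter_union]
      congr 1
      ext t
      simp only [mem_Ico, mem_union]
      omega
    · rw [disjoint_left]
      intro t ht ht'
      simp only [mem_filter, mem_Ico] at ht ht'
      linarith
  have s1 := compl_card A (-L) z (by positivity)
  have heq : #{t ∈ Ico (-L) (-L + z) | A t = true} = #{t ∈ Ico (-L + z) L | A t = false} := by
    have : (#{t ∈ Ico (-L) (-L + z) | A t = true} : ℤ) = #{t ∈ Ico (-L + z) L | A t = false} := by linarith
    exact_mod_cast this
  have hI : #{t ∈ Ico (-L) (-L + z) | A t = true} * #{t ∈ Ico (-L + z) L | A t = false} ≤ #(Inv L (2 ^ k * G) A) := by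
    rw [← card_product]
    apply card_le_card
    rintro ⟨x, y⟩
    simp only [Inv, mem_filter, mem_product, mem_Ico]
    rintro ⟨⟨⟨h1, h2⟩, h3⟩, ⟨⟨h4, h5⟩, h6⟩⟩
    exact ⟨⟨⟨h1, by linarith⟩, by linarith, h5⟩, by linarith, by linarith, h3, h6⟩
  have h1 := Inv_pow A L G hG k
  have h2 := Inv_small A P H G hP (by linarith) hGH hT
  rw [← hL] at h2
  have h3 : #{t ∈ Ico (-L) (-L + z) | A t = true} ^ 2 ≤ (2 ^ (k + 1) * e) ^ 2 := by
    rw [sq]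
    nth_rw 2 [heq]
    calc _ ≤ _ := hI
      _ ≤ 4 ^ k * (4 * e ^ 2) := h1.trans (Nat.mul_le_mul le_rfl (h2.trans (Nat.mul_le_mul le_rfl hΦ)))
      _ = _ := by rw [show (4:ℕ) = 2 ^ 2 by norm_num, ← pow_mul]; ring
  have h4 := (Nat.pow_le_pow_iff_left (by norm_num)).1 h3
  exact ⟨h4, heq ▸ h4⟩

theorem cardmul {α : Type*} (S : Finset α) (g : α → ℤ) (f : α → ℕ) (X : Finset ℤ) (D : ℕ)
    (h1 : ∀ a ∈ S, g a ∈ X) (h2 : ∀ a ∈ S, f a < D)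
    (h3 : ∀ a ∈ S, ∀ b ∈ S, g a = g b → f a = f b → a = b) (η : ℕ) (hX : #X ≤ η) : #S ≤ η * D := by
  calc #S ≤ #(X ×ˢ range D) := card_le_card_of_injOn (fun a => (g a, f a))
        (fun a ha => by simpa using ⟨h1 a ha, h2 a ha⟩)
        (fun a ha b hb hab => by simp at hab; exact h3 a ha b hb hab.1 hab.2)
    _ ≤ _ := by rw [card_product, card_range]; exact Nat.mul_le_mul hX le_rfl

theorem grid (A B C : ℤ → Bool) (P H α β γ : ℤ) (η D : ℕ) (hP : 0 < P) (hH : 0 < H)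
    (hA : NT (P + H) A α η) (hB : NT (P + H) B β η) (hC : NT (P + H) C γ η)
    (hα : -(16 * P + H) ≤ 16 * α) (hα' : 16 * α ≤ 16 * P + H)
    (hβ : -(16 * P + H) ≤ 16 * β)
    (hγ : -(16 * P + H) ≤ 16 * γ) (hγ' : 16 * γ ≤ 16 * P + H)
    (hD : 4 * (D : ℤ) ≤ α + γ - 2 * β + 1) (hDH : 4 * (D : ℤ) ≤ H) :
    D ^ 2 ≤ Phi (4 * (P + H)) A B C + 3 * (η * D) := by
  obtain ⟨m0, c, hc1, hc2, hm⟩ : ∃ m0 c : ℤ, 1 ≤ c ∧ c ≤ 2 ∧ α - 1 + (γ - c) = 2 * m0 := by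
    rcases Int.even_or_odd (α - 1 + (γ - 1)) with ⟨r, hr⟩ | ⟨r, hr⟩
    · exact ⟨r, 1, by omega, by omega, by omega⟩
    · exact ⟨r, 2, by omega, by omega, by omega⟩
  have hsub : (range D ×ˢ range D : Finset (ℕ × ℕ)) ⊆
     (({z ∈ range D ×ˢ range D | A (α - 1 - z.1) = true}) ∪
     ({z ∈ range D ×ˢ range D | C (γ - c - z.1 - 2 * z.2) = true})) ∪
     (({z ∈ range D ×ˢ range D | B (m0 - z.1 - z.2) = false}) ∪
     ({z ∈ range D ×ˢ range D | bad3 A B C (α - 1 - z.1) (m0 - z.1 - z.2)})) := by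
    rintro ⟨i, j⟩ hij
    simp only [mem_union, mem_filter, hij, true_and]
    unfold bad3
    rw [show 2 * (m0 - i - j) - (α - 1 - i) = γ - c - i - 2 * j by linarith]
    cases A (α - 1 - i) <;> cases C (γ - c - i - 2 * j) <;> cases B (m0 - i - j) <;> simp
  have b1 : #{z ∈ range D ×ˢ range D | A (α - 1 - z.1) = true} ≤ η * D := by
    refine cardmul _ (fun z => α - 1 - z.1) (fun z => z.2) _ D ?_ ?_ ?_ η hA.1
    · rintro ⟨i, j⟩; simp; intro hi hj h; exact ⟨⟨by omega, by omega⟩, h⟩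
    · rintro ⟨i, j⟩; simp; omega
    · rintro ⟨i, j⟩ _ ⟨i', j'⟩ _; simp; tauto
  have b2 : #{z ∈ range D ×ˢ range D | C (γ - c - z.1 - 2 * z.2) = true} ≤ η * D := by
    refine cardmul _ (fun z => γ - c - z.1 - 2 * z.2) (fun z => z.2) _ D ?_ ?_ ?_ η hC.1
    · rintro ⟨i, j⟩; simp; intro hi hj h; exact ⟨⟨by omega, by omega⟩, h⟩
    · rintro ⟨i, j⟩; simp; omega
    · rintro ⟨i, j⟩ _ ⟨i', j'⟩ _; simp; omega
  have b3 : #{z ∈ range D ×ˢ range D | B (m0 - z.1 - z.2) = false} ≤ η * D := by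
    refine cardmul _ (fun z => m0 - z.1 - z.2) (fun z => z.2) _ D ?_ ?_ ?_ η hB.2
    · rintro ⟨i, j⟩; simp; intro hi hj h; exact ⟨⟨by omega, by omega⟩, h⟩
    · rintro ⟨i, j⟩; simp; omega
    · rintro ⟨i, j⟩ _ ⟨i', j'⟩ _; simp; omega
  have b4 : #{z ∈ range D ×ˢ range D | bad3 A B C (α - 1 - z.1) (m0 - z.1 - z.2)} ≤ Phi (4 * (P + H)) A B C := by
    refine card_le_card_of_injOn (fun z => (α - 1 - z.1, m0 - z.1 - z.2)) ?_ ?_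
    · rintro ⟨i, j⟩; simp; intro hi hj h; exact ⟨⟨⟨by omega, by omega⟩, by omega, by omega⟩, h⟩
    · rintro ⟨i, j⟩ _ ⟨i', j'⟩ _; simp; omega
  have h1 := (card_le_card hsub).trans ((card_union_le _ _).trans (add_le_add (card_union_le _ _) (card_union_le _ _)))
  rw [card_product, card_range] at h1
  nlinarith

theorem Delta_le (A B C : ℤ → Bool) (P α β γ : ℤ) (N c e : ℕ) (hP : 0 < P)
    (hc : (3 * c + 1) * e < N) (hN : 1 ≤ N)
    (hA : NT (P + 8 * N) A α (c * e)) (hB : NT (P + 8 * N) B β (c * e)) (hC : NT (P + 8 * N) C γ (c * e))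
    (hα : -(16 * P + 8 * N) ≤ 16 * α) (hα' : 16 * α ≤ 16 * P + 8 * N)
    (hβ : -(16 * P + 8 * N) ≤ 16 * β)
    (hγ : -(16 * P + 8 * N) ≤ 16 * γ) (hγ' : 16 * γ ≤ 16 * P + 8 * N)
    (hΦ : Phi (4 * (P + 8 * N)) A B C ≤ e ^ 2) :
    α + γ - 2 * β ≤ 4 * ((3 * c + 1) * e) + 3 := by
  by_contra hcon
  push Not at hcon
  set D := (3 * c + 1) * e + 1 with hD
  have := grid A B C P (8 * N) α β γ (c * e) D hP (by linarith) hA hB hC hα hα' hβ hγ hγ' (by push_cast [hD]; linarith) (by omega)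
  have h2 : e * e ≤ e * D := Nat.mul_le_mul le_rfl (by rw [hD]; nlinarith)
  nlinarith

def refl (A : ℤ → Bool) : ℤ → Bool := fun t => !A (-1 - t)

theorem refl_NT {L : ℤ} {A : ℤ → Bool} {ψ : ℤ} {η : ℕ} (h : NT L A ψ η) : NT L (refl A) (-ψ) η := by
  refine ⟨?_, ?_⟩
  · refine le_trans ?_ h.2
    refine card_le_card_of_injOn (fun t => -1 - t) ?_ (fun a _ b _ h => by simpa using h)
    intro t; simp [refl]; intro h1 h2 h3; exact ⟨⟨by omega, by omega⟩, h3⟩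
  · refine le_trans ?_ h.1
    refine card_le_card_of_injOn (fun t => -1 - t) ?_ (fun a _ b _ h => by simpa using h)
    intro t; simp [refl]; intro h1 h2 h3; exact ⟨⟨by omega, by omega⟩, h3⟩

theorem refl_Phi (K : ℤ) (A B C : ℤ → Bool) : Phi K (refl A) (refl B) (refl C) ≤ Phi K A B C := by
  refine card_le_card_of_injOn (fun z => (-1 - z.1, -1 - z.2)) ?_ (fun a _ b _ h => by
    simp at h; exact Prod.ext h.1 h.2)
  rintro ⟨p, m⟩
  simp only [mem_coe, mem_filter, mem_product, mem_Ico]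
  unfold bad3 refl
  rintro ⟨⟨⟨h1, h2⟩, h3, h4⟩, h5, h6⟩
  refine ⟨⟨⟨by omega, by omega⟩, by omega, by omega⟩, ?_, ?_⟩
  · rw [show 2 * (-1 - m) - (-1 - p) = -1 - (2 * m - p) by ring]; simpa using h5
  · simpa using h6

theorem Delta_abs (A B C : ℤ → Bool) (P α β γ : ℤ) (N c e : ℕ) (hP : 0 < P)
    (hc : (3 * c + 1) * e < N) (hN : 1 ≤ N)
    (hA : NT (P + 8 * N) A α (c * e)) (hB : NT (P + 8 * N) B β (c * e)) (hC : NT (P + 8 * N) C γ (c * e))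
    (hα : -(16 * P + 8 * N) ≤ 16 * α ∧ 16 * α ≤ 16 * P + 8 * N)
    (hβ : -(16 * P + 8 * N) ≤ 16 * β ∧ 16 * β ≤ 16 * P + 8 * N)
    (hγ : -(16 * P + 8 * N) ≤ 16 * γ ∧ 16 * γ ≤ 16 * P + 8 * N)
    (hΦ : Phi (4 * (P + 8 * N)) A B C ≤ e ^ 2) :
    |α + γ - 2 * β| ≤ 4 * ((3 * c + 1) * e) + 3 := by
  rw [abs_le]
  have h1 := Delta_le A B C P α β γ N c e hP hc hN hA hB hC hα.1 hα.2 hβ.1 hγ.1 hγ.2 hΦ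
  have h2 := Delta_le (refl A) (refl B) (refl C) P (-α) (-β) (-γ) N c e hP hc hN (refl_NT hA) (refl_NT hB) (refl_NT hC)
    (by linarith) (by linarith) (by linarith) (by linarith) (by linarith) ((refl_Phi _ _ _ _).trans hΦ)
  constructor <;> linarith

/-- The one-dimensional `L²` lemma. `F l 0, F l 1, F l 2` are the fibres over `0, w_l, -w_l`. -/
theorem oneD (F : Fin 3 → Fin 3 → ℤ → Bool) (P : ℤ) (N k κ e : ℕ) (hP : 0 < P) (hN : 1 ≤ N)
    (hκ : P ≤ κ * N) (hk : P + 8 * N ≤ 2 ^ k * N) (he : 1 ≤ e)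
    (hT : ∀ l δ, Tail P (8 * N) (F l δ))
    (h1 : ∀ l δ, Phi (4 * (P + 8 * N)) (F l δ) (F l δ) (F l δ) ≤ e ^ 2)
    (h2 : ∀ l, Phi (4 * (P + 8 * N)) (F l 2) (F l 0) (F l 1) ≤ e ^ 2)
    (h3 : ∀ δ, δ ≠ 0 → Phi (4 * (P + 8 * N)) (F 0 δ) (F 1 δ) (F 2 δ) ≤ e ^ 2) :
    #{t ∈ Ico (-P) P | F 0 0 t = false ∧ F 1 0 t = true ∧ F 2 0 t = false} ≤
      (2 * κ + 14) * (3 * 2 ^ (k + 1) + 1) * e := by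
  set c := 2 ^ (k + 1) with hcdef
  have hNT : ∀ l δ, ∃ ψ, NT (P + 8 * N) (F l δ) ψ (c * e) ∧ -(16 * P + 8 * N) ≤ 16 * ψ ∧ 16 * ψ ≤ 16 * P + 8 * N :=
    fun l δ => exists_NT (F l δ) P (8 * N) (2 * N) k e hP (by omega) (by omega) (by nlinarith) (hT l δ) (h1 l δ)
  choose ψ hψ hb using hNT
  rcases le_or_gt N ((3 * c + 1) * e) with hle | hc
  · have : #{t ∈ Ico (-P) P | F 0 0 t = false ∧ F 1 0 t = true ∧ F 2 0 t = false} ≤ 2 * (κ * N) := by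
      refine (card_filter_le _ _).trans ?_
      rw [Int.card_Ico]
      zify; omega
    refine this.trans ?_
    have := Nat.mul_le_mul (le_refl (2 * κ)) hle
    nlinarith
  · have d1 : ∀ l, |ψ l 2 + ψ l 1 - 2 * ψ l 0| ≤ 4 * ((3 * c + 1) * e) + 3 := fun l =>
      Delta_abs _ _ _ P _ _ _ N c e hP hc hN (hψ l 2) (hψ l 0) (hψ l 1) (hb l 2) (hb l 0) (hb l 1) (h2 l)
    have d2 : ∀ δ, δ ≠ 0 → |ψ 0 δ + ψ 2 δ - 2 * ψ 1 δ| ≤ 4 * ((3 * c + 1) * e) + 3 := fun δ hδ =>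
      Delta_abs _ _ _ P _ _ _ N c e hP hc hN (hψ 0 δ) (hψ 1 δ) (hψ 2 δ) (hb 0 δ) (hb 1 δ) (hb 2 δ) (h3 δ hδ)
    have a0 := abs_le.1 (d1 0)
    have a1 := abs_le.1 (d1 1)
    have a2 := abs_le.1 (d1 2)
    have a3 := abs_le.1 (d2 1 (by decide))
    have a4 := abs_le.1 (d2 2 (by decide))
    have hX : 2 * (ψ 0 0 + ψ 2 0 - 2 * ψ 1 0) ≤ 6 * (4 * ((3 * c + 1) * e) + 3) := by linarith
    have hsub : ({t ∈ Ico (-P) P | F 0 0 t = false ∧ F 1 0 t = true ∧ F 2 0 t = false} : Finset ℤ) ⊆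
       ({t ∈ Ico (ψ 0 0) (P + 8 * N) | F 0 0 t = false} ∪ {t ∈ Ico (-(P + 8 * N)) (ψ 1 0) | F 1 0 t = true}) ∪
       ({t ∈ Ico (ψ 2 0) (P + 8 * N) | F 2 0 t = false} ∪ Ico (ψ 1 0) (min (ψ 0 0) (ψ 2 0))) := by
      intro t
      simp only [mem_union, mem_filter, mem_Ico, lt_min_iff]
      rintro ⟨⟨t1, t2⟩, t3, t4, t5⟩
      simp only [t3, t4, t5, and_true]
      omega
    have h1 := (card_le_card hsub).trans ((card_union_le _ _).trans (add_le_add (card_union_le _ _) (card_union_le _ _)))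
    have c1 := (hψ 0 0).2
    have c2 := (hψ 1 0).1
    have c3 := (hψ 2 0).2
    have hpos : 1 ≤ (3 * c + 1) * e := by nlinarith
    have c4 : #(Ico (ψ 1 0) (min (ψ 0 0) (ψ 2 0))) ≤ 11 * ((3 * c + 1) * e) := by
      rw [Int.card_Ico]
      have hmin : 2 * min (ψ 0 0) (ψ 2 0) ≤ ψ 0 0 + ψ 2 0 := by
        linarith [min_le_left (ψ 0 0) (ψ 2 0), min_le_right (ψ 0 0) (ψ 2 0)]
      zify
      zify at hpos
      omega
    nlinarith
end
end NY

namespace NY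
open Finset
noncomputable section
open scoped Classical
set_option linter.all false

def NM (M : ℕ) (s : ℕ → Bool) : Prop := ∃ i j k, i < j ∧ j < k ∧ k ≤ M ∧ s i = s k ∧ s j ≠ s i
def ind (p : Prop) : ℕ := if p then 1 else 0
theorem ind_mono {p q : Prop} (h : p → q) : ind p ≤ ind q := by
  unfold ind; split_ifs <;> simp_all
theorem ind_le_one (p : Prop) : ind p ≤ 1 := by unfold ind; split_ifs <;> simp
theorem ind_true {p : Prop} (h : p) : ind p = 1 := by simp [ind, h]
theorem ind_false {p : Prop} (h : ¬ p) : ind p = 0 := by simp [ind, h]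
theorem card_ind {α : Type*} (S : Finset α) (p : α → Prop) : #{x ∈ S | p x} = ∑ x ∈ S, ind (p x) := by
  rw [card_filter]; rfl

theorem changes_le (M : ℕ) (s : ℕ → Bool) :
    ∑ i ∈ range M, ind (s i ≠ s (i + 1)) ≤ 1 + M * ind (NM M s) := by
  by_cases h : NM M s
  · rw [ind_true h]
    calc _ ≤ ∑ i ∈ range M, 1 := sum_le_sum fun _ _ => ind_le_one _
      _ ≤ _ := by simp
  · rw [ind_false h, ← card_ind, mul_zero, add_zero, card_le_one]
    have key : ∀ a b, a < b → b < M → s a ≠ s (a + 1) → s b ≠ s (b + 1) → False := by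
      intro a b hab hb h1 h2
      apply h
      by_cases h3 : s (a + 1) = s b
      · refine ⟨a, a + 1, b + 1, by omega, by omega, by omega, ?_, h1.symm⟩
        rw [h3] at h1
        revert h1 h2; cases s a <;> cases s b <;> cases s (b + 1) <;> simp
      · have : a + 1 < b := by
          rcases Nat.lt_or_ge (a + 1) b with h | h
          · exact h
          · exact absurd (by rw [show b = a + 1 by omega]) h3
        refine ⟨a, a + 1, b, by omega, this, by omega, ?_, h1.symm⟩
        revert h1 h3; cases s a <;> cases s b <;> cases s (a + 1) <;> simp
    intro a ha b hb
    simp only [mem_filter, mem_range] at ha hb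
    rcases lt_trichotomy a b with h1 | h1 | h1
    · exact (key a b h1 hb.1 ha.2 hb.2).elim
    · exact h1
    · exact (key b a h1 ha.1 hb.2 ha.2).elim

section
variable {V : Type*} [AddCommGroup V] (ω : V →ₗ[ℤ] V →ₗ[ℤ] ℤ) (M : ℕ) (Ψ : V → ℤ → Bool)

def Fail (τ : V × ℤ × V) : Prop :=
  NM M (fun n => Ψ (τ.1 + (n : ℤ) • τ.2.2) (τ.2.1 + n * ω τ.1 τ.2.2))

theorem not_fail {v u : V} {ζ : ℤ} (h : ¬ Fail ω M Ψ (v, ζ, u)) (i j k : ℕ) (v1 v2 v3 : V) (z1 z2 z3 : ℤ)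
    (hij : i < j) (hjk : j < k) (hk : k ≤ M)
    (e1 : v1 = v + (i : ℤ) • u) (e2 : v2 = v + (j : ℤ) • u) (e3 : v3 = v + (k : ℤ) • u)
    (f1 : z1 = ζ + i * ω v u) (f2 : z2 = ζ + j * ω v u) (f3 : z3 = ζ + k * ω v u) :
    Ψ v1 z1 = Ψ v3 z3 → Ψ v2 z2 = Ψ v1 z1 := by
  subst e1 e2 e3 f1 f2 f3
  intro h1
  by_contra h2
  exact h ⟨i, j, k, hij, hjk, hk, h1, h2⟩

def wv (w0 w1 : V) : Fin 3 → V := ![w0, w1, 2 • w1 - w0]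
def sg : Bool → ℤ := fun b => if b then 1 else -1
def gd : Fin 3 → ℤ := ![0, 1, -1]
/-- nine fibres -/
def Fib (b w0 w1 : V) (h : ℤ) (l δ : Fin 3) (t : ℤ) : Bool :=
  Ψ (t • ((2:ℤ) • b) + gd δ • wv w0 w1 l) ((l : ℕ) * h)

def vbad (h : ℤ) : Prop := Ψ 0 0 = false ∧ Ψ 0 h = true ∧ Ψ 0 (2 * h) = false

abbrev TI := Fin 5 × Fin 3 × Bool × Bool × Bool

def linTest (b w0 w1 : V) (h p d : ℤ) : TI → V × ℤ × V := fun ⟨κ, l, ε, δ, c⟩ =>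
  match κ with
  | 0 => (sg ε • ((if c then 2 * p else p) • b), (l : ℕ) * h, sg δ • wv w0 w1 l)
  | 1 => (-(2 * p) • b, (l : ℕ) * h, p • b)
  | 2 => (- wv w0 w1 l, (l : ℕ) * h, wv w0 w1 l)
  | 3 => if c then (sg ε • ((2 * p) • b) + sg δ • w0, 0, sg δ • (w1 - w0) - sg ε • (p • b))
     else (sg δ • w0, 0, sg δ • (w1 - w0) + sg ε • (p • b))
  | 4 => (p • b, h, d • b)

def smooth (b w0 w1 : V) (h p : ℤ) : Prop := ∀ l : Fin 3, ∀ ε δ c : Bool,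
  Ψ (sg ε • ((if c then 2 * p else p) • b)) ((l : ℕ) * h) =
  Ψ (sg ε • ((if c then 2 * p else p) • b) + sg δ • wv w0 w1 l) ((l : ℕ) * h)

def conc (b w0 w1 : V) (h p : ℤ) : Prop := ∀ l δ : Fin 3,
  Fib Ψ b w0 w1 h l δ p = Ψ (p • b) h ∧ Fib Ψ b w0 w1 h l δ (-p) = !Ψ (p • b) h

theorem slogic (hM : 4 ≤ M) (b w0 w1 : V) (h p d : ℤ) (hω : ∀ v, ω v v = 0)
    (hb0 : ω b w0 = 0) (hb1 : ω b w1 = 0) (h0b : ω w0 b = 0) (h01 : ω w0 w1 = h)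
    (hv : vbad Ψ h) (hs : smooth Ψ b w0 w1 h p)
    (ht : ∀ τ : TI, ¬ Fail ω M Ψ (linTest b w0 w1 h p d τ)) : conc Ψ b w0 w1 h p := by
  obtain ⟨v0, v1, v2⟩ := hv
  have L1 : ∀ (l : Fin 3) (i j k : ℕ), i < j → j < k → k ≤ M →
      Ψ (((i : ℤ) - 2) • (p • b)) ((l:ℕ) * h) = Ψ (((k : ℤ) - 2) • (p • b)) ((l:ℕ) * h) →
      Ψ (((j : ℤ) - 2) • (p • b)) ((l:ℕ) * h) = Ψ (((i : ℤ) - 2) • (p • b)) ((l:ℕ) * h) := by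
    intro l i j k hij hjk hk
    exact not_fail ω M Ψ (ht ⟨1, l, true, true, true⟩) i j k _ _ _ _ _ _ hij hjk hk
      (by module) (by module) (by module) (by simp [hω]) (by simp [hω]) (by simp [hω])
  have L2 : ∀ (l : Fin 3), Ψ (- wv w0 w1 l) ((l:ℕ) * h) = Ψ (wv w0 w1 l) ((l:ℕ) * h) →
      Ψ 0 ((l:ℕ) * h) = Ψ (- wv w0 w1 l) ((l:ℕ) * h) := by
    intro l
    exact not_fail ω M Ψ (ht ⟨2, l, true, true, true⟩) 0 1 2 _ _ _ _ _ _ (by omega) (by omega) (by omega)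
      (by simp) (by simp) (by module) (by simp) (by simp [hω]) (by simp [hω])
  have C0 : ∀ ε δ, Ψ (sg ε • ((2 * p) • b) + sg δ • w0) 0 = Ψ (sg δ • (2 • w1 - w0)) (2 * h) →
      Ψ (sg ε • (p • b) + sg δ • w1) h = Ψ (sg ε • ((2 * p) • b) + sg δ • w0) 0 := by
    intro ε δ
    refine not_fail ω M Ψ (ht ⟨3, 0, ε, δ, true⟩) 0 1 2 _ _ _ _ _ _ (by omega) (by omega) (by omega)
      (by simp) (by simp; module) (by simp; module) (by simp) ?_ ?_
    all_goals
      simp [hω, hb0, hb1, h0b, h01]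
      cases δ <;> simp [sg]
  have C2 : ∀ ε δ, Ψ (sg δ • w0) 0 = Ψ (sg ε • ((2 * p) • b) + sg δ • (2 • w1 - w0)) (2 * h) →
      Ψ (sg ε • (p • b) + sg δ • w1) h = Ψ (sg δ • w0) 0 := by
    intro ε δ
    refine not_fail ω M Ψ (ht ⟨3, 0, ε, δ, false⟩) 0 1 2 _ _ _ _ _ _ (by omega) (by omega) (by omega)
      (by simp) (by simp; module) (by simp; module) (by simp) ?_ ?_
    all_goals
      simp [hω, hb0, hb1, h0b, h01]
      cases δ <;> simp [sg]
  -- names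
  have s0 := fun ε δ => hs 0 ε δ true
  have s1 := fun ε δ => hs 1 ε δ false
  have s1' := fun ε δ => hs 1 ε δ true
  have s2 := fun ε δ => hs 2 ε δ true
  simp only [wv, Matrix.cons_val_zero, Matrix.cons_val_one, Matrix.cons_val, Fin.val_zero, Fin.val_one, Fin.val_two, Nat.cast_zero, zero_mul, Nat.cast_one, one_mul, Nat.cast_ofNat, if_true, if_false, Bool.false_eq_true] at s0 s1 s1' s2
  have l0 := L2 0
  have l2 := L2 2
  simp only [wv, Matrix.cons_val_zero, Matrix.cons_val_one, Matrix.cons_val, Fin.val_zero, Fin.val_one, Fin.val_two, Nat.cast_zero, zero_mul, Nat.cast_one, one_mul, Nat.cast_ofNat, v0, v2] at l0 l2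
  have key0 : ∀ ε, Ψ (sg ε • (p • b)) h = true → Ψ (sg ε • ((2 * p) • b)) 0 = true := by
    intro ε he
    by_contra hc
    simp only [Bool.not_eq_true] at hc
    have q : ∀ δ, Ψ (sg δ • (2 • w1 - w0)) (2 * h) = true := by
      intro δ
      have := C0 ε δ
      rw [← s0, ← s1, hc, he] at this
      simpa using this
    have q1 := q true
    have q2 := q false
    simp only [sg, if_true, if_false, one_smul, neg_smul, Bool.false_eq_true] at q1 q2
    rw [q1, q2] at l2
    simp at l2
  have key2 : ∀ ε, Ψ (sg ε • (p • b)) h = true → Ψ (sg ε • ((2 * p) • b)) (2 * h) = true := by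
    intro ε he
    by_contra hc
    simp only [Bool.not_eq_true] at hc
    have q : ∀ δ, Ψ (sg δ • w0) 0 = true := by
      intro δ
      have := C2 ε δ
      rw [← s2, ← s1, hc, he] at this
      revert this; cases Ψ (sg δ • w0) 0 <;> simp
    have q1 := q true
    have q2 := q false
    simp only [sg, if_true, if_false, one_smul, neg_smul, Bool.false_eq_true] at q1 q2
    rw [q1, q2] at l0
    simp at l0
  -- centre lines
  have a1 := L1 1 1 2 3 (by omega) (by omega) (by omega)
  have a2 := L1 1 0 2 4 (by omega) (by omega) (by omega)
  have a3 := L1 1 0 1 2 (by omega) (by omega) (by omega)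
  have a4 := L1 1 2 3 4 (by omega) (by omega) (by omega)
  have a5 := L1 0 0 2 4 (by omega) (by omega) (by omega)
  have a6 := L1 2 0 2 4 (by omega) (by omega) (by omega)
  have k0t := key0 true
  have k0f := key0 false
  have k2t := key2 true
  have k2f := key2 false
  have n1 : sg true • (p • b) = p • b := by simp [sg]
  have n2 : sg false • (p • b) = -p • b := by simp [sg]
  have n3 : sg true • ((2 * p) • b) = (2 * p) • b := by simp [sg]
  have n4 : sg false • ((2 * p) • b) = -(2 * p) • b := by simp [sg]
  have m0 : (((0:ℕ) : ℤ) - 2) • (p • b) = -(2 * p) • b := by push_cast; module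
  have m1 : (((1:ℕ) : ℤ) - 2) • (p • b) = -p • b := by push_cast; module
  have m2 : (((2:ℕ) : ℤ) - 2) • (p • b) = 0 := by simp
  have m3 : (((3:ℕ) : ℤ) - 2) • (p • b) = p • b := by push_cast; module
  have m4 : (((4:ℕ) : ℤ) - 2) • (p • b) = (2 * p) • b := by push_cast; module
  rw [n1, n3] at k0t k2t
  rw [n2, n4] at k0f k2f
  rw [m1, m2, m3] at a1
  rw [m0, m2, m4] at a2 a5 a6
  rw [m0, m1, m2] at a3
  rw [m2, m3, m4] at a4
  simp only [Fin.val_zero, Fin.val_one, Fin.val_two, Nat.cast_zero, zero_mul, Nat.cast_one, one_mul, Nat.cast_ofNat, v0, v1, v2] at a1 a2 a3 a4 a5 a6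
  have main : (Ψ ((2 * p) • b) 0 = Ψ (p • b) h ∧ Ψ (-(2 * p) • b) 0 = !Ψ (p • b) h) ∧
     (Ψ ((2 * p) • b) h = Ψ (p • b) h ∧ Ψ (-(2 * p) • b) h = !Ψ (p • b) h) ∧
     (Ψ ((2 * p) • b) (2 * h) = Ψ (p • b) h ∧ Ψ (-(2 * p) • b) (2 * h) = !Ψ (p • b) h) := by
    clear s0 s1 s1' s2 C0 C2 L1 L2 key0 key2 l0 l2 m0 m1 m2 m3 m4 n1 n2 n3 n4 hs ht
    revert a1 a2 a3 a4 a5 a6 k0t k0f k2t k2f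
    generalize Ψ ((2 * p) • b) 0 = x1
    generalize Ψ (-(2 * p) • b) 0 = x2
    generalize Ψ ((2 * p) • b) h = x3
    generalize Ψ (-(2 * p) • b) h = x4
    generalize Ψ ((2 * p) • b) (2 * h) = x5
    generalize Ψ (-(2 * p) • b) (2 * h) = x6
    generalize Ψ (p • b) h = x7
    generalize Ψ (-p • b) h = x8
    revert x1 x2 x3 x4 x5 x6 x7 x8
    decide
  have hfull : ∀ l : Fin 3, Ψ ((2 * p) • b) ((l : ℕ) * h) = Ψ (p • b) h ∧ Ψ (-(2 * p) • b) ((l:ℕ) * h) = !Ψ (p • b) h := by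
    intro l
    fin_cases l
    · simpa using main.1
    · simpa using main.2.1
    · simpa using main.2.2
  intro l δ
  obtain ⟨f1, f2⟩ := hfull l
  have t1 := fun δ => hs l true δ true
  have t2 := fun δ => hs l false δ true
  simp only [if_true] at t1 t2
  rw [n3] at t1
  rw [n4] at t2
  rw [f1] at t1
  rw [f2] at t2
  have r1 : p • ((2:ℤ) • b) = (2 * p) • b := by module
  have r2 : (-p) • ((2:ℤ) • b) = -(2 * p) • b := by module
  unfold Fib
  rw [r1, r2]
  fin_cases δ
  · constructor
    · simpa [gd] using f1
    · simpa [gd] using f2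
  · have u1 := t1 true
    have u2 := t2 true
    simp only [sg, if_true] at u1 u2
    exact ⟨u1.symm, u2.symm⟩
  · have u1 := t1 false
    have u2 := t2 false
    simp only [sg, if_false, Bool.false_eq_true] at u1 u2
    exact ⟨u1.symm, u2.symm⟩
end
end
end NY

namespace NY
open Finset
noncomputable section
open scoped Classical
set_option linter.all false

theorem shiftcount {α : Type*} (T : ℤ → α → α) (hadd : ∀ s t a, T (s + t) a = T s (T t a))
    (h0 : ∀ a, T 0 a = a) (A A' : Finset α) (g : α → Bool) (M : ℕ)
    (hsub : ∀ n : ℕ, n < M → ∀ a ∈ A, T (-n) a ∈ A') :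
    M * ∑ a ∈ A, ind (g a ≠ g (T 1 a)) ≤ ∑ a ∈ A', (1 + M * ind (NM M (fun n => g (T n a)))) := by
  calc M * ∑ a ∈ A, ind (g a ≠ g (T 1 a)) = ∑ n ∈ range M, ∑ a ∈ A, ind (g a ≠ g (T 1 a)) := by simp
    _ ≤ ∑ n ∈ range M, ∑ a ∈ A', ind (g (T n a) ≠ g (T ((n + 1 : ℕ) : ℤ) a)) := by
      refine sum_le_sum fun n hn => ?_
      have hinj : Set.InjOn (T (-n)) (A : Set α) := by
        intro a _ b _ hab
        have := congrArg (T n) hab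
        simpa [← hadd, h0] using this
      calc _ = ∑ a ∈ A.image (T (-n)), ind (g (T n a) ≠ g (T ((n + 1 : ℕ) : ℤ) a)) := by
            rw [sum_image hinj]
            refine sum_congr rfl fun a _ => ?_
            rw [← hadd, ← hadd]
            push_cast
            rw [show (n:ℤ) + -n = 0 by ring, show (n:ℤ) + 1 + -n = 1 by ring, h0]
        _ ≤ _ := sum_le_sum_of_subset (by
            intro a ha
            obtain ⟨b, hb, rfl⟩ := mem_image.1 ha
            exact hsub n (mem_range.1 hn) b hb)
    _ = ∑ a ∈ A', ∑ n ∈ range M, ind (g (T n a) ≠ g (T ((n + 1 : ℕ) : ℤ) a)) := sum_comm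
    _ ≤ _ := sum_le_sum fun a _ => changes_le M (fun n => g (T n a))

theorem apcount (s : ℤ → Bool) (P H d : ℤ) (M : ℕ) (hH : 0 < H) (hd : H ≤ d) (hd3 : d ≤ 3 * H) (hM : 514 ≤ M) :
    (∑ p ∈ Ico P (P + 512 * H), ind (s p ≠ s (p + d)) : ℤ) ≤
      d + M * ∑ r ∈ Ico P (P + 514 * H), ind (NM M (fun n => s (r + n * d))) := by
  have hdpos : 0 < d := by linarith
  have h1 : ∑ p ∈ Ico P (P + 512 * H), ind (s p ≠ s (p + d)) ≤
      ∑ z ∈ Ico P (P + d) ×ˢ range M, ind (s (z.1 + z.2 * d) ≠ s (z.1 + ((z.2 + 1 : ℕ) : ℤ) * d)) := by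
    have hinj : Set.InjOn (fun p => (P + (p - P) % d, ((p - P) / d).toNat)) (Ico P (P + 512 * H) : Set ℤ) := by
      intro a ha b hb hab
      simp only [Prod.mk.injEq, coe_Ico, Set.mem_Ico] at hab ha hb
      have e1 := Int.emod_add_mul_ediv (a - P) d
      have e2 := Int.emod_add_mul_ediv (b - P) d
      have e3 := Int.ediv_nonneg (show 0 ≤ a - P by linarith) hdpos.le
      have e4 := Int.ediv_nonneg (show 0 ≤ b - P by linarith) hdpos.le
      have e5 : (a - P) / d = (b - P) / d := by omega
      rw [e5] at e1
      linarith [hab.1]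
    calc _ = ∑ z ∈ (Ico P (P + 512 * H)).image (fun p => (P + (p - P) % d, ((p - P) / d).toNat)),
          ind (s (z.1 + z.2 * d) ≠ s (z.1 + ((z.2 + 1 : ℕ) : ℤ) * d)) := by
          rw [sum_image hinj]
          refine sum_congr rfl fun p hp => ?_
          have e1 := Int.emod_add_mul_ediv (p - P) d
          have e3 := Int.ediv_nonneg (show 0 ≤ p - P by linarith [(mem_Ico.1 hp).1]) hdpos.le
          have e4 : (((p - P) / d).toNat : ℤ) = (p - P) / d := Int.toNat_of_nonneg e3
          simp only [Nat.cast_add, e4, Nat.cast_one]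
          rw [show P + (p - P) % d + (p - P) / d * d = p by linarith,
            show P + (p - P) % d + ((p - P) / d + 1) * d = p + d by linarith]
      _ ≤ _ := sum_le_sum_of_subset (by
          intro z hz
          obtain ⟨p, hp, rfl⟩ := mem_image.1 hz
          rw [mem_Ico] at hp
          have e1 := Int.emod_lt_of_pos (p - P) hdpos
          have e2 := Int.emod_nonneg (p - P) hdpos.ne'
          have e3 : (p - P) / d < 512 := Int.ediv_lt_of_lt_mul hdpos (by linarith)
          simp only [mem_product, mem_Ico, mem_range]
          refine ⟨⟨by linarith, by linarith⟩, by omega⟩)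
  rw [sum_product] at h1
  have h2 := h1.trans (sum_le_sum fun r _ => changes_le M (fun n => s (r + n * d)))
  rw [sum_add_distrib, ← mul_sum] at h2
  simp only [sum_const, Int.card_Ico, smul_eq_mul, mul_one] at h2
  have h3 : ∑ r ∈ Ico P (P + d), ind (NM M (fun n => s (r + n * d))) ≤ ∑ r ∈ Ico P (P + 514 * H), ind (NM M (fun n => s (r + n * d))) :=
    sum_le_sum_of_subset (Ico_subset_Ico le_rfl (by linarith))
  have h4 := h2.trans (add_le_add le_rfl (Nat.mul_le_mul le_rfl h3))
  zify at h4
  rw [show P + d - P = d by ring, Int.toNat_of_nonneg hdpos.le] at h4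
  exact_mod_cast h4

theorem Ico_split (f : ℤ → ℕ) (a b c : ℤ) (h1 : a ≤ b) (h2 : b ≤ c) :
    ∑ x ∈ Ico a c, f x = ∑ x ∈ Ico a b, f x + ∑ x ∈ Ico b c, f x := by
  rw [← sum_union]
  · congr 1; ext; simp; omega
  · rw [disjoint_left]; intro t; simp; omega

theorem minority (s : ℤ → Bool) (P Q H : ℤ) (hH : 0 < H)
    (h : 64 * (∑ p ∈ Ico P (P + H), ∑ q ∈ Ico Q (Q + H), ind (s p ≠ s q) : ℤ) ≤ H ^ 2) :
    ∃ σ, 64 * (#{p ∈ Ico P (P + H) | s p ≠ σ} : ℤ) ≤ H := by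
  set b : ℤ := ((#{p ∈ Ico P (P + H) | s p = true} : ℕ) : ℤ) with hb
  set b' : ℤ := ((#{p ∈ Ico Q (Q + H) | s p = true} : ℕ) : ℤ) with hb'
  have c1 := compl_card s P H hH.le
  have c2 := compl_card s Q H hH.le
  rw [← hb] at c1
  rw [← hb'] at c2
  have e : (∑ p ∈ Ico P (P + H), ∑ q ∈ Ico Q (Q + H), (ind (s p ≠ s q) : ℤ)) = b * (H - b') + (H - b) * b' := by
    have : ∀ p, (∑ q ∈ Ico Q (Q + H), (ind (s p ≠ s q) : ℤ)) = if s p = true then H - b' else b' := by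
      intro p
      rw [← Nat.cast_sum, ← card_ind]
      cases s p
      · simp only [Bool.false_eq_true, if_false, hb']; congr 2; ext q; cases s q <;> simp
      · simp only [if_true]; rw [show H - b' = ((#{t ∈ Ico Q (Q + H) | s t = false} : ℕ) : ℤ) by linarith]; congr 2; ext q; cases s q <;> simp
    rw [sum_congr rfl fun p _ => this p, sum_ite]
    simp only [sum_const, nsmul_eq_mul, Bool.not_eq_true]
    rw [← hb, show (#{p ∈ Ico P (P + H) | s p = false} : ℤ) = H - b by linarith]
  rw [e] at h
  have hb0 : 0 ≤ b := by positivity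
  have hb0' : 0 ≤ b' := by positivity
  have z1 : (0:ℤ) ≤ #{p ∈ Ico P (P + H) | s p = false} := by positivity
  have z2 : (0:ℤ) ≤ #{p ∈ Ico Q (Q + H) | s p = false} := by positivity
  rcases le_total (2 * b) H with h1 | h1
  · refine ⟨false, ?_⟩
    simp only [ne_eq, Bool.not_eq_false]
    rw [← hb]
    nlinarith
  · refine ⟨true, ?_⟩
    simp only [ne_eq, Bool.not_eq_true]
    have : 64 * (H - b) ≤ H := by nlinarith
    linarith

theorem orient (s : ℤ → Bool) (P H : ℤ) (M : ℕ) (hH : 0 < H) (hM : 514 ≤ M)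
    (hF : (M : ℤ) * ∑ r ∈ Ico P (P + 514 * H), ∑ d ∈ Ico H (3 * H), ind (NM M (fun n => s (r + n * d))) ≤ 2 * H ^ 2) :
    ∃ i : ℕ, i < 512 ∧ ∃ σ, 64 * (#{p ∈ Ico (P + i * H) (P + i * H + H) | s p ≠ σ} : ℤ) ≤ H := by
  by_contra hcon
  push Not at hcon
  have h1 : ∀ k : ℕ, k ≤ 512 → (k : ℤ) * (H ^ 2 + 1) ≤
      64 * (∑ p ∈ Ico P (P + k * H), ∑ d ∈ Ico H (3 * H), ind (s p ≠ s (p + d)) : ℕ) := by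
    intro k
    induction k with
    | zero => simp
    | succ k ih =>
      intro hk
      have h2 := ih (by omega)
      have h3 : H ^ 2 + 1 ≤ 64 * ((∑ p ∈ Ico (P + k * H) (P + k * H + H), ∑ q ∈ Ico (P + k * H + 2 * H) (P + k * H + 2 * H + H), ind (s p ≠ s q) : ℕ) : ℤ) := by
        by_contra h4
        push Not at h4
        obtain ⟨σ, h5⟩ := minority s (P + k * H) (P + k * H + 2 * H) H hH (by push_cast at h4 ⊢; linarith)
        exact absurd h5 (not_le.2 (hcon k (by omega) σ))
      have h4 : ∑ p ∈ Ico (P + k * H) (P + k * H + H), ∑ q ∈ Ico (P + k * H + 2 * H) (P + k * H + 2 * H + H), ind (s p ≠ s q)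
          ≤ ∑ p ∈ Ico (P + k * H) (P + k * H + H), ∑ d ∈ Ico H (3 * H), ind (s p ≠ s (p + d)) := by
        refine sum_le_sum fun p hp => ?_
        rw [mem_Ico] at hp
        calc _ = ∑ d ∈ (Ico (P + k * H + 2 * H) (P + k * H + 2 * H + H)).image (fun q => q - p), ind (s p ≠ s (p + d)) := by
              rw [sum_image (fun a _ b _ h => by simpa using h)]
              simp
          _ ≤ _ := sum_le_sum_of_subset (by
              intro d hd
              obtain ⟨q, hq, rfl⟩ := mem_image.1 hd
              rw [mem_Ico] at hq ⊢
              constructor <;> linarith)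
      have h5 := Ico_split (fun p => ∑ d ∈ Ico H (3 * H), ind (s p ≠ s (p + d))) P (P + k * H) (P + ((k + 1 : ℕ) : ℤ) * H)
        (by nlinarith [Int.natCast_nonneg k]) (by push_cast; nlinarith)
      rw [h5, show P + ((k + 1 : ℕ) : ℤ) * H = P + k * H + H by push_cast; ring]
      zify at h4
      push_cast at h4 h3 h2 ⊢
      linarith
  have h2 := h1 512 le_rfl
  have h3 : (∑ p ∈ Ico P (P + (512:ℕ) * H), ∑ d ∈ Ico H (3 * H), (ind (s p ≠ s (p + d)) : ℤ)) ≤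
      ∑ d ∈ Ico H (3 * H), (3 * H + M * ∑ r ∈ Ico P (P + 514 * H), (ind (NM M (fun n => s (r + n * d))) : ℤ)) := by
    rw [sum_comm]
    refine sum_le_sum fun d hd => ?_
    rw [mem_Ico] at hd
    have := apcount s P H d M hH hd.1 hd.2.le hM
    push_cast at this ⊢
    linarith
  have e : ∑ d ∈ Ico H (3 * H), (3 * H + M * ∑ r ∈ Ico P (P + 514 * H), (ind (NM M (fun n => s (r + n * d))) : ℤ)) =
      2 * H * (3 * H) + M * ∑ r ∈ Ico P (P + 514 * H), ∑ d ∈ Ico H (3 * H), (ind (NM M (fun n => s (r + n * d))) : ℤ) := by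
    rw [sum_add_distrib, sum_comm (s := Ico P (P + 514 * H)), mul_sum]
    simp only [sum_const, Int.card_Ico, nsmul_eq_mul]
    rw [show 3 * H - H = 2 * H by ring, Int.toNat_of_nonneg (by linarith)]
  rw [e] at h3
  push_cast at h2 h3 hF
  nlinarith
end
end NY

namespace NY
open Finset
noncomputable section
open scoped Classical
set_option linter.all false

abbrev V4 := ℤ × ℤ × ℤ × ℤ
abbrev I3 := ℤ × ℤ × ℤ

def om : V4 →ₗ[ℤ] V4 →ₗ[ℤ] ℤ :=
  LinearMap.mk₂ ℤ (fun v w => v.1 * w.2.1 - v.2.1 * w.1 + v.2.2.1 * w.2.2.2 - v.2.2.2 * w.2.2.1)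
    (by intros; simp; ring) (by intros; simp; ring) (by intros; simp; ring) (by intros; simp; ring)

theorem om_apply (v w : V4) : om v w = v.1 * w.2.1 - v.2.1 * w.1 + v.2.2.1 * w.2.2.2 - v.2.2.2 * w.2.2.1 := rfl
theorem om_self (v : V4) : om v v = 0 := by rw [om_apply]; ring

def bb (Λ : ℤ) (a : I3) : V4 := (Λ ^ 2, a.1, Λ * a.2.1, Λ * a.2.2)
def ww0 (N Λ : ℤ) (a : I3) : V4 := (0, N * Λ * a.2.2, N * Λ ^ 2, 0)
def ww1 (N Λ : ℤ) (a : I3) : V4 := (0, -(N * Λ * a.2.1), 0, N * Λ ^ 2)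
def hh (N Λ : ℤ) : ℤ := (N * Λ ^ 2) ^ 2
theorem om_b0 (N Λ a) : om (bb Λ a) (ww0 N Λ a) = 0 := by simp [om_apply, bb, ww0]; ring
theorem om_b1 (N Λ a) : om (bb Λ a) (ww1 N Λ a) = 0 := by simp [om_apply, bb, ww1]; ring
theorem om_0b (N Λ a) : om (ww0 N Λ a) (bb Λ a) = 0 := by simp [om_apply, bb, ww0]; ring
theorem om_01 (N Λ a) : om (ww0 N Λ a) (ww1 N Λ a) = hh N Λ := by simp [om_apply, ww1, ww0, hh]; ring

def al : Fin 3 → ℤ := ![1, 0, -1]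
def be : Fin 3 → ℤ := ![0, 1, 2]
def Sh (l : Fin 3) (t : ℤ) (a : I3) : I3 :=
  (a.1 + t * (al l * a.2.2 - be l * a.2.1), a.2.1 + t * al l, a.2.2 + t * be l)
theorem wv_eq (N Λ a) (l : Fin 3) : wv (ww0 N Λ a) (ww1 N Λ a) l =
    (0, N * Λ * (al l * a.2.2 - be l * a.2.1), N * Λ ^ 2 * al l, N * Λ ^ 2 * be l) := by
  fin_cases l <;> simp [wv, ww0, ww1, al, be, Prod.ext_iff] <;> ring_nf <;> simp
theorem om_bw (N Λ a) (l : Fin 3) : om (bb Λ a) (wv (ww0 N Λ a) (ww1 N Λ a) l) = 0 := by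
  rw [wv_eq]; simp [om_apply, bb]; ring
theorem Sh_add (l s t a) : Sh l (s + t) a = Sh l s (Sh l t a) := by
  simp [Sh, Prod.ext_iff]; refine ⟨?_, ?_, ?_⟩ <;> ring
theorem Sh_zero (l a) : Sh l 0 a = a := by simp [Sh]
theorem b_Sh (N Λ q κ n : ℤ) (l a) (hq : q * κ = N * Λ) :
    q • bb Λ (Sh l (n * κ) a) = q • bb Λ a + n • wv (ww0 N Λ a) (ww1 N Λ a) l := by
  rw [wv_eq]
  simp only [bb, Sh, Prod.smul_mk, Prod.mk_add_mk, smul_eq_mul, Prod.ext_iff]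
  refine ⟨by ring, ?_, ?_, ?_⟩
  · linear_combination n * (al l * a.2.2 - be l * a.2.1) * hq
  · linear_combination n * al l * Λ * hq
  · linear_combination n * be l * Λ * hq

def AA (Λ : ℤ) : Finset I3 := Ico 0 (Λ ^ 2) ×ˢ Ico 0 Λ ×ˢ Ico 0 Λ
def AP (Λ : ℤ) : Finset I3 := Ico (-Λ ^ 2) (2 * Λ ^ 2) ×ˢ Ico (-Λ) (2 * Λ) ×ˢ Ico (-Λ) (2 * Λ)
theorem card_AP (Λ : ℤ) (h : 0 ≤ Λ) : #(AP Λ) = 27 * #(AA Λ) := by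
  simp only [AP, AA, card_product, Int.card_Ico, sub_zero]
  rw [show 2 * Λ - -Λ = 3 * Λ by ring, show 2 * Λ ^ 2 - -Λ ^ 2 = 3 * Λ ^ 2 by ring]
  zify
  rw [Int.toNat_of_nonneg h, Int.toNat_of_nonneg (by positivity), Int.toNat_of_nonneg (by positivity), Int.toNat_of_nonneg (by positivity)]
  ring
theorem Sh_mem (Λ t : ℤ) (l a) (h : 0 ≤ Λ) (ha : a ∈ AA Λ) (ht : 4 * |t| ≤ Λ) : Sh l t a ∈ AP Λ := by
  simp only [AA, AP, mem_product, mem_Ico, Sh] at *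
  obtain ⟨⟨h1, h2⟩, ⟨h3, h4⟩, h5, h6⟩ := ha
  have ht' : |t| ≤ Λ / 4 := by omega
  have h7 := abs_le.1 ht'
  have key : ∀ x : ℤ, |x| ≤ 3 * Λ → |t * x| ≤ Λ ^ 2 := by
    intro x hx
    rw [abs_mul]
    nlinarith [abs_nonneg t, abs_nonneg x]
  have k := key (al l * a.2.2 - be l * a.2.1) (by
    rw [abs_le]; fin_cases l <;> simp [al, be] <;> constructor <;> linarith)
  have k' := abs_le.1 k
  refine ⟨⟨by linarith, by linarith⟩, ?_⟩
  fin_cases l <;> simp [al, be] <;> omega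

def lt (N M : ℕ) (Λ : ℤ) (Ψ : V4 → ℤ → Bool) (a : I3) (p d : ℤ) (τ : TI) : ℕ :=
  ind (Fail om M Ψ (linTest (bb Λ a) (ww0 N Λ a) (ww1 N Λ a) (hh N Λ) p d τ))

theorem smooth_one (N M : ℕ) (Λ : ℤ) (Ψ : V4 → ℤ → Bool) (p d : ℤ) (hΛ : 0 < Λ) (hN : 1 ≤ N)
    (hp : M * (8 * N) ≤ p) (hM : 1 ≤ M) (hd : 2 * p ∣ Λ) (l : Fin 3) (ε δ c : Bool) :
    M * ∑ a ∈ AA Λ, ind (Ψ (sg ε • ((if c then 2 * p else p) • bb Λ a)) ((l : ℕ) * hh N Λ) ≠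
      Ψ (sg ε • ((if c then 2 * p else p) • bb Λ a) + sg δ • wv (ww0 N Λ a) (ww1 N Λ a) l) ((l : ℕ) * hh N Λ))
    ≤ 27 * #(AA Λ) + M * ∑ a ∈ AP Λ, lt N M Λ Ψ a p d (0, l, ε, δ, c) := by
  set q : ℤ := if c then 2 * p else p with hqd
  have hppos : 0 < p := by
    have : (0:ℤ) < M * (8 * N) := by positivity
    linarith
  have hq0 : p ≤ q := by rw [hqd]; split_ifs <;> linarith
  have hqd : q ∣ Λ := by
    rw [hqd]; split_ifs
    · exact hd
    · exact (Dvd.intro_left 2 rfl).trans hd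
  obtain ⟨κ0, hκ0⟩ := hqd
  set κ := N * κ0 with hκd
  have hκ : q * κ = N * Λ := by rw [hκ0, hκd]; ring
  have hκ0pos : 0 < κ0 := by
    rcases lt_trichotomy κ0 0 with h | h | h
    · nlinarith
    · rw [h] at hκ0; simp at hκ0; omega
    · exact h
  have hNz : (1:ℤ) ≤ N := by exact_mod_cast hN
  have hMz : (1:ℤ) ≤ M := by exact_mod_cast hM
  have hMκ : 8 * (M * κ) ≤ Λ := by
    rw [hκ0, hκd]; nlinarith
  have hsg : ∀ x : Bool, sg x * sg x = 1 := by intro x; cases x <;> rfl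
  have key : ∀ (n : ℤ) a, sg ε • (q • bb Λ (Sh l (n * (sg ε * sg δ * κ)) a)) =
      sg ε • (q • bb Λ a) + n • (sg δ • wv (ww0 N Λ a) (ww1 N Λ a) l) := by
    intro n a
    rw [show n * (sg ε * sg δ * κ) = (n * (sg ε * sg δ)) * κ by ring, b_Sh N Λ q κ _ l a hκ, smul_add, smul_smul (sg ε) (n * _)]
    rw [smul_smul n (sg δ)]
    congr 2
    have := hsg ε
    linear_combination n * sg δ * this
  have h1 := shiftcount (fun t a => Sh l (t * (sg ε * sg δ * κ)) a) (by intro s t a; rw [add_mul, Sh_add])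
    (by intro a; simp [Sh_zero]) (AA Λ) (AP Λ) (fun a => Ψ (sg ε • (q • bb Λ a)) ((l : ℕ) * hh N Λ)) M (by
      intro n hn a ha
      refine Sh_mem Λ _ l a hΛ.le ha ?_
      have e : |-(n:ℤ) * (sg ε * sg δ * κ)| = n * κ := by
        have hκ' : 0 < κ := by positivity
        rw [abs_mul, abs_neg, Nat.abs_cast, abs_mul, abs_of_pos hκ']
        cases ε <;> cases δ <;> simp [sg]
      rw [e]
      have : (n:ℤ) ≤ M := by exact_mod_cast hn.le
      have hκ' : 0 < κ := by positivity
      nlinarith)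
  simp only [key, one_smul, sum_add_distrib, sum_const, smul_eq_mul, mul_one, card_AP Λ hΛ.le, ← mul_sum] at h1
  refine h1.trans (le_of_eq ?_)
  congr 2
  refine sum_congr rfl fun a _ => ?_
  simp only [lt, Fail, linTest]
  congr 2
  funext n
  congr 1
  simp only [map_smul, LinearMap.smul_apply, om_bw, smul_zero, mul_zero, add_zero]
end
end NY

namespace NY
open Finset
noncomputable section
open scoped Classical
set_option linter.all false

abbrev FB (N : ℕ) (Λ : ℤ) (Ψ : V4 → ℤ → Bool) (a : I3) : Fin 3 → Fin 3 → ℤ → Bool :=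
  Fib Ψ (bb Λ a) (ww0 N Λ a) (ww1 N Λ a) (hh N Λ)
abbrev Cn (N : ℕ) (Λ : ℤ) (Ψ : V4 → ℤ → Bool) (a : I3) (p : ℤ) : Prop :=
  conc Ψ (bb Λ a) (ww0 N Λ a) (ww1 N Λ a) (hh N Λ) p

theorem conc_p (N M : ℕ) (Λ : ℤ) (Ψ : V4 → ℤ → Bool) (p d : ℤ) (hΛ : 0 < Λ) (hN : 1 ≤ N)
    (hp : M * (8 * N) ≤ p) (hM : 4 ≤ M) (hd : 2 * p ∣ Λ) (hv : vbad Ψ (hh N Λ)) :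
    M * ∑ a ∈ AA Λ, ind (¬ Cn N Λ Ψ a p) ≤ 648 * #(AA Λ) + 2 * M * ∑ a ∈ AP Λ, ∑ τ : TI, lt N M Λ Ψ a p d τ := by
  have h1 : ∀ a ∈ AA Λ, ind (¬ Cn N Λ Ψ a p) ≤
      (∑ l : Fin 3, ∑ ε : Bool, ∑ δ : Bool, ∑ c : Bool, ind (Ψ (sg ε • ((if c then 2 * p else p) • bb Λ a)) ((l : ℕ) * hh N Λ) ≠
      Ψ (sg ε • ((if c then 2 * p else p) • bb Λ a) + sg δ • wv (ww0 N Λ a) (ww1 N Λ a) l) ((l : ℕ) * hh N Λ))) +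
      ∑ τ : TI, lt N M Λ Ψ a p d τ := by
    intro a _
    by_contra hcon
    push Not at hcon
    have h2 := hcon.trans_le (ind_le_one _)
    rw [Nat.lt_one_iff, Nat.add_eq_zero_iff] at h2
    obtain ⟨h2, h3⟩ := h2
    simp only [sum_eq_zero_iff, mem_univ, true_implies] at h2 h3
    have h4 : Cn N Λ Ψ a p := by
      refine slogic om M Ψ hM _ _ _ _ p d om_self (om_b0 _ _ _) (om_b1 _ _ _) (om_0b _ _ _) (om_01 _ _ _) hv ?_ ?_
      · intro l ε δ c
        have := h2 l ε δ c
        by_contra h5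
        rw [ind_true h5] at this
        omega
      · intro τ h5
        have := h3 τ
        rw [lt, ind_true h5] at this
        omega
    rw [ind_false (not_not.2 h4)] at hcon
    omega
  have h2 := Nat.mul_le_mul (le_refl M) (sum_le_sum h1)
  rw [sum_add_distrib, mul_add] at h2
  have h3 : ∑ a ∈ AA Λ, ∑ τ : TI, lt N M Λ Ψ a p d τ ≤ ∑ a ∈ AP Λ, ∑ τ : TI, lt N M Λ Ψ a p d τ := by
    refine sum_le_sum_of_subset ?_
    intro a ha
    have := Sh_mem Λ 0 0 a hΛ.le ha (by simp; linarith)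
    rwa [Sh_zero] at this
  have h4 : M * ∑ a ∈ AA Λ, (∑ l : Fin 3, ∑ ε : Bool, ∑ δ : Bool, ∑ c : Bool, ind (Ψ (sg ε • ((if c then 2 * p else p) • bb Λ a)) ((l : ℕ) * hh N Λ) ≠
      Ψ (sg ε • ((if c then 2 * p else p) • bb Λ a) + sg δ • wv (ww0 N Λ a) (ww1 N Λ a) l) ((l : ℕ) * hh N Λ)))
      ≤ 648 * #(AA Λ) + M * ∑ a ∈ AP Λ, ∑ τ : TI, lt N M Λ Ψ a p d τ := by
    calc _ = ∑ l : Fin 3, ∑ ε : Bool, ∑ δ : Bool, ∑ c : Bool, M * ∑ a ∈ AA Λ, ind (Ψ (sg ε • ((if c then 2 * p else p) • bb Λ a)) ((l : ℕ) * hh N Λ) ≠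
      Ψ (sg ε • ((if c then 2 * p else p) • bb Λ a) + sg δ • wv (ww0 N Λ a) (ww1 N Λ a) l) ((l : ℕ) * hh N Λ)) := by
          simp only [mul_sum]
          rw [sum_comm]; refine sum_congr rfl fun l _ => ?_
          rw [sum_comm]; refine sum_congr rfl fun ε _ => ?_
          rw [sum_comm]; refine sum_congr rfl fun δ _ => ?_
          rw [sum_comm]
      _ ≤ ∑ l : Fin 3, ∑ ε : Bool, ∑ δ : Bool, ∑ c : Bool, (27 * #(AA Λ) + M * ∑ a ∈ AP Λ, lt N M Λ Ψ a p d (0, l, ε, δ, c)) :=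
          sum_le_sum fun l _ => sum_le_sum fun ε _ => sum_le_sum fun δ _ => sum_le_sum fun c _ =>
            smooth_one N M Λ Ψ p d hΛ hN hp (by omega) hd l ε δ c
      _ = 648 * #(AA Λ) + M * ∑ a ∈ AP Λ, ∑ l : Fin 3, ∑ ε : Bool, ∑ δ : Bool, ∑ c : Bool, lt N M Λ Ψ a p d (0, l, ε, δ, c) := by
          simp only [sum_add_distrib, ← mul_sum, sum_const, card_univ, Fintype.card_fin, Fintype.card_bool, smul_eq_mul]
          congr 1
          · ring
          · congr 1
            symm
            rw [sum_comm]; refine sum_congr rfl fun l _ => ?_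
            rw [sum_comm]; refine sum_congr rfl fun ε _ => ?_
            rw [sum_comm]; refine sum_congr rfl fun δ _ => ?_
            rw [sum_comm]
      _ ≤ _ := by
          gcongr with a ha
          have := single_le_sum (f := fun κ : Fin 5 => ∑ y : Fin 3 × Bool × Bool × Bool, lt N M Λ Ψ a p d (κ, y))
            (fun _ _ => Nat.zero_le _) (mem_univ 0)
          rw [Fintype.sum_prod_type]
          refine le_trans (le_of_eq ?_) this
          simp only [Fintype.sum_prod_type]
  have h5 := Nat.mul_le_mul (le_refl M) h3
  nlinarith

def F1 (N M : ℕ) (Λ : ℤ) (Ψ : V4 → ℤ → Bool) : ℕ :=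
  ∑ p ∈ Ico (M * (8 * N) : ℤ) (M * (8 * N) + 514 * (8 * N)), ∑ d ∈ Ico (8 * N : ℤ) (3 * (8 * N)),
    ∑ a ∈ AP Λ, ∑ τ : TI, lt N M Λ Ψ a p d τ

def good (N M : ℕ) (Λ : ℤ) (Ψ : V4 → ℤ → Bool) (a : I3) : Prop :=
  ∃ i : ℕ, i < 512 ∧ ((∀ l δ, Tail (M * (8 * N) + i * (8 * N)) (8 * N) (FB N Λ Ψ a l δ)) ∨
    (∀ l δ, Tail (M * (8 * N) + i * (8 * N)) (8 * N) (fun t => FB N Λ Ψ a l δ (-t))))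

theorem card_ind' {α : Type*} (S : Finset α) (p : α → Prop) [DecidablePred p] : #{x ∈ S | p x} = ∑ x ∈ S, ind (p x) := by
  rw [card_filter]; refine sum_congr rfl fun x _ => ?_
  unfold ind; congr

theorem tail_of (g s : ℤ → Bool) (C : ℤ → Prop) (P H : ℤ) (σ : Bool)
    (key : ∀ (f : ℤ → Prop) [DecidablePred f], (∀ p, f p → (s p ≠ σ ∨ ¬ C p)) → 16 * (#{p ∈ Ico P (P + H) | f p} : ℤ) ≤ H)
    (hC : ∀ p, C p → g p = s p ∧ g (-p) = !s p) : if σ then Tail P H g else Tail P H (fun t => g (-t)) := by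
  have refl : ∀ (f : ℤ → Prop) [DecidablePred f], #{t ∈ Ico (-P - H + 1) (-P + 1) | f t} = #{p ∈ Ico P (P + H) | f (-p)} := by
    intro f _
    refine card_bij' (fun t _ => -t) (fun t _ => -t) ?_ ?_ ?_ ?_
    · intro t ht; simp only [mem_filter, mem_Ico, neg_neg] at *; refine ⟨⟨by linarith, by linarith⟩, ht.2⟩
    · intro t ht; simp only [mem_filter, mem_Ico] at *; refine ⟨⟨by linarith, by linarith⟩, ht.2⟩
    · simp
    · simp
  cases σ
  · simp only [Bool.false_eq_true, if_false, Tail]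
    rw [refl]
    refine ⟨key _ ?_, key _ ?_⟩
    · intro p hp
      by_contra hc
      push Not at hc
      have := (hC p hc.2).2
      rw [hc.1, hp] at this
      simp at this
    · intro p hp
      by_contra hc
      push Not at hc
      have := (hC p hc.2).1
      rw [neg_neg] at hp
      rw [hc.1, hp] at this
      simp at this
  · simp only [if_true, Tail]
    rw [refl]
    refine ⟨key _ ?_, key _ ?_⟩
    · intro p hp
      by_contra hc
      push Not at hc
      have := (hC p hc.2).1
      rw [hc.1, hp] at this
      simp at this
    · intro p hp
      by_contra hc
      push Not at hc
      have := (hC p hc.2).2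
      rw [hc.1, hp] at this
      simp at this

theorem good_of (N M : ℕ) (Λ : ℤ) (Ψ : V4 → ℤ → Bool) (a : I3) (hN : 1 ≤ N) (hM : 514 ≤ M)
    (h1 : 32 * (∑ p ∈ Ico (M * (8 * N) : ℤ) (M * (8 * N) + 514 * (8 * N)), ind (¬ Cn N Λ Ψ a p)) ≤ 8 * N)
    (h2 : M * ∑ p ∈ Ico (M * (8 * N) : ℤ) (M * (8 * N) + 514 * (8 * N)), ∑ d ∈ Ico (8 * N : ℤ) (3 * (8 * N)),
      lt N M Λ Ψ a p d (4, 0, true, true, true) ≤ 2 * (8 * N) ^ 2) : good N M Λ Ψ a := by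
  have hNz : (1:ℤ) ≤ N := by exact_mod_cast hN
  obtain ⟨i, hi, σ, hσ⟩ := orient (fun p => Ψ (p • bb Λ a) (hh N Λ)) (M * (8 * N)) (8 * N) M (by positivity) hM (by
    refine le_trans (le_of_eq ?_) (show ((M * ∑ p ∈ Ico (M * (8 * N) : ℤ) (M * (8 * N) + 514 * (8 * N)), ∑ d ∈ Ico (8 * N : ℤ) (3 * (8 * N)),
      lt N M Λ Ψ a p d (4, 0, true, true, true) : ℕ) : ℤ) ≤ 2 * (8 * N) ^ 2 by exact_mod_cast h2)
    push_cast
    congr 1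
    refine sum_congr rfl fun p _ => sum_congr rfl fun d _ => ?_
    simp only [lt, Fail, linTest]
    congr 3
    funext n
    simp only [map_smul, LinearMap.smul_apply, om_self, smul_zero, mul_zero, add_zero, add_smul, mul_smul])
  refine ⟨i, hi, ?_⟩
  set P : ℤ := M * (8 * N) + i * (8 * N) with hP
  set H : ℤ := 8 * N with hH
  have hi' : (i : ℤ) ≤ 511 := by omega
  have key : ∀ (f : ℤ → Prop) [DecidablePred f], (∀ p, f p → (Ψ (p • bb Λ a) (hh N Λ) ≠ σ ∨ ¬ Cn N Λ Ψ a p)) →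
      16 * (#{p ∈ Ico P (P + H) | f p} : ℤ) ≤ H := by
    intro f _ hf
    have e1 : #{p ∈ Ico P (P + H) | f p} ≤ #{p ∈ Ico P (P + H) | Ψ (p • bb Λ a) (hh N Λ) ≠ σ} + #{p ∈ Ico P (P + H) | ¬ Cn N Λ Ψ a p} := by
      rw [← card_union_add_card_inter]
      refine le_trans (card_le_card ?_) (Nat.le_add_right _ _)
      intro p hp
      rw [mem_filter] at hp
      simp only [mem_union, mem_filter]
      rcases hf p hp.2 with h | h
      · exact Or.inl ⟨hp.1, h⟩
      · exact Or.inr ⟨hp.1, h⟩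
    have e2 : #{p ∈ Ico P (P + H) | ¬ Cn N Λ Ψ a p} ≤ ∑ p ∈ Ico (M * H : ℤ) (M * H + 514 * H), ind (¬ Cn N Λ Ψ a p) := by
      rw [card_ind']
      refine sum_le_sum_of_subset (Ico_subset_Ico ?_ ?_)
      · rw [hP]; nlinarith
      · rw [hP]; nlinarith
    have e3 : (32 * ((∑ p ∈ Ico (M * H : ℤ) (M * H + 514 * H), ind (¬ Cn N Λ Ψ a p) : ℕ) : ℤ)) ≤ H := by
      rw [hH]; exact_mod_cast h1
    zify at e1 e2
    push_cast at e3
    linarith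
  have hC : ∀ l δ p, Cn N Λ Ψ a p → FB N Λ Ψ a l δ p = Ψ (p • bb Λ a) (hh N Λ) ∧ FB N Λ Ψ a l δ (-p) = !Ψ (p • bb Λ a) (hh N Λ) :=
    fun l δ p h => h l δ
  clear_value P H
  cases σ
  · right
    intro l δ
    exact tail_of (FB N Λ Ψ a l δ) (fun p => Ψ (p • bb Λ a) (hh N Λ)) (fun p => Cn N Λ Ψ a p) P H false key (hC l δ)
  · left
    intro l δ
    exact tail_of (FB N Λ Ψ a l δ) (fun p => Ψ (p • bb Λ a) (hh N Λ)) (fun p => Cn N Λ Ψ a p) P H true key (hC l δ)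

theorem good_many (N M : ℕ) (Λ : ℤ) (Ψ : V4 → ℤ → Bool) (hΛ : 0 < Λ) (hN : 1 ≤ N)
    (hM : 2 ^ 30 ≤ M) (hd : ∀ p : ℤ, 0 < p → p < M * (8 * N) + 514 * (8 * N) → 2 * p ∣ Λ) (hv : vbad Ψ (hh N Λ))
    (hF : 2 * M * F1 N M Λ Ψ ≤ #(AA Λ) * (8 * N) ^ 2) :
    #(AA Λ) ≤ 2 * #{a ∈ AA Λ | good N M Λ Ψ a} := by
  set H : ℕ := 8 * N with hH
  have hHpos : 0 < H := by omega
  set W := Ico (M * (8 * N) : ℤ) (M * (8 * N) + 514 * (8 * N)) with hW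
  set D := Ico (8 * N : ℤ) (3 * (8 * N)) with hD
  have cW : #W = 514 * H := by rw [hW, Int.card_Ico]; omega
  have cD : #D = 2 * H := by rw [hD, Int.card_Ico]; omega
  set B1 := {a ∈ AA Λ | H < 32 * ∑ p ∈ W, ind (¬ Cn N Λ Ψ a p)} with hB1
  set B2 := {a ∈ AA Λ | 2 * H ^ 2 < M * ∑ p ∈ W, ∑ d ∈ D, lt N M Λ Ψ a p d (4, 0, true, true, true)} with hB2
  have hsub : AA Λ ⊆ {a ∈ AA Λ | good N M Λ Ψ a} ∪ (B1 ∪ B2) := by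
    intro a ha
    simp only [mem_union, hB1, hB2, mem_filter]
    by_contra hc
    push Not at hc
    exact hc.1 ha (good_of N M Λ Ψ a hN (by omega) (hc.2.1 ha) (hc.2.2 ha))
  have hc := (card_le_card hsub).trans ((card_union_le _ _).trans (add_le_add le_rfl (card_union_le _ _)))
  have b1 : H * #B1 ≤ 32 * ∑ p ∈ W, ∑ a ∈ AA Λ, ind (¬ Cn N Λ Ψ a p) := by
    rw [sum_comm, mul_sum, mul_comm, ← smul_eq_mul, ← sum_const]
    calc _ ≤ ∑ a ∈ B1, 32 * ∑ p ∈ W, ind (¬ Cn N Λ Ψ a p) := sum_le_sum fun a ha => (mem_filter.1 ha).2.le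
      _ ≤ _ := sum_le_sum_of_subset (filter_subset _ _)
  have b1' : H * (M * ∑ p ∈ W, ∑ a ∈ AA Λ, ind (¬ Cn N Λ Ψ a p)) ≤ 514 * 648 * H ^ 2 * #(AA Λ) + M * F1 N M Λ Ψ := by
    have : ∀ p ∈ W, ∀ d ∈ D, M * ∑ a ∈ AA Λ, ind (¬ Cn N Λ Ψ a p) ≤ 648 * #(AA Λ) + 2 * M * ∑ a ∈ AP Λ, ∑ τ : TI, lt N M Λ Ψ a p d τ := by
      intro p hp d _
      rw [hW, mem_Ico] at hp
      have hp0 : (0:ℤ) < p := lt_of_lt_of_le (by positivity) hp.1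
      exact conc_p N M Λ Ψ p d hΛ hN (by exact_mod_cast hp.1) (by omega) (hd p hp0 hp.2) hv
    have h2 := sum_le_sum fun p hp => sum_le_sum (this p hp)
    simp only [sum_add_distrib, sum_const, cW, cD, smul_eq_mul, ← mul_sum] at h2
    rw [show ∑ p ∈ W, ∑ d ∈ D, ∑ a ∈ AP Λ, ∑ τ : TI, lt N M Λ Ψ a p d τ = F1 N M Λ Ψ from rfl] at h2
    nlinarith
  have b2 : 2 * H ^ 2 * #B2 ≤ M * F1 N M Λ Ψ := by
    calc _ = ∑ a ∈ B2, 2 * H ^ 2 := by rw [sum_const, smul_eq_mul, mul_comm]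
      _ ≤ ∑ a ∈ B2, M * ∑ p ∈ W, ∑ d ∈ D, lt N M Λ Ψ a p d (4, 0, true, true, true) := sum_le_sum fun a ha => (mem_filter.1 ha).2.le
      _ ≤ ∑ a ∈ AP Λ, M * ∑ p ∈ W, ∑ d ∈ D, lt N M Λ Ψ a p d (4, 0, true, true, true) := by
        refine sum_le_sum_of_subset ?_
        intro a ha
        have := Sh_mem Λ 0 0 a hΛ.le (mem_filter.1 ha).1 (by simp; linarith)
        rwa [Sh_zero] at this
      _ ≤ _ := by
        rw [← mul_sum, F1, sum_comm]
        refine Nat.mul_le_mul le_rfl (sum_le_sum fun p _ => ?_)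
        rw [sum_comm]
        refine sum_le_sum fun d _ => sum_le_sum fun a _ => ?_
        exact single_le_sum (f := fun τ => lt N M Λ Ψ a p d τ) (fun _ _ => Nat.zero_le _) (mem_univ _)
  have hA1 : H ^ 2 * (M * #B1) ≤ H ^ 2 * (32 * (514 * 648 + 1) * #(AA Λ)) := by
    have := Nat.mul_le_mul (le_refl (H * M)) b1
    nlinarith
  have hA2 := Nat.le_of_mul_le_mul_left hA1 (by positivity)
  have hA3 : 4 * #B1 ≤ #(AA Λ) := by nlinarith
  have hA4 : H ^ 2 * (4 * #B2) ≤ H ^ 2 * #(AA Λ) := by nlinarith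
  have hA5 := Nat.le_of_mul_le_mul_left hA4 (by positivity)
  omega
end
end NY

namespace NY
open Finset
noncomputable section
open scoped Classical
set_option linter.all false

theorem Phi_shift (K K' t0 σ : ℤ) (hσ : σ = 1 ∨ σ = -1) (hK : K + |t0| + 1 ≤ K') (A B C : ℤ → Bool) :
    Phi K (fun t => A (t0 + σ * t)) (fun t => B (t0 + σ * t)) (fun t => C (t0 + σ * t)) ≤ Phi K' A B C := by
  have h0 := abs_le.1 (le_refl |t0|)
  refine card_le_card_of_injOn (fun z => (t0 + σ * z.1, t0 + σ * z.2)) ?_ (fun a _ b _ h => by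
    simp only [Prod.mk.injEq, add_right_inj] at h
    rcases hσ with rfl | rfl
    · exact Prod.ext (by linarith [h.1]) (by linarith [h.2])
    · exact Prod.ext (by linarith [h.1]) (by linarith [h.2]))
  rintro ⟨p, m⟩
  simp only [mem_coe, mem_filter, mem_product, mem_Ico]
  unfold bad3
  rintro ⟨⟨⟨h1, h2⟩, h3, h4⟩, h5, h6⟩
  refine ⟨?_, ?_, h6⟩
  · rcases hσ with rfl | rfl <;> refine ⟨⟨?_, ?_⟩, ?_, ?_⟩ <;> linarith
  · rw [show 2 * (t0 + σ * m) - (t0 + σ * p) = t0 + σ * (2 * m - p) by ring]; exact h5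

theorem change_of (A : ℤ → Bool) (s t K : ℤ) (hs : -K ≤ s ∧ s ≤ K) (ht : -K ≤ t ∧ t ≤ K) (h : A s ≠ A t) :
    ∃ u ∈ Ico (-K) K, A u ≠ A (u + 1) := by
  by_contra hc
  push Not at hc
  have : ∀ u, -K ≤ u → u ≤ K → A u = A (-K) := by
    intro u hu
    induction u, hu using Int.le_induction with
    | base => intro _; rfl
    | succ n hn ih =>
      intro h2
      rw [← hc n (mem_Ico.2 ⟨hn, by omega⟩)]
      exact ih (by omega)
  exact h ((this s hs.1 hs.2).trans (this t ht.1 ht.2).symm)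

theorem Tail_ex (P H : ℤ) (A : ℤ → Bool) (hH : 0 < H) (h : Tail P H A) : ∃ t ∈ Ico P (P + H), A t = true := by
  by_contra hc
  push Not at hc
  have h1 := h.1
  rw [filter_true_of_mem (fun t ht => by simpa using hc t ht), Int.card_Ico] at h1
  omega

def KK (N M : ℕ) : ℤ := 4 * (8 * N * (M + 512)) + N + 1

theorem oneDset (G : Fin 3 → Fin 3 → ℤ → Bool) (N M k e i : ℕ) (S : Finset ℤ) (t0 σ : ℤ) (hN : 1 ≤ N) (hM : 1 ≤ M)
    (hk : 8 * (M + 512) ≤ 2 ^ k) (he : 1 ≤ e) (hi : i < 512) (hσ : σ = 1 ∨ σ = -1)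
    (hS0 : S ⊆ Ico 0 (N : ℤ)) (ht0 : t0 ∈ S)
    (hS : ∀ t ∈ S, G 0 0 t = false ∧ G 1 0 t = true ∧ G 2 0 t = false)
    (hT : ∀ l δ, Tail (M * (8 * N) + i * (8 * N)) (8 * N) (fun t => G l δ (t0 + σ * t)))
    (h1 : ∀ l δ, Phi (KK N M) (G l δ) (G l δ) (G l δ) ≤ e ^ 2)
    (h2 : ∀ l, Phi (KK N M) (G l 2) (G l 0) (G l 1) ≤ e ^ 2)
    (h3 : ∀ δ, δ ≠ 0 → Phi (KK N M) (G 0 δ) (G 1 δ) (G 2 δ) ≤ e ^ 2) :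
    #S ≤ (2 * (8 * (M + 512)) + 14) * (3 * 2 ^ (k + 1) + 1) * e ∧ ∃ t ∈ Ico (-KK N M) (KK N M), G 0 0 t ≠ G 0 0 (t + 1) := by
  have hNz : (1:ℤ) ≤ N := by exact_mod_cast hN
  have hMz : (1:ℤ) ≤ M := by exact_mod_cast hM
  have hi' : (i : ℤ) ≤ 511 := by omega
  have hin : (i : ℤ) * N ≤ 511 * N := by nlinarith
  have hmn : (1 : ℤ) * N ≤ M * N := by nlinarith
  set P : ℤ := M * (8 * N) + i * (8 * N) with hP
  have hPN : (N : ℤ) ≤ P := by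
    have : (0:ℤ) ≤ i * (8 * N) := by positivity
    linarith
  have ht0' := mem_Ico.1 (hS0 ht0)
  have habs : |t0| ≤ N := by rw [abs_le]; constructor <;> linarith
  have hK : 4 * (P + 8 * N) + |t0| + 1 ≤ KK N M := by unfold KK; nlinarith
  have main := oneD (fun l δ t => G l δ (t0 + σ * t)) P N k (8 * (M + 512)) e (by linarith) hN (by push_cast; linarith)
    (by
      have : (8 * ((M:ℤ) + 512)) ≤ 2 ^ k := by exact_mod_cast hk
      nlinarith) he hT
    (fun l δ => (Phi_shift _ _ t0 σ hσ hK _ _ _).trans (h1 l δ))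
    (fun l => (Phi_shift _ _ t0 σ hσ hK _ _ _).trans (h2 l))
    (fun δ hδ => (Phi_shift _ _ t0 σ hσ hK _ _ _).trans (h3 δ hδ))
  constructor
  · refine le_trans ?_ main
    refine card_le_card_of_injOn (fun t => σ * (t - t0)) ?_ (fun a _ b _ h => by
      rcases hσ with rfl | rfl <;> simp only [] at h <;> linarith)
    intro t ht
    have h4 := mem_Ico.1 (hS0 ht)
    simp only [mem_coe, mem_filter, mem_Ico]
    have e : t0 + σ * (σ * (t - t0)) = t := by rcases hσ with rfl | rfl <;> ring
    rw [e]
    refine ⟨?_, hS t ht⟩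
    rcases hσ with rfl | rfl <;> constructor <;> linarith
  · obtain ⟨t, ht, ht2⟩ := Tail_ex P (8 * N) _ (by positivity) (hT 0 0)
    rw [mem_Ico] at ht
    have hb : P + 8 * N + N ≤ KK N M := by unfold KK; nlinarith
    refine change_of (G 0 0) t0 (t0 + σ * t) _ ⟨by linarith, by linarith⟩ ?_ ?_
    · rcases hσ with rfl | rfl <;> constructor <;> linarith
    · rw [(hS t0 ht0).1]; rw [show G 0 0 (t0 + σ * t) = true from ht2]; simp

abbrev QI := Fin 3 × Fin 3 × Fin 3
def quadTest {V : Type*} [AddCommGroup V] (b w0 w1 : V) (h p m : ℤ) : QI → V × ℤ × V := fun ⟨κ, l, δ⟩ =>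
  match κ with
  | 0 => (p • ((2:ℤ) • b) + gd δ • wv w0 w1 l, (l : ℕ) * h, (m - p) • ((2:ℤ) • b))
  | 1 => (p • ((2:ℤ) • b) - wv w0 w1 l, (l : ℕ) * h, (m - p) • ((2:ℤ) • b) + wv w0 w1 l)
  | 2 => (p • ((2:ℤ) • b) + gd δ • w0, 0, (m - p) • ((2:ℤ) • b) + gd δ • (w1 - w0))

def qt (N M : ℕ) (Λ : ℤ) (Ψ : V4 → ℤ → Bool) (a : I3) (p m : ℤ) (τ : QI) : ℕ :=
  ind (Fail om M Ψ (quadTest (bb Λ a) (ww0 N Λ a) (ww1 N Λ a) (hh N Λ) p m τ))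

def QQ (N M : ℕ) (Λ : ℤ) (Ψ : V4 → ℤ → Bool) (a : I3) : ℕ :=
  ∑ p ∈ Ico (-KK N M) (KK N M), ∑ m ∈ Ico (-KK N M) (KK N M), ∑ τ : QI, qt N M Λ Ψ a p m τ

theorem Phi_le_QQ (N M : ℕ) (Λ : ℤ) (Ψ : V4 → ℤ → Bool) (a : I3) (A B C : ℤ → Bool) (τ : QI)
    (h : ∀ p m, bad3 A B C p m → Fail om M Ψ (quadTest (bb Λ a) (ww0 N Λ a) (ww1 N Λ a) (hh N Λ) p m τ)) :
    Phi (KK N M) A B C ≤ QQ N M Λ Ψ a := by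
  unfold Phi
  rw [card_ind', sum_product]
  refine sum_le_sum fun p _ => sum_le_sum fun m _ => ?_
  refine le_trans (ind_mono (h p m)) ?_
  exact single_le_sum (f := fun τ => qt N M Λ Ψ a p m τ) (fun _ _ => Nat.zero_le _) (mem_univ τ)

theorem fail_of (M : ℕ) (Ψ : V4 → ℤ → Bool) (hM : 2 ≤ M) (v u v1 v2 : V4) (ζ ζ1 ζ2 : ℤ)
    (e1 : v1 = v + u) (e2 : v2 = v + (2:ℤ) • u) (f1 : ζ1 = ζ + om v u) (f2 : ζ2 = ζ + 2 * om v u)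
    (h1 : Ψ v ζ = Ψ v2 ζ2) (h2 : Ψ v1 ζ1 ≠ Ψ v ζ) : Fail om M Ψ (v, ζ, u) := by
  refine ⟨0, 1, 2, by omega, by omega, hM, ?_, ?_⟩
  · simp only [Nat.cast_zero, zero_smul, zero_mul, add_zero, Nat.cast_ofNat, ← e2, ← f2]; exact h1
  · simp only [Nat.cast_zero, zero_smul, zero_mul, add_zero, Nat.cast_one, one_smul, one_mul, ← e1, ← f1]; exact h2

theorem om_anti (v w : V4) : om v w = - om w v := by rw [om_apply, om_apply]; ring
theorem om_wb (N Λ a) (l : Fin 3) : om (wv (ww0 N Λ a) (ww1 N Λ a) l) (bb Λ a) = 0 := by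
  rw [om_anti, om_bw, neg_zero]

theorem Phi1 (N M : ℕ) (Λ : ℤ) (Ψ : V4 → ℤ → Bool) (a : I3) (hM : 2 ≤ M) (l δ : Fin 3) :
    Phi (KK N M) (FB N Λ Ψ a l δ) (FB N Λ Ψ a l δ) (FB N Λ Ψ a l δ) ≤ QQ N M Λ Ψ a := by
  refine Phi_le_QQ N M Λ Ψ a _ _ _ (0, l, δ) ?_
  rintro p m ⟨h1, h2⟩
  refine fail_of M Ψ hM _ _ _ _ _ _ _ ?_ ?_ ?_ ?_ h1 h2
  · module
  · module
  · simp only [map_smul, map_add, LinearMap.smul_apply, LinearMap.add_apply, om_self, om_wb, smul_zero, mul_zero, add_zero]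
  · simp only [map_smul, map_add, LinearMap.smul_apply, LinearMap.add_apply, om_self, om_wb, smul_zero, mul_zero, add_zero]

theorem Phi2 (N M : ℕ) (Λ : ℤ) (Ψ : V4 → ℤ → Bool) (a : I3) (hM : 2 ≤ M) (l : Fin 3) :
    Phi (KK N M) (FB N Λ Ψ a l 2) (FB N Λ Ψ a l 0) (FB N Λ Ψ a l 1) ≤ QQ N M Λ Ψ a := by
  refine Phi_le_QQ N M Λ Ψ a _ _ _ (1, l, 0) ?_
  rintro p m ⟨h1, h2⟩
  simp only [FB, Fib, show gd 2 = -1 from rfl, show gd 1 = 1 from rfl, show gd 0 = 0 from rfl, neg_one_smul, ← sub_eq_add_neg, one_smul, zero_smul, add_zero] at h1 h2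
  refine fail_of M Ψ hM _ _ _ _ _ _ _ ?_ ?_ ?_ ?_ h1 h2
  · module
  · module
  · simp only [map_smul, map_add, map_sub, LinearMap.smul_apply, LinearMap.sub_apply, om_self, om_wb, om_bw, smul_zero, mul_zero, add_zero, sub_zero]
  · simp only [map_smul, map_add, map_sub, LinearMap.smul_apply, LinearMap.sub_apply, om_self, om_wb, om_bw, smul_zero, mul_zero, add_zero, sub_zero]

theorem Phi3 (N M : ℕ) (Λ : ℤ) (Ψ : V4 → ℤ → Bool) (a : I3) (hM : 2 ≤ M) (δ : Fin 3) (hδ : δ ≠ 0) :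
    Phi (KK N M) (FB N Λ Ψ a 0 δ) (FB N Λ Ψ a 1 δ) (FB N Λ Ψ a 2 δ) ≤ QQ N M Λ Ψ a := by
  refine Phi_le_QQ N M Λ Ψ a _ _ _ (2, 0, δ) ?_
  rintro p m ⟨h1, h2⟩
  have g2 : gd δ * gd δ = 1 := by fin_cases δ <;> simp_all [gd]
  have key : om (p • (2:ℤ) • bb Λ a + gd δ • ww0 N Λ a) ((m - p) • (2:ℤ) • bb Λ a + gd δ • (ww1 N Λ a - ww0 N Λ a)) = hh N Λ := by
    simp only [map_smul, map_add, map_sub, LinearMap.smul_apply, LinearMap.add_apply, om_self, om_0b, om_b0, om_b1, om_01, smul_zero, mul_zero, add_zero, zero_add, sub_zero, smul_eq_mul]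
    linear_combination hh N Λ * g2
  simp only [FB, Fib, wv, Fin.val_zero, Fin.val_one, Fin.val_two, Nat.cast_zero, zero_mul, Nat.cast_one, one_mul, Nat.cast_ofNat, Matrix.cons_val_zero, Matrix.cons_val_one, Matrix.cons_val] at h1 h2
  refine fail_of M Ψ hM _ _ _ _ _ _ _ ?_ ?_ ?_ ?_ h1 h2
  · module
  · module
  · rw [key]; simp
  · rw [key]; simp

def Sft (b : V4) (t : ℤ) (Ψ : V4 → ℤ → Bool) : V4 → ℤ → Bool :=
  fun v ζ => Ψ (t • ((2:ℤ) • b) + v) (ζ + om (t • ((2:ℤ) • b)) v)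

theorem FB_Sft (N : ℕ) (Λ : ℤ) (Ψ : V4 → ℤ → Bool) (a : I3) (l δ : Fin 3) (t0 t : ℤ) :
    FB N Λ (Sft (bb Λ a) t0 Ψ) a l δ t = FB N Λ Ψ a l δ (t0 + t) := by
  simp only [FB, Fib, Sft, map_smul, map_add, LinearMap.smul_apply, LinearMap.add_apply, om_self, om_bw, smul_zero, add_zero]
  congr 1
  module

def TT (N M : ℕ) (Λ : ℤ) (Ψ : V4 → ℤ → Bool) (a : I3) : Finset ℤ :=
  {t ∈ Ico 0 (N : ℤ) | vbad (Sft (bb Λ a) t Ψ) (hh N Λ) ∧ good N M Λ (Sft (bb Λ a) t Ψ) a}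

def CC (M k : ℕ) : ℕ := (2 * (8 * (M + 512)) + 14) * (3 * 2 ^ (k + 1) + 1)

theorem quad (N M k : ℕ) (Λ : ℤ) (Ψ : V4 → ℤ → Bool) (a : I3) (hN : 1 ≤ N) (hM : 2 ≤ M) (hk : 8 * (M + 512) ≤ 2 ^ k)
    (hne : (TT N M Λ Ψ a).Nonempty) : #(TT N M Λ Ψ a) ^ 2 ≤ CC M k ^ 2 * (2 * QQ N M Λ Ψ a + 2) ∧
      ∃ t ∈ Ico (-KK N M) (KK N M), Ψ (t • ((2:ℤ) • bb Λ a)) 0 ≠ Ψ ((t + 1) • ((2:ℤ) • bb Λ a)) 0 := by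
  obtain ⟨t0, ht0⟩ := hne
  have h0 := mem_filter.1 ht0
  obtain ⟨i, hi, hT⟩ := h0.2.2
  have hT' : ∃ σ : ℤ, (σ = 1 ∨ σ = -1) ∧ ∀ l δ, Tail (M * (8 * N) + i * (8 * N)) (8 * N) (fun t => FB N Λ Ψ a l δ (t0 + σ * t)) := by
    rcases hT with h | h
    · refine ⟨1, Or.inl rfl, fun l δ => ?_⟩
      have := h l δ
      rw [show FB N Λ (Sft (bb Λ a) t0 Ψ) a l δ = fun t => FB N Λ Ψ a l δ (t0 + 1 * t) by funext t; rw [FB_Sft, one_mul]] at this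
      exact this
    · refine ⟨-1, Or.inr rfl, fun l δ => ?_⟩
      have := h l δ
      rw [show (fun t => FB N Λ (Sft (bb Λ a) t0 Ψ) a l δ (-t)) = fun t => FB N Λ Ψ a l δ (t0 + -1 * t) by funext t; rw [FB_Sft, neg_one_mul]] at this
      exact this
  obtain ⟨σ, hσ, hT⟩ := hT'
  have hQ : QQ N M Λ Ψ a ≤ (Nat.sqrt (QQ N M Λ Ψ a) + 1) ^ 2 := by
    have := Nat.lt_succ_sqrt (QQ N M Λ Ψ a)
    rw [pow_two]; exact this.le
  have main := oneDset (FB N Λ Ψ a) N M k (Nat.sqrt (QQ N M Λ Ψ a) + 1) i (TT N M Λ Ψ a) t0 σ hN (by omega) hk (by omega) hi hσ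
    (filter_subset _ _) ht0 (by
      intro t ht
      have h1 := (mem_filter.1 ht).2.1
      simp only [vbad, Sft, add_zero, map_zero] at h1
      simpa [FB, Fib, gd] using h1)
    hT (fun l δ => (Phi1 N M Λ Ψ a hM l δ).trans hQ) (fun l => (Phi2 N M Λ Ψ a hM l).trans hQ)
    (fun δ hδ => (Phi3 N M Λ Ψ a hM δ hδ).trans hQ)
  constructor
  · refine (Nat.pow_le_pow_left main.1 2).trans ?_
    rw [mul_pow]
    refine Nat.mul_le_mul le_rfl ?_
    have := Nat.sqrt_le (QQ N M Λ Ψ a)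
    nlinarith [sq_nonneg ((Nat.sqrt (QQ N M Λ Ψ a) : ℤ) - 1)]
  · obtain ⟨t, ht, h⟩ := main.2
    refine ⟨t, ht, ?_⟩
    simpa [FB, Fib, gd] using h
end
end NY

namespace NY
open Finset
noncomputable section
open scoped Classical
set_option linter.all false

theorem ind_trans {p q r : Prop} (h : p → q ∨ r) : ind p ≤ ind q + ind r := by
  unfold ind
  by_cases hp : p
  · rcases h hp with h | h <;> simp [hp, h]
  · simp [hp]

theorem seq_change (s : ℕ → Bool) (a b : ℕ) (h : a ≤ b) : ind (s a ≠ s b) ≤ ∑ i ∈ Ico a b, ind (s i ≠ s (i + 1)) := by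
  induction b, h using Nat.le_induction with
  | base => simp [ind]
  | succ n hn ih =>
    rw [sum_Ico_succ_top hn]
    refine le_trans (ind_trans (q := s a ≠ s n) (r := s n ≠ s (n + 1)) ?_) (add_le_add ih le_rfl)
    intro h
    by_cases h1 : s a = s n
    · right; rwa [← h1]
    · left; exact h1

theorem seq_NM (L : ℕ) (s : ℕ → Bool) :
    ind (s 0 ≠ s L) + 2 * ind (NM L s) ≤ ∑ i ∈ range L, ind (s i ≠ s (i + 1)) := by
  rw [range_eq_Ico]
  by_cases h : NM L s
  · obtain ⟨i, j, k, hij, hjk, hk, h1, h2⟩ := id h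
    rw [ind_true h]
    have e1 := sum_Ico_consecutive (fun i => ind (s i ≠ s (i + 1))) (Nat.zero_le i) hij.le
    have e2 := sum_Ico_consecutive (fun i => ind (s i ≠ s (i + 1))) (Nat.zero_le j) hjk.le
    have e3 := sum_Ico_consecutive (fun i => ind (s i ≠ s (i + 1))) (Nat.zero_le k) hk
    have c1 := seq_change s 0 i (Nat.zero_le i)
    have c2 := seq_change s i j hij.le
    have c3 := seq_change s j k hjk.le
    have c4 := seq_change s k L hk
    rw [ind_true h2.symm] at c2
    rw [ind_true (by rwa [← h1])] at c3
    have c5 : ind (s 0 ≠ s L) ≤ ind (s 0 ≠ s i) + ind (s k ≠ s L) := by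
      refine ind_trans ?_
      intro h
      by_cases h3 : s 0 = s i
      · right; rwa [← h1, ← h3]
      · left; exact h3
    omega
  · rw [ind_false h]
    exact seq_change s 0 L (Nat.zero_le L)

section
variable {G : Type*} [Group G] [Fintype G] (E : G → Bool)
def Dd (g : G) : ℕ := ∑ x, ind (E x ≠ E (x * g))
def Ph (L : ℕ) (g : G) : ℕ := ∑ x, ind (NM L (fun n => E (x * g ^ n)))

theorem sum_shift (f : G → ℕ) (g : G) : ∑ x, f (x * g) = ∑ x, f x :=
  Fintype.sum_equiv (Equiv.mulRight g) _ _ (fun x => rfl)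

theorem Dd_mul (g h : G) : Dd E (g * h) ≤ Dd E g + Dd E h := by
  rw [show Dd E h = ∑ x, ind (E (x * g) ≠ E (x * g * h)) from (sum_shift (fun x => ind (E x ≠ E (x * h))) g).symm]
  unfold Dd
  rw [← sum_add_distrib]
  refine sum_le_sum fun x _ => ind_trans ?_
  rw [← mul_assoc]
  intro h
  by_cases h1 : E x = E (x * g)
  · right; rwa [← h1]
  · left; exact h1
theorem Dd_one : Dd E 1 = 0 := by simp [Dd, ind]
theorem Dd_inv (g : G) : Dd E g⁻¹ = Dd E g := by
  unfold Dd
  rw [← sum_shift (fun x => ind (E x ≠ E (x * g⁻¹))) g]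
  refine sum_congr rfl fun x _ => ?_
  simp only [mul_inv_cancel_right]
  congr 1
  rw [ne_comm]
theorem Dd_pow (g : G) (n : ℕ) : Dd E (g ^ n) ≤ n * Dd E g := by
  induction n with
  | zero => simp [Dd_one]
  | succ n ih =>
    rw [pow_succ, add_mul, one_mul]
    exact (Dd_mul E _ _).trans (add_le_add ih le_rfl)
theorem Dd_zpow (g : G) (n : ℤ) : Dd E (g ^ n) ≤ n.natAbs * Dd E g := by
  rcases Int.natAbs_eq n with h | h
  · conv_lhs => rw [h]
    rw [zpow_natCast]; exact Dd_pow E g _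
  · conv_lhs => rw [h]
    rw [zpow_neg, zpow_natCast, Dd_inv]; exact Dd_pow E g _

theorem Dd_Ph (L : ℕ) (g : G) : Dd E (g ^ L) + 2 * Ph E L g ≤ L * Dd E g := by
  calc _ = ∑ x, (ind (E (x * g ^ 0) ≠ E (x * g ^ L)) + 2 * ind (NM L (fun n => E (x * g ^ n)))) := by
        simp [Dd, Ph, sum_add_distrib, mul_sum]
    _ ≤ ∑ x, ∑ i ∈ range L, ind (E (x * g ^ i) ≠ E (x * g ^ (i + 1))) := sum_le_sum fun x _ => seq_NM L (fun n => E (x * g ^ n))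
    _ = ∑ i ∈ range L, ∑ x, ind (E (x * g ^ i) ≠ E (x * g ^ (i + 1))) := sum_comm
    _ = ∑ i ∈ range L, Dd E g := by
      refine sum_congr rfl fun i _ => ?_
      rw [show Dd E g = ∑ x, ind (E (x * g ^ i) ≠ E (x * g ^ i * g)) from (sum_shift (fun x => ind (E x ≠ E (x * g))) (g ^ i)).symm]
      simp only [pow_succ, mul_assoc]
    _ = _ := by simp

theorem tele_sum (x : ℕ → ℝ) (l S : ℕ) (h0 : ∀ s, 0 ≤ x s) :
    ∑ s ∈ range S, (x s - x (s + l)) ≤ ∑ s ∈ range l, x s := by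
  have : ∑ s ∈ range S, (x s - x (s + l)) = ∑ s ∈ range l, x s - ∑ s ∈ range l, x (S + s) := by
    have e1 := sum_range_add x S l
    have e2 := sum_range_add x l S
    rw [sum_sub_distrib]
    have e3 : ∑ s ∈ range S, x (s + l) = ∑ s ∈ range S, x (l + s) := sum_congr rfl fun s _ => by rw [add_comm]
    rw [add_comm l S] at e2
    linarith
  rw [this]
  have := sum_nonneg fun s (_ : s ∈ range l) => h0 (S + s)
  linarith

theorem Ph_sum (l S : ℕ) (g : G) :
    ∑ s ∈ range S, (Ph E (2 ^ l) (g ^ (2 ^ s)) : ℝ) / 2 ^ s ≤ 2 ^ l * l * Dd E g := by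
  set x : ℕ → ℝ := fun s => (Dd E (g ^ (2 ^ s)) : ℝ) / 2 ^ s with hx
  have h1 : ∀ s, (Ph E (2 ^ l) (g ^ (2 ^ s)) : ℝ) / 2 ^ s ≤ 2 ^ l * (x s - x (s + l)) := by
    intro s
    have h2 := Dd_Ph E (2 ^ l) (g ^ (2 ^ s))
    rw [← pow_mul, ← pow_add] at h2
    have h3 : (Dd E (g ^ 2 ^ (s + l)) : ℝ) + 2 * Ph E (2 ^ l) (g ^ (2 ^ s)) ≤ 2 ^ l * Dd E (g ^ 2 ^ s) := by exact_mod_cast h2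
    have e : 2 ^ l * (x s - x (s + l)) = (2 ^ l * Dd E (g ^ 2 ^ s) - Dd E (g ^ 2 ^ (s + l))) / 2 ^ s := by
      rw [hx]; simp only [pow_add]; field_simp
    rw [e]
    gcongr
    have : (0:ℝ) ≤ Ph E (2 ^ l) (g ^ (2 ^ s)) := by positivity
    linarith
  have h4 : ∀ s, x s ≤ Dd E g := by
    intro s
    rw [hx]
    simp only []
    rw [div_le_iff₀ (by positivity)]
    have := Dd_pow E g (2 ^ s)
    rw [mul_comm]
    exact_mod_cast this
  calc _ ≤ ∑ s ∈ range S, 2 ^ l * (x s - x (s + l)) := sum_le_sum fun s _ => h1 s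
    _ ≤ 2 ^ l * ∑ s ∈ range l, x s := by
      rw [← mul_sum]
      exact mul_le_mul_of_nonneg_left (tele_sum x l S (fun s => by positivity)) (by positivity)
    _ ≤ 2 ^ l * ∑ s ∈ range l, (Dd E g : ℝ) := by gcongr with s _; exact h4 s
    _ = _ := by simp; ring
end
end
end NY

namespace NY
open Finset
noncomputable section
open scoped Classical
set_option linter.all false

section
variable {G : Type*} [Group G] [Fintype G] (E : G → Bool) (el : V4 → ℤ → G)
def PS (x : G) : V4 → ℤ → Bool := fun v ζ => E (x * el v ζ)
def IsEl : Prop := ∀ v ζ u η, el v ζ * el u η = el (v + u) (ζ + η + om v u)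

variable {el}
theorem el_zero (h : IsEl el) : el 0 0 = 1 := by
  have := h 0 0 0 0
  simpa using this
theorem el_pow (h : IsEl el) (u : V4) (n : ℕ) : (el u 0) ^ n = el ((n : ℤ) • u) 0 := by
  induction n with
  | zero => simp [el_zero h]
  | succ n ih =>
    rw [pow_succ, ih, h]
    congr 1
    · push_cast; module
    · simp only [map_smul, LinearMap.smul_apply, om_self, smul_zero, add_zero]

theorem fail_sum (h : IsEl el) (M : ℕ) (v u : V4) (ζ : ℤ) :
    ∑ x, ind (Fail om M (PS E el x) (v, ζ, u)) = Ph E M (el u 0) := by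
  unfold Ph
  rw [← sum_shift (fun x => ind (NM M (fun n => E (x * (el u 0) ^ n)))) (el v ζ)]
  refine sum_congr rfl fun x _ => ?_
  unfold Fail PS
  congr 2
  funext n
  rw [el_pow h, mul_assoc, h]
  simp only [map_smul, smul_eq_mul, add_zero]

theorem PS_Sft (h : IsEl el) (b : V4) (t : ℤ) (x : G) : Sft b t (PS E el x) = PS E el (x * el (t • ((2:ℤ) • b)) 0) := by
  funext v ζ
  simp only [Sft, PS]
  rw [mul_assoc, h, zero_add]

variable (el)
def LIN (N M : ℕ) (Λ : ℤ) : ℕ :=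
  ∑ p ∈ Ico (M * (8 * N) : ℤ) (M * (8 * N) + 514 * (8 * N)), ∑ d ∈ Ico (8 * N : ℤ) (3 * (8 * N)),
    ∑ a ∈ AP Λ, ∑ τ : TI, Ph E M (el (linTest (bb Λ a) (ww0 N Λ a) (ww1 N Λ a) (hh N Λ) p d τ).2.2 0)
def QUAD (N M : ℕ) (Λ : ℤ) (a : I3) : ℕ :=
  ∑ p ∈ Ico (-KK N M) (KK N M), ∑ m ∈ Ico (-KK N M) (KK N M), ∑ τ : QI,
    Ph E M (el (quadTest (bb Λ a) (ww0 N Λ a) (ww1 N Λ a) (hh N Λ) p m τ).2.2 0)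
def vn (N : ℕ) (Λ : ℤ) : ℕ := ∑ x, ind (vbad (PS E el x) (hh N Λ))
def nn (N M : ℕ) (Λ : ℤ) (a : I3) : ℕ := ∑ x, ind (vbad (PS E el x) (hh N Λ) ∧ good N M Λ (PS E el x) a)
variable {el}

theorem LIN_eq (h : IsEl el) (N M : ℕ) (Λ : ℤ) : ∑ x, F1 N M Λ (PS E el x) = LIN E el N M Λ := by
  unfold F1 LIN
  rw [sum_comm]; refine sum_congr rfl fun p _ => ?_
  rw [sum_comm]; refine sum_congr rfl fun d _ => ?_
  rw [sum_comm]; refine sum_congr rfl fun a _ => ?_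
  rw [sum_comm]; refine sum_congr rfl fun τ _ => ?_
  exact fail_sum E h M _ _ _
theorem QUAD_eq (h : IsEl el) (N M : ℕ) (Λ : ℤ) (a : I3) : ∑ x, QQ N M Λ (PS E el x) a = QUAD E el N M Λ a := by
  unfold QQ QUAD
  rw [sum_comm]; refine sum_congr rfl fun p _ => ?_
  rw [sum_comm]; refine sum_congr rfl fun m _ => ?_
  rw [sum_comm]; refine sum_congr rfl fun τ _ => ?_
  exact fail_sum E h M _ _ _

theorem TT_sum (h : IsEl el) (N M : ℕ) (Λ : ℤ) (a : I3) : ∑ x, #(TT N M Λ (PS E el x) a) = N * nn E el N M Λ a := by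
  unfold TT
  simp only [card_ind', PS_Sft E h]
  rw [sum_comm]
  have : ∀ t : ℤ, ∑ x, ind (vbad (PS E el (x * el (t • (2:ℤ) • bb Λ a) 0)) (hh N Λ) ∧ good N M Λ (PS E el (x * el (t • (2:ℤ) • bb Λ a) 0)) a)
      = nn E el N M Λ a := fun t => sum_shift (fun x => ind (vbad (PS E el x) (hh N Λ) ∧ good N M Λ (PS E el x) a)) _
  rw [sum_congr rfl fun t _ => this t]
  simp

theorem B_le (h : IsEl el) (N M k : ℕ) (Λ : ℤ) (a : I3) (hN : 1 ≤ N) (hM : 2 ≤ M) (hk : 8 * (M + 512) ≤ 2 ^ k) :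
    ∑ x, ind ((TT N M Λ (PS E el x) a).Nonempty) ≤ (2 * KK N M).toNat * Dd E (el ((2:ℤ) • bb Λ a) 0) := by
  calc _ ≤ ∑ x, ∑ t ∈ Ico (-KK N M) (KK N M), ind (PS E el x (t • ((2:ℤ) • bb Λ a)) 0 ≠ PS E el x ((t + 1) • ((2:ℤ) • bb Λ a)) 0) := by
        refine sum_le_sum fun x _ => ?_
        by_cases hx : (TT N M Λ (PS E el x) a).Nonempty
        · obtain ⟨t, ht, h2⟩ := (quad N M k Λ (PS E el x) a hN hM hk hx).2
          rw [ind_true hx, ← ind_true h2]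
          exact single_le_sum (f := fun t => ind (PS E el x (t • ((2:ℤ) • bb Λ a)) 0 ≠ PS E el x ((t + 1) • ((2:ℤ) • bb Λ a)) 0)) (fun _ _ => Nat.zero_le _) ht
        · rw [ind_false hx]; exact Nat.zero_le _
    _ = ∑ t ∈ Ico (-KK N M) (KK N M), Dd E (el ((2:ℤ) • bb Λ a) 0) := by
        rw [sum_comm]
        refine sum_congr rfl fun t _ => ?_
        unfold Dd
        rw [← sum_shift (fun x => ind (E x ≠ E (x * _))) (el (t • ((2:ℤ) • bb Λ a)) 0)]
        refine sum_congr rfl fun x _ => ?_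
        unfold PS
        rw [mul_assoc x, h, add_smul, one_smul]
        simp only [map_smul, LinearMap.smul_apply, om_self, smul_zero, add_zero]
    _ = _ := by
        rw [sum_const, Int.card_Ico, smul_eq_mul]
        congr 2; ring

theorem nn_le (h : IsEl el) (N M k : ℕ) (Λ : ℤ) (a : I3) (B : ℕ) (hN : 1 ≤ N) (hM : 2 ≤ M) (hk : 8 * (M + 512) ≤ 2 ^ k)
    (hB : (2 * KK N M).toNat * Dd E (el ((2:ℤ) • bb Λ a) 0) ≤ B) :
    (N * nn E el N M Λ a) ^ 2 ≤ 2 * CC M k ^ 2 * (B * (QUAD E el N M Λ a + B)) := by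
  rw [← TT_sum E h]
  have hB' := (B_le E h N M k Λ a hN hM hk).trans hB
  set I : G → ℕ := fun x => ind ((TT N M Λ (PS E el x) a).Nonempty) with hI
  have hI2 : ∀ x, I x * I x = I x := by intro x; simp only [hI, ind]; split_ifs <;> rfl
  have h1 : ∀ x, #(TT N M Λ (PS E el x) a) = I x * #(TT N M Λ (PS E el x) a) := by
    intro x
    by_cases hx : (TT N M Λ (PS E el x) a).Nonempty
    · simp only [hI]; rw [ind_true hx, one_mul]
    · rw [not_nonempty_iff_eq_empty.1 hx]; simp
  rw [sum_congr rfl fun x _ => h1 x]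
  refine (sum_mul_sq_le_sq_mul_sq univ I (fun x => #(TT N M Λ (PS E el x) a))).trans ?_
  have e1 : ∑ x, I x ^ 2 ≤ B := by
    refine le_trans (le_of_eq ?_) hB'
    exact sum_congr rfl fun x _ => by rw [pow_two, hI2]
  have e2 : ∑ x, #(TT N M Λ (PS E el x) a) ^ 2 ≤ 2 * CC M k ^ 2 * (QUAD E el N M Λ a + B) := by
    calc _ ≤ ∑ x, 2 * CC M k ^ 2 * (QQ N M Λ (PS E el x) a + I x) := by
          refine sum_le_sum fun x _ => ?_
          by_cases hx : (TT N M Λ (PS E el x) a).Nonempty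
          · have := (quad N M k Λ (PS E el x) a hN hM hk hx).1
            simp only [hI]; rw [ind_true hx]; linarith
          · rw [not_nonempty_iff_eq_empty.1 hx]; simp
      _ ≤ _ := by
          rw [← mul_sum, sum_add_distrib, QUAD_eq E h]
          gcongr
  calc _ ≤ B * (2 * CC M k ^ 2 * (QUAD E el N M Λ a + B)) := Nat.mul_le_mul e1 e2
    _ = _ := by ring

theorem vn_le (h : IsEl el) (N M : ℕ) (Λ : ℤ) (hΛ : 0 < Λ) (hN : 1 ≤ N)
    (hM : 2 ^ 30 ≤ M) (hd : ∀ p : ℤ, 0 < p → p < M * (8 * N) + 514 * (8 * N) → 2 * p ∣ Λ) :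
    (8 * N) ^ 2 * #(AA Λ) * vn E el N Λ ≤ 2 * M * LIN E el N M Λ + 2 * (8 * N) ^ 2 * ∑ a ∈ AA Λ, nn E el N M Λ a := by
  rw [← LIN_eq E h]
  unfold vn nn
  rw [sum_comm, mul_sum, mul_sum, mul_sum, ← sum_add_distrib]
  refine sum_le_sum fun x _ => ?_
  by_cases hv : vbad (PS E el x) (hh N Λ)
  · rw [ind_true hv]
    by_cases hF : 2 * M * F1 N M Λ (PS E el x) ≤ #(AA Λ) * (8 * N) ^ 2
    · have := good_many N M Λ (PS E el x) hΛ hN hM hd hv hF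
      rw [card_ind] at this
      have e : ∑ a ∈ AA Λ, ind (vbad (PS E el x) (hh N Λ) ∧ good N M Λ (PS E el x) a) = ∑ a ∈ AA Λ, ind (good N M Λ (PS E el x) a) :=
        sum_congr rfl fun a _ => by simp [hv]
      rw [e]
      nlinarith [Nat.zero_le (F1 N M Λ (PS E el x))]
    · push Not at hF
      have := Nat.zero_le (2 * (8 * N) ^ 2 * ∑ a ∈ AA Λ, ind (vbad (PS E el x) (hh N Λ) ∧ good N M Λ (PS E el x) a))
      linarith
  · rw [ind_false hv, mul_zero]; exact Nat.zero_le _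
end
end
end NY

namespace NY
open Finset
noncomputable section
open scoped Classical
set_option linter.all false

def nrm (u : V4) : ℤ := |u.1| + |u.2.1| + |u.2.2.1| + |u.2.2.2|
theorem nrm_smul (n : ℤ) (u : V4) : nrm (n • u) = |n| * nrm u := by
  simp only [nrm, Prod.smul_fst, Prod.smul_snd, smul_eq_mul, abs_mul]; ring
theorem nrm_add (u v : V4) : nrm (u + v) ≤ nrm u + nrm v := by
  simp only [nrm, Prod.fst_add, Prod.snd_add]
  have := abs_add_le u.1 v.1
  have := abs_add_le u.2.1 v.2.1
  have := abs_add_le u.2.2.1 v.2.2.1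
  have := abs_add_le u.2.2.2 v.2.2.2
  linarith
theorem nrm_nonneg (u : V4) : 0 ≤ nrm u := by unfold nrm; positivity
theorem nrm_sub (u v : V4) : nrm (u - v) ≤ nrm u + nrm v := by
  have := nrm_add u ((-1 : ℤ) • v)
  rw [nrm_smul] at this
  rw [show u - v = u + (-1:ℤ) • v by module]
  simpa using this
theorem mem_AP {Λ : ℤ} {a : I3} (h : a ∈ AP Λ) : |a.1| ≤ 2 * Λ ^ 2 ∧ |a.2.1| ≤ 2 * Λ ∧ |a.2.2| ≤ 2 * Λ := by
  simp only [AP, mem_product, mem_Ico] at h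
  obtain ⟨⟨h1, h2⟩, ⟨h3, h4⟩, h5, h6⟩ := h
  simp only [abs_le]
  refine ⟨⟨?_, ?_⟩, ⟨?_, ?_⟩, ?_, ?_⟩ <;> nlinarith
theorem nrm_bb {Λ : ℤ} {a : I3} (hΛ : 0 < Λ) (h : a ∈ AP Λ) : nrm (bb Λ a) ≤ 7 * Λ ^ 2 := by
  obtain ⟨h1, h2, h3⟩ := mem_AP h
  simp only [nrm, bb, abs_mul, abs_of_pos hΛ, abs_pow]
  nlinarith
theorem nrm_w {N : ℕ} {Λ : ℤ} {a : I3} (hΛ : 0 < Λ) (h : a ∈ AP Λ) : nrm (ww0 N Λ a) ≤ 3 * (N * Λ ^ 2) ∧ nrm (ww1 N Λ a) ≤ 3 * (N * Λ ^ 2) := by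
  obtain ⟨h1, h2, h3⟩ := mem_AP h
  have e : (0:ℤ) ≤ N * Λ := by positivity
  simp only [nrm, ww0, ww1, abs_mul, abs_of_pos hΛ, abs_pow, abs_neg, Nat.abs_cast, abs_zero]
  constructor <;> nlinarith
theorem nrm_wv {N : ℕ} {Λ : ℤ} {a : I3} (hΛ : 0 < Λ) (h : a ∈ AP Λ) (l : Fin 3) : nrm (wv (ww0 N Λ a) (ww1 N Λ a) l) ≤ 9 * (N * Λ ^ 2) := by
  obtain ⟨h1, h2⟩ := nrm_w (N := N) hΛ h
  have e : (0:ℤ) ≤ N * Λ ^ 2 := by positivity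
  fin_cases l
  · simp [wv]; linarith
  · simp [wv]; linarith
  · simp only [wv, Fin.reduceFinMk, Matrix.cons_val]
    have := nrm_sub (2 • ww1 N Λ a) (ww0 N Λ a)
    have e2 := nrm_smul 2 (ww1 N Λ a)
    rw [show (2:ℤ) • ww1 N Λ a = 2 • ww1 N Λ a by norm_cast] at e2
    rw [e2, abs_of_nonneg (by norm_num)] at this
    linarith
theorem sg_abs (b : Bool) : |sg b| = 1 := by cases b <;> rfl
theorem gd_abs (b : Fin 3) : |gd b| ≤ 1 := by fin_cases b <;> simp [gd]

def C1 (M : ℕ) : ℕ := 2000 * (M + 514)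

theorem nrm_p {N : ℕ} {Λ : ℤ} {a : I3} (hΛ : 0 < Λ) (h : a ∈ AP Λ) (p B : ℤ) (hp : |p| ≤ B * N) :
    nrm (p • bb Λ a) ≤ 7 * B * (N * Λ ^ 2) := by
  rw [nrm_smul]
  have h1 := nrm_bb hΛ h
  have h2 := nrm_nonneg (bb Λ a)
  calc |p| * nrm (bb Λ a) ≤ (B * N) * (7 * Λ ^ 2) := mul_le_mul hp h1 h2 (le_trans (abs_nonneg _) hp)
    _ = _ := by ring

theorem nrm_lin {N M : ℕ} {Λ : ℤ} {a : I3} (hΛ : 0 < Λ) (h : a ∈ AP Λ) (p d : ℤ) (τ : TI)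
    (hp : p ∈ Ico (M * (8 * N) : ℤ) (M * (8 * N) + 514 * (8 * N))) (hd : d ∈ Ico (8 * N : ℤ) (3 * (8 * N))) :
    nrm (linTest (bb Λ a) (ww0 N Λ a) (ww1 N Λ a) (hh N Λ) p d τ).2.2 ≤ C1 M * (N * Λ ^ 2) := by
  rw [mem_Ico] at hp hd
  have hR : (0:ℤ) ≤ N * Λ ^ 2 := by positivity
  have hMR : (0:ℤ) ≤ M * (N * Λ ^ 2) := by positivity
  have hw := nrm_w (N := N) hΛ h
  have hpb := nrm_p (N := N) hΛ h p (8 * (M + 514)) (by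
    rw [abs_of_nonneg (le_trans (by positivity) hp.1)]; linarith)
  have hdb := nrm_p (N := N) hΛ h d 24 (by
    rw [abs_of_nonneg (le_trans (by positivity) hd.1)]; linarith)
  have hww := nrm_sub (ww1 N Λ a) (ww0 N Λ a)
  have e : ((C1 M : ℕ) : ℤ) * (N * Λ ^ 2) = 2000 * (M * (N * Λ ^ 2)) + 2000 * 514 * (N * Λ ^ 2) := by simp [C1]; ring
  have e' : 7 * (8 * ((M:ℤ) + 514)) * (N * Λ ^ 2) = 56 * (M * (N * Λ ^ 2)) + 56 * 514 * (N * Λ ^ 2) := by ring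
  rw [e]
  rw [e'] at hpb
  obtain ⟨κ, l, ε, δ, c⟩ := τ
  have hwv := nrm_wv (N := N) hΛ h l
  fin_cases κ
  · simp only [linTest]; rw [nrm_smul, sg_abs]; linarith
  · simp only [linTest]; linarith
  · simp only [linTest]; linarith
  · simp only [linTest]
    cases c
    · simp only [Bool.false_eq_true, if_false]
      have := nrm_add (sg δ • (ww1 N Λ a - ww0 N Λ a)) (sg ε • (p • bb Λ a))
      rw [nrm_smul, nrm_smul (sg ε), sg_abs, sg_abs] at this
      linarith
    · simp only [if_true]
      have := nrm_sub (sg δ • (ww1 N Λ a - ww0 N Λ a)) (sg ε • (p • bb Λ a))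
      rw [nrm_smul, nrm_smul (sg ε), sg_abs, sg_abs] at this
      linarith
  · simp only [linTest]; linarith

theorem KK_le (N M : ℕ) (hN : 1 ≤ N) : KK N M ≤ 33 * (M + 514) * N := by
  have : (1:ℤ) ≤ N := by exact_mod_cast hN
  unfold KK
  nlinarith [Int.natCast_nonneg M]

theorem nrm_quad {N M : ℕ} {Λ : ℤ} {a : I3} (hN : 1 ≤ N) (hΛ : 0 < Λ) (h : a ∈ AP Λ) (p m : ℤ) (τ : QI)
    (hp : p ∈ Ico (-KK N M) (KK N M)) (hm : m ∈ Ico (-KK N M) (KK N M)) :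
    nrm (quadTest (bb Λ a) (ww0 N Λ a) (ww1 N Λ a) (hh N Λ) p m τ).2.2 ≤ C1 M * (N * Λ ^ 2) := by
  rw [mem_Ico] at hp hm
  have hK := KK_le N M hN
  have hR : (0:ℤ) ≤ N * Λ ^ 2 := by positivity
  have hMR : (0:ℤ) ≤ M * (N * Λ ^ 2) := by positivity
  have hw := nrm_w (N := N) hΛ h
  have hpb := nrm_p (N := N) hΛ h ((m - p) * 2) (132 * (M + 514)) (by
    rw [abs_le]; constructor <;> linarith)
  rw [mul_smul] at hpb
  have hww := nrm_sub (ww1 N Λ a) (ww0 N Λ a)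
  have hww0 := nrm_nonneg (ww1 N Λ a - ww0 N Λ a)
  have e : ((C1 M : ℕ) : ℤ) * (N * Λ ^ 2) = 2000 * (M * (N * Λ ^ 2)) + 2000 * 514 * (N * Λ ^ 2) := by simp [C1]; ring
  have e' : 7 * (132 * ((M:ℤ) + 514)) * (N * Λ ^ 2) = 924 * (M * (N * Λ ^ 2)) + 924 * 514 * (N * Λ ^ 2) := by ring
  rw [e]
  rw [e'] at hpb
  obtain ⟨κ, l, δ⟩ := τ
  have hwv := nrm_wv (N := N) hΛ h l
  fin_cases κ
  · simp only [quadTest]; linarith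
  · simp only [quadTest]
    have := nrm_add ((m - p) • (2:ℤ) • bb Λ a) (wv (ww0 N Λ a) (ww1 N Λ a) l)
    linarith
  · simp only [quadTest]
    have := nrm_add ((m - p) • (2:ℤ) • bb Λ a) (gd δ • (ww1 N Λ a - ww0 N Λ a))
    rw [nrm_smul (gd δ)] at this
    have h3 := gd_abs δ
    nlinarith

section
variable {G : Type*} [Group G] [Fintype G] (E : G → Bool) (el : ℕ → V4 → ℤ → G) (Per : ℝ)

structure Sys : Prop where
  isel : ∀ s, IsEl (el s)
  pw : ∀ s u, el s u 0 = (el 0 u 0) ^ (2 ^ s)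
  per0 : 0 ≤ Per
  per : ∀ u, (Dd E (el 0 u 0) : ℝ) ≤ nrm u * Per
variable {E el Per}

theorem Sys.Ph_dir (H : Sys E el Per) (l S : ℕ) (u : V4) (K : ℤ) (hu : nrm u ≤ K) :
    ∑ s ∈ range S, (Ph E (2 ^ l) (el s u 0) : ℝ) / 2 ^ s ≤ 2 ^ l * l * (K * Per) := by
  rw [sum_congr rfl fun s _ => by rw [H.pw s u]]
  refine (Ph_sum E l S (el 0 u 0)).trans ?_
  gcongr
  refine (H.per u).trans ?_
  have := H.per0
  have : (nrm u : ℝ) ≤ K := by exact_mod_cast hu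
  gcongr

theorem Sys.D_dir (H : Sys E el Per) (s : ℕ) (u : V4) : (Dd E (el s u 0) : ℝ) ≤ 2 ^ s * (nrm u * Per) := by
  rw [H.pw s u]
  have := Dd_pow E (el 0 u 0) (2 ^ s)
  calc (Dd E ((el 0 u 0) ^ 2 ^ s) : ℝ) ≤ 2 ^ s * Dd E (el 0 u 0) := by exact_mod_cast this
    _ ≤ _ := by gcongr; exact H.per u

def C2 (l : ℕ) : ℝ := 2 ^ l * l * C1 (2 ^ l)

theorem Sys.LIN_sum (H : Sys E el Per) (N l S : ℕ) (Λ : ℤ) (hΛ : 0 < Λ) :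
    ∑ s ∈ range S, (LIN E (el s) N (2 ^ l) Λ : ℝ) / 2 ^ s ≤
      (514 * (8 * N)) * (2 * (8 * N)) * (27 * #(AA Λ)) * 120 * (C2 l * (N * Λ ^ 2) * Per) := by
  have e : ∑ s ∈ range S, (LIN E (el s) N (2 ^ l) Λ : ℝ) / 2 ^ s =
      ∑ p ∈ Ico ((2 ^ l : ℕ) * (8 * N) : ℤ) ((2 ^ l : ℕ) * (8 * N) + 514 * (8 * N)), ∑ d ∈ Ico (8 * N : ℤ) (3 * (8 * N)),
      ∑ a ∈ AP Λ, ∑ τ : TI, ∑ s ∈ range S, (Ph E (2 ^ l) (el s (linTest (bb Λ a) (ww0 N Λ a) (ww1 N Λ a) (hh N Λ) p d τ).2.2 0) : ℝ) / 2 ^ s := by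
    unfold LIN
    push_cast
    simp only [sum_div]
    rw [sum_comm]; refine sum_congr rfl fun p _ => ?_
    rw [sum_comm]; refine sum_congr rfl fun d _ => ?_
    rw [sum_comm]; refine sum_congr rfl fun a _ => ?_
    rw [sum_comm]
  rw [e]
  have c1 : (#(Ico ((2 ^ l : ℕ) * (8 * N) : ℤ) ((2 ^ l : ℕ) * (8 * N) + 514 * (8 * N))) : ℝ) = 514 * (8 * N) := by
    rw [Int.card_Ico, show ∀ x : ℤ, x + 514 * (8 * N) - x = ((514 * (8 * N) : ℕ) : ℤ) by intro x; push_cast; ring, Int.toNat_natCast]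
    push_cast; ring
  have c2 : (#(Ico (8 * N : ℤ) (3 * (8 * N))) : ℝ) = 2 * (8 * N) := by
    rw [Int.card_Ico, show (3 * (8 * N) - 8 * N : ℤ) = ((2 * (8 * N) : ℕ) : ℤ) by push_cast; ring, Int.toNat_natCast]
    push_cast; ring
  have c3 : (#(AP Λ) : ℝ) = 27 * #(AA Λ) := by rw [card_AP Λ hΛ.le]; push_cast; ring
  rw [← c1, ← c2, ← c3]
  have c4 : (Fintype.card TI : ℝ) = 120 := by
    have : Fintype.card TI = 120 := by simp [TI]
    rw [this]; norm_num
  calc _ ≤ ∑ p ∈ Ico ((2 ^ l : ℕ) * (8 * N) : ℤ) ((2 ^ l : ℕ) * (8 * N) + 514 * (8 * N)), ∑ d ∈ Ico (8 * N : ℤ) (3 * (8 * N)),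
      ∑ a ∈ AP Λ, ∑ τ : TI, (C2 l * (N * Λ ^ 2) * Per) := by
        refine sum_le_sum fun p hp => sum_le_sum fun d hd => sum_le_sum fun a ha => sum_le_sum fun τ _ => ?_
        refine (H.Ph_dir l S _ _ (nrm_lin hΛ ha p d τ hp hd)).trans (le_of_eq ?_)
        unfold C2; push_cast; ring
    _ = _ := by
        simp only [sum_const, card_univ, nsmul_eq_mul, c4]
        ring

theorem Sys.QUAD_sum (H : Sys E el Per) (N l S : ℕ) (Λ : ℤ) (a : I3) (ha : a ∈ AP Λ) (hN : 1 ≤ N) (hΛ : 0 < Λ) :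
    ∑ s ∈ range S, (QUAD E (el s) N (2 ^ l) Λ a : ℝ) / 2 ^ s ≤
      27 * (66 * (2 ^ l + 514) * N) ^ 2 * (C2 l * (N * Λ ^ 2) * Per) := by
  have e : ∑ s ∈ range S, (QUAD E (el s) N (2 ^ l) Λ a : ℝ) / 2 ^ s =
      ∑ p ∈ Ico (-KK N (2 ^ l)) (KK N (2 ^ l)), ∑ m ∈ Ico (-KK N (2 ^ l)) (KK N (2 ^ l)),
      ∑ τ : QI, ∑ s ∈ range S, (Ph E (2 ^ l) (el s (quadTest (bb Λ a) (ww0 N Λ a) (ww1 N Λ a) (hh N Λ) p m τ).2.2 0) : ℝ) / 2 ^ s := by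
    unfold QUAD
    push_cast
    simp only [sum_div]
    rw [sum_comm]; refine sum_congr rfl fun p _ => ?_
    rw [sum_comm]; refine sum_congr rfl fun d _ => ?_
    rw [sum_comm]
  rw [e]
  have c1 : (#(Ico (-KK N (2 ^ l)) (KK N (2 ^ l))) : ℝ) ≤ 66 * (2 ^ l + 514) * N := by
    have h1 := KK_le N (2 ^ l) hN
    have h0 : 0 ≤ KK N (2 ^ l) := by unfold KK; positivity
    have h2 : ((#(Ico (-KK N (2 ^ l)) (KK N (2 ^ l))) : ℕ) : ℤ) ≤ 66 * (2 ^ l + 514) * N := by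
      rw [Int.card_Ico, Int.toNat_of_nonneg (by linarith)]
      push_cast at h1
      linarith
    exact_mod_cast h2
  have c4 : (Fintype.card QI : ℝ) = 27 := by
    have : Fintype.card QI = 27 := by simp [QI]
    rw [this]; norm_num
  calc _ ≤ ∑ p ∈ Ico (-KK N (2 ^ l)) (KK N (2 ^ l)), ∑ m ∈ Ico (-KK N (2 ^ l)) (KK N (2 ^ l)),
      ∑ τ : QI, (C2 l * (N * Λ ^ 2) * Per) := by
        refine sum_le_sum fun p hp => sum_le_sum fun d hd => sum_le_sum fun τ _ => ?_
        refine (H.Ph_dir l S _ _ (nrm_quad hN hΛ ha p d τ hp hd)).trans (le_of_eq ?_)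
        unfold C2; push_cast; ring
    _ = 27 * (#(Ico (-KK N (2 ^ l)) (KK N (2 ^ l))) : ℝ) ^ 2 * (C2 l * (N * Λ ^ 2) * Per) := by
        simp only [sum_const, card_univ, nsmul_eq_mul, c4]
        ring
    _ ≤ _ := by
        have := H.per0
        have : 0 ≤ C2 l := by unfold C2; positivity
        gcongr
end
end
end NY

namespace NY
open Finset
noncomputable section
open scoped Classical
set_option linter.all false

section
variable {G : Type*} [Group G] [Fintype G] {E : G → Bool} {el : ℕ → V4 → ℤ → G} {Per : ℝ}

theorem AA_AP {Λ : ℤ} {a : I3} (h : a ∈ AA Λ) : a ∈ AP Λ := by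
  simp only [AA, AP, mem_product, mem_Ico] at h ⊢
  obtain ⟨⟨h1, h2⟩, ⟨h3, h4⟩, h5, h6⟩ := h
  refine ⟨⟨?_, ?_⟩, ⟨?_, ?_⟩, ?_, ?_⟩ <;> nlinarith

def c3 (l : ℕ) : ℝ := 2 * 2 ^ l * 514 * 2 * 27 * 120 * C2 l
def c5 (l : ℕ) : ℝ := 924 * (2 ^ l + 514)
def c6 (l k : ℕ) : ℝ := 2 * CC (2 ^ l) k ^ 2 * c5 l * (27 * (66 * (2 ^ l + 514)) ^ 2 * C2 l + c5 l)

theorem Sys.nn_sum (H : Sys E el Per) (N l k S : ℕ) (Λ : ℤ) (a : I3) (ha : a ∈ AP Λ) (hN : 1 ≤ N) (hΛ : 0 < Λ)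
    (hl : 1 ≤ l) (hk : 8 * (2 ^ l + 512) ≤ 2 ^ k) (hS : S ≤ N ^ 2) :
    ∑ s ∈ range S, ((nn E (el s) N (2 ^ l) Λ a : ℝ) / (N * Λ ^ 2 * 2 ^ s)) ^ 2 ≤ c6 l k * Per ^ 2 := by
  have hP := H.per0
  have hN' : (1:ℝ) ≤ N := by exact_mod_cast hN
  have hN0 : (0:ℝ) < N := by linarith
  have hΛ' : (0:ℝ) < Λ := by exact_mod_cast hΛ
  have h5 : 0 ≤ c5 l := by unfold c5; positivity
  set R : ℝ := N * Λ ^ 2 with hR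
  have hR0 : 0 < R := by positivity
  have key : ∀ s ∈ range S, ((nn E (el s) N (2 ^ l) Λ a : ℝ) / (R * 2 ^ s)) ^ 2 ≤
      (2 * CC (2 ^ l) k ^ 2 * c5 l * Per / N ^ 2) * ((QUAD E (el s) N (2 ^ l) Λ a : ℝ) / 2 ^ s / R + c5 l * Per) := by
    intro s _
    have h1 := nn_le E (H.isel s) N (2 ^ l) k Λ a _ hN (by calc 2 = 2 ^ 1 := by norm_num
      _ ≤ 2 ^ l := Nat.pow_le_pow_right (by norm_num) hl) hk le_rfl
    set B : ℕ := (2 * KK N (2 ^ l)).toNat * Dd E (el s ((2:ℤ) • bb Λ a) 0) with hB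
    have hBle : (B : ℝ) ≤ c5 l * R * 2 ^ s * Per := by
      have e1 : (((2 * KK N (2 ^ l)).toNat : ℕ) : ℝ) ≤ 66 * (2 ^ l + 514) * N := by
        have h1 := KK_le N (2 ^ l) hN
        have h0 : 0 ≤ KK N (2 ^ l) := by unfold KK; positivity
        have h2 : (((2 * KK N (2 ^ l)).toNat : ℕ) : ℤ) ≤ 66 * (2 ^ l + 514) * N := by
          rw [Int.toNat_of_nonneg (by linarith)]
          push_cast at h1
          linarith
        exact_mod_cast h2
      have e2 := H.D_dir s ((2:ℤ) • bb Λ a)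
      have e3 : (nrm ((2:ℤ) • bb Λ a) : ℝ) ≤ 14 * Λ ^ 2 := by
        have := nrm_bb hΛ ha
        have h2 : nrm ((2:ℤ) • bb Λ a) ≤ 14 * Λ ^ 2 := by rw [nrm_smul]; norm_num; linarith
        exact_mod_cast h2
      rw [hB]; push_cast
      calc _ ≤ (66 * (2 ^ l + 514) * N) * (2 ^ s * (14 * Λ ^ 2 * Per)) := by
            gcongr
            exact e2.trans (by gcongr)
        _ = _ := by rw [hR]; unfold c5; ring
    have h2 : ((N : ℝ) * nn E (el s) N (2 ^ l) Λ a) ^ 2 ≤ 2 * CC (2 ^ l) k ^ 2 * (B * (QUAD E (el s) N (2 ^ l) Λ a + B)) := by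
      exact_mod_cast h1
    set n : ℝ := (nn E (el s) N (2 ^ l) Λ a : ℝ)
    set Q : ℝ := (QUAD E (el s) N (2 ^ l) Λ a : ℝ)
    have hQ : 0 ≤ Q := Nat.cast_nonneg _
    have h3 : (N * n) ^ 2 ≤ 2 * CC (2 ^ l) k ^ 2 * ((c5 l * R * 2 ^ s * Per) * (Q + c5 l * R * 2 ^ s * Per)) := by
      refine h2.trans (mul_le_mul_of_nonneg_left ?_ (mul_nonneg zero_le_two (sq_nonneg _)))
      have hb0 : (0:ℝ) ≤ B := Nat.cast_nonneg _
      exact mul_le_mul hBle (by linarith) (by linarith) (by linarith)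
    have e : (2 * CC (2 ^ l) k ^ 2 * c5 l * Per / N ^ 2) * (Q / 2 ^ s / R + c5 l * Per)
      = 2 * CC (2 ^ l) k ^ 2 * ((c5 l * R * 2 ^ s * Per) * (Q + c5 l * R * 2 ^ s * Per)) / (N * (R * 2 ^ s)) ^ 2 := by
      field_simp
    rw [e, show (n / (R * 2 ^ s)) ^ 2 = (N * n) ^ 2 / (N * (R * 2 ^ s)) ^ 2 by field_simp]
    gcongr
  refine (sum_le_sum key).trans ?_
  rw [← mul_sum, sum_add_distrib, ← sum_div]
  have q := H.QUAD_sum N l S Λ a ha hN hΛ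
  simp only [sum_const, card_range, nsmul_eq_mul]
  have hS' : (S:ℝ) ≤ N ^ 2 := by exact_mod_cast hS
  calc _ ≤ (2 * CC (2 ^ l) k ^ 2 * c5 l * Per / N ^ 2) * (27 * (66 * (2 ^ l + 514) * N) ^ 2 * (C2 l * R * Per) / R + N ^ 2 * (c5 l * Per)) := by
        gcongr
    _ = _ := by unfold c6; field_simp

set_option maxHeartbeats 1000000 in
theorem Sys.vn_sum (H : Sys E el Per) (N l k S : ℕ) (Λ : ℤ) (hN : 1 ≤ N) (hΛ : 0 < Λ)
    (hl : 30 ≤ l) (hk : 8 * (2 ^ l + 512) ≤ 2 ^ k) (hS : S ≤ N ^ 2)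
    (hd : ∀ p : ℤ, 0 < p → p < (2 ^ l : ℕ) * (8 * N) + 514 * (8 * N) → 2 * p ∣ Λ) :
    ∑ s ∈ range S, ((vn E (el s) N Λ : ℝ) / (N * Λ ^ 2 * 2 ^ s)) ^ 2 ≤ (2 * c3 l ^ 2 + 8 * c6 l k) * Per ^ 2 := by
  have hP := H.per0
  have hN' : (1:ℝ) ≤ N := by exact_mod_cast hN
  have hN0 : (0:ℝ) < N := by linarith
  have hΛ' : (0:ℝ) < Λ := by exact_mod_cast hΛ
  have hA : (0:ℝ) < #(AA Λ) := by
    have : (0, 0, 0) ∈ AA Λ := by simp only [AA, mem_product, mem_Ico]; refine ⟨⟨?_, ?_⟩, ⟨?_, ?_⟩, ?_, ?_⟩ <;> positivity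
    exact_mod_cast card_pos.2 ⟨_, this⟩
  have nns := fun a ha => H.nn_sum N l k S Λ a (AA_AP ha) hN hΛ (by linarith) hk hS
  have ls := H.LIN_sum N l S Λ hΛ
  generalize c6 l k = c at nns ⊢
  set R : ℝ := N * Λ ^ 2 with hR
  have hR0 : 0 < R := by positivity
  set A : ℝ := ((#(AA Λ) : ℕ) : ℝ) with hAdef
  let u : ℕ → ℝ := fun s => 2 * 2 ^ l / ((8 * N) ^ 2 * A * R) * ((LIN E (el s) N (2 ^ l) Λ : ℝ) / 2 ^ s)
  have hu0 : ∀ s, 0 ≤ u s := fun s => by positivity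
  have key : ∀ s ∈ range S, ((vn E (el s) N Λ : ℝ) / (R * 2 ^ s)) ^ 2 ≤
      2 * u s ^ 2 + 8 / A * ∑ a ∈ AA Λ, ((nn E (el s) N (2 ^ l) Λ a : ℝ) / (R * 2 ^ s)) ^ 2 := by
    intro s _
    have h1 := vn_le E (H.isel s) N (2 ^ l) Λ hΛ hN (Nat.pow_le_pow_right (by norm_num) hl) hd
    have h2 : (8 * N) ^ 2 * A * vn E (el s) N Λ ≤ 2 * 2 ^ l * LIN E (el s) N (2 ^ l) Λ + 2 * (8 * N) ^ 2 * ∑ a ∈ AA Λ, (nn E (el s) N (2 ^ l) Λ a : ℝ) := by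
      rw [hAdef]; exact_mod_cast h1
    have h3 : (vn E (el s) N Λ : ℝ) / (R * 2 ^ s) ≤ u s + 2 / A * ∑ a ∈ AA Λ, (nn E (el s) N (2 ^ l) Λ a : ℝ) / (R * 2 ^ s) := by
      rw [← sum_div, show (vn E (el s) N Λ : ℝ) / (R * 2 ^ s) = ((8 * N) ^ 2 * A * vn E (el s) N Λ) / ((8 * N) ^ 2 * A * (R * 2 ^ s)) by field_simp]
      calc _ ≤ _ := div_le_div_of_nonneg_right h2 (by positivity)
        _ = _ := by simp only [u]; field_simp
    have h4 := sq_sum_le_card_mul_sum_sq (s := AA Λ) (f := fun a => (nn E (el s) N (2 ^ l) Λ a : ℝ) / (R * 2 ^ s))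
    have h5 : 0 ≤ ∑ a ∈ AA Λ, (nn E (el s) N (2 ^ l) Λ a : ℝ) / (R * 2 ^ s) := sum_nonneg fun a _ => by positivity
    set T := ∑ a ∈ AA Λ, (nn E (el s) N (2 ^ l) Λ a : ℝ) / (R * 2 ^ s)
    set W := ∑ a ∈ AA Λ, ((nn E (el s) N (2 ^ l) Λ a : ℝ) / (R * 2 ^ s)) ^ 2
    calc _ ≤ (u s + 2 / A * T) ^ 2 := by gcongr
      _ ≤ 2 * u s ^ 2 + 2 * (2 / A * T) ^ 2 := by nlinarith [sq_nonneg (u s - 2 / A * T)]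
      _ = 2 * u s ^ 2 + 8 / A ^ 2 * T ^ 2 := by ring
      _ ≤ 2 * u s ^ 2 + 8 / A ^ 2 * (A * W) := by gcongr
      _ = _ := by field_simp
  refine (sum_le_sum key).trans ?_
  rw [sum_add_distrib, ← mul_sum, ← mul_sum, sum_comm]
  have i1 : ∑ s ∈ range S, u s ^ 2 ≤ (c3 l * Per) ^ 2 := by
    refine (sum_sq_le_sq_sum_of_nonneg fun i _ => hu0 i).trans ?_
    have : ∑ s ∈ range S, u s ≤ c3 l * Per := by
      simp only [u]
      rw [← mul_sum]
      refine (mul_le_mul_of_nonneg_left ls (by positivity)).trans (le_of_eq ?_)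
      unfold c3; field_simp
    have h0 : 0 ≤ ∑ s ∈ range S, u s := sum_nonneg fun s _ => hu0 s
    gcongr
  have i2 : ∑ a ∈ AA Λ, ∑ s ∈ range S, ((nn E (el s) N (2 ^ l) Λ a : ℝ) / (R * 2 ^ s)) ^ 2 ≤ A * (c * Per ^ 2) := by
    calc _ ≤ ∑ a ∈ AA Λ, c * Per ^ 2 := sum_le_sum fun a ha => nns a ha
      _ = _ := by rw [sum_const, nsmul_eq_mul]
  calc _ ≤ 2 * (c3 l * Per) ^ 2 + 8 / A * (A * (c * Per ^ 2)) := by gcongr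
    _ = _ := by field_simp
end
end
end NY

namespace NY
open Finset
noncomputable section
open scoped Classical
set_option linter.all false

@[ext] structure Hs (K : Type) where
  a : K
  b : K
  c : K
  d : K
  z : K

section
variable {K : Type} [CommRing K]
def Hs.mul (x y : Hs K) : Hs K :=
  ⟨x.a + y.a, x.b + y.b, x.c + y.c, x.d + y.d, x.z + y.z + (x.a * y.b - x.b * y.a + x.c * y.d - x.d * y.c)⟩
instance : Group (Hs K) where
  mul := Hs.mul
  one := ⟨0, 0, 0, 0, 0⟩
  inv x := ⟨-x.a, -x.b, -x.c, -x.d, -x.z⟩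
  mul_assoc x y z := by
    change Hs.mul (Hs.mul x y) z = Hs.mul x (Hs.mul y z)
    ext <;> simp only [Hs.mul] <;> ring
  one_mul x := by
    change Hs.mul ⟨0, 0, 0, 0, 0⟩ x = x
    ext <;> simp only [Hs.mul] <;> ring
  mul_one x := by
    change Hs.mul x ⟨0, 0, 0, 0, 0⟩ = x
    ext <;> simp only [Hs.mul] <;> ring
  inv_mul_cancel x := by
    change Hs.mul ⟨-x.a, -x.b, -x.c, -x.d, -x.z⟩ x = ⟨0, 0, 0, 0, 0⟩
    ext <;> simp only [Hs.mul] <;> ring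
theorem Hs.mul_def (x y : Hs K) : x * y =
  ⟨x.a + y.a, x.b + y.b, x.c + y.c, x.d + y.d, x.z + y.z + (x.a * y.b - x.b * y.a + x.c * y.d - x.d * y.c)⟩ := rfl
theorem Hs.one_def : (1 : Hs K) = ⟨0, 0, 0, 0, 0⟩ := rfl
theorem Hs.inv_def (x : Hs K) : x⁻¹ = ⟨-x.a, -x.b, -x.c, -x.d, -x.z⟩ := rfl
theorem Hs.pow_def (x : Hs K) (n : ℕ) : x ^ n = ⟨n * x.a, n * x.b, n * x.c, n * x.d, n * x.z⟩ := by
  induction n with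
  | zero => simp [Hs.one_def]
  | succ n ih => rw [pow_succ, ih, Hs.mul_def]; ext <;> push_cast <;> ring
theorem Hs.zpow_def (x : Hs K) (n : ℤ) : x ^ n = ⟨n * x.a, n * x.b, n * x.c, n * x.d, n * x.z⟩ := by
  obtain ⟨n, rfl | rfl⟩ := n.eq_nat_or_neg
  · rw [zpow_natCast, Hs.pow_def]; simp
  · rw [zpow_neg, zpow_natCast, Hs.pow_def, Hs.inv_def]; simp
instance [Fintype K] : Fintype (Hs K) :=
  Fintype.ofInjective (fun x : Hs K => (x.a, x.b, x.c, x.d, x.z)) (by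
    intro x y h; simp only [Prod.mk.injEq] at h; ext <;> simp [h])

def hl (r s : ℕ) (v : V4) (ζ : ℤ) : Hs K :=
  ⟨2 ^ (s + 1) * v.1, 2 ^ (s + 1 + r) * v.2.1, 2 ^ (s + 1) * v.2.2.1, 2 ^ (s + 1 + r) * v.2.2.2, 4 * 2 ^ (2 * s + r) * ζ⟩
theorem hl_isel (r s : ℕ) : IsEl (hl (K := K) r s) := by
  intro v ζ u η
  rw [Hs.mul_def]
  simp only [hl, om_apply]
  ext <;> simp only [Prod.fst_add, Prod.snd_add] <;> push_cast <;> ring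
theorem hl_pw (r s : ℕ) (u : V4) : hl (K := K) r s u 0 = (hl r 0 u 0) ^ (2 ^ s) := by
  rw [Hs.pow_def]
  simp only [hl]
  ext <;> push_cast <;> ring

variable (K) in
def e1 : Hs K := ⟨1, 0, 0, 0, 0⟩
variable (K) in
def e2 : Hs K := ⟨0, 1, 0, 0, 0⟩
variable (K) in
def e3 : Hs K := ⟨0, 0, 1, 0, 0⟩
variable (K) in
def e4 : Hs K := ⟨0, 0, 0, 1, 0⟩
variable [Fintype K]
def Pr (E : Hs K → Bool) : ℕ := Dd E (e1 K) + Dd E (e2 K) + Dd E (e3 K) + Dd E (e4 K)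

theorem hl_per (E : Hs K → Bool) (r : ℕ) (hr : r ≤ 1) (u : V4) : Dd E (hl r 0 u 0) ≤ nrm u * (4 * Pr E : ℤ) := by
  have e : hl (K := K) r 0 u 0 = e1 K ^ u.1 * e2 K ^ (2 ^ (1 + r) * u.2.1) * e1 K ^ u.1
      * (e3 K ^ u.2.2.1 * e4 K ^ (2 ^ (1 + r) * u.2.2.2) * e3 K ^ u.2.2.1) := by
    simp only [Hs.zpow_def, e1, e2, e3, e4, Hs.mul_def, hl]
    ext <;> push_cast <;> ring
  rw [e]
  have h0 : ∀ g (n : ℤ), (Dd E (g ^ n) : ℤ) ≤ |n| * Dd E g := fun g n => by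
    have := Dd_zpow E g n
    rw [← Int.natCast_natAbs]; exact_mod_cast this
  have hm : ∀ g h, (Dd E (g * h) : ℤ) ≤ Dd E g + Dd E h := fun g h => by exact_mod_cast Dd_mul E g h
  have h4 : ∀ n : ℤ, |2 ^ (1 + r) * n| ≤ 4 * |n| := fun n => by
    rw [abs_mul]
    gcongr
    interval_cases r <;> simp
  have f1 := h0 (e1 K) u.1
  have f2 := (h0 (e2 K) (2 ^ (1 + r) * u.2.1)).trans (mul_le_mul_of_nonneg_right (h4 _) (by positivity))
  have f3 := h0 (e3 K) u.2.2.1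
  have f4 := (h0 (e4 K) (2 ^ (1 + r) * u.2.2.2)).trans (mul_le_mul_of_nonneg_right (h4 _) (by positivity))
  have g1 := hm (e1 K ^ u.1 * e2 K ^ (2 ^ (1 + r) * u.2.1) * e1 K ^ u.1) (e3 K ^ u.2.2.1 * e4 K ^ (2 ^ (1 + r) * u.2.2.2) * e3 K ^ u.2.2.1)
  have g2 := hm (e1 K ^ u.1 * e2 K ^ (2 ^ (1 + r) * u.2.1)) (e1 K ^ u.1)
  have g3 := hm (e1 K ^ u.1) (e2 K ^ (2 ^ (1 + r) * u.2.1))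
  have g4 := hm (e3 K ^ u.2.2.1 * e4 K ^ (2 ^ (1 + r) * u.2.2.2)) (e3 K ^ u.2.2.1)
  have g5 := hm (e3 K ^ u.2.2.1) (e4 K ^ (2 ^ (1 + r) * u.2.2.2))
  have d1 : (Dd E (e1 K) : ℤ) ≤ Pr E := by unfold Pr; push_cast; linarith
  have d2 : (Dd E (e2 K) : ℤ) ≤ Pr E := by unfold Pr; push_cast; linarith
  have d3 : (Dd E (e3 K) : ℤ) ≤ Pr E := by unfold Pr; push_cast; linarith
  have d4 : (Dd E (e4 K) : ℤ) ≤ Pr E := by unfold Pr; push_cast; linarith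
  have k1 := mul_le_mul_of_nonneg_left d1 (abs_nonneg u.1)
  have k2 := mul_le_mul_of_nonneg_left d2 (abs_nonneg u.2.1)
  have k3 := mul_le_mul_of_nonneg_left d3 (abs_nonneg u.2.2.1)
  have k4 := mul_le_mul_of_nonneg_left d4 (abs_nonneg u.2.2.2)
  have hp : (0:ℤ) ≤ Pr E := Int.natCast_nonneg _
  have p1 := mul_nonneg (abs_nonneg u.1) hp
  have p3 := mul_nonneg (abs_nonneg u.2.2.1) hp
  unfold nrm
  linarith

theorem hl_sys (E : Hs K → Bool) (r : ℕ) (hr : r ≤ 1) : Sys E (hl r) (4 * Pr E : ℝ) where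
  isel := hl_isel r
  pw := hl_pw r
  per0 := by positivity
  per u := by exact_mod_cast hl_per E r hr u

def cp {G : Type*} (E : G → Bool) : G → Bool := fun x => !(E x)
theorem Dd_cp {G : Type*} [Group G] [Fintype G] (E : G → Bool) (g : G) : Dd (cp E) g = Dd E g := by
  unfold Dd cp
  refine sum_congr rfl fun x _ => ?_
  congr 1; simp
theorem Pr_cp (E : Hs K → Bool) : Pr (cp E) = Pr E := by simp only [Pr, Dd_cp]

theorem Dd_sq {G : Type*} [Group G] [Fintype G] (E : G → Bool) (el : V4 → ℤ → G) (h : IsEl el) (N : ℕ) (Λ : ℤ) :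
    2 * Dd E (el 0 (hh N Λ)) = Dd E (el 0 (2 * hh N Λ)) + 2 * (vn E el N Λ + vn (cp E) el N Λ) := by
  have e : el 0 (2 * hh N Λ) = el 0 (hh N Λ) * el 0 (hh N Λ) := by
    rw [h]; simp only [map_zero, LinearMap.zero_apply, add_zero]; rw [two_mul]
  have e2 : Dd E (el 0 (hh N Λ)) = ∑ x, ind (E (x * el 0 (hh N Λ)) ≠ E (x * el 0 (2 * hh N Λ))) := by
    unfold Dd
    rw [← sum_shift (fun x => ind (E x ≠ E (x * _))) (el 0 (hh N Λ))]
    refine sum_congr rfl fun x _ => ?_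
    rw [e, mul_assoc]
  rw [two_mul]
  nth_rw 1 [e2]
  unfold Dd vn
  rw [← sum_add_distrib, ← sum_add_distrib, mul_sum, ← sum_add_distrib]
  refine sum_congr rfl fun x _ => ?_
  unfold vbad PS cp
  rw [el_zero h, mul_one]
  generalize E x = p
  generalize E (x * el 0 (hh N Λ)) = q
  generalize E (x * el 0 (2 * hh N Λ)) = t
  cases p <;> cases q <;> cases t <;> simp [ind]
end
end
end NY

namespace NY
open Finset
noncomputable section
open scoped Classical
set_option linter.all false

theorem seq_lem (v n : ℕ → ℝ) (J : ℕ) (h : ∀ j, v j = v (j + 1) / √2 + n j) :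
    ∑ j ∈ range J, v j ^ 2 ≤ 3 * v J ^ 2 + 12 * ∑ j ∈ range J, n j ^ 2 := by
  have h1 : ∀ j, v j ^ 2 ≤ 3 / 4 * v (j + 1) ^ 2 + 3 * n j ^ 2 := by
    intro j
    have e : (v (j + 1) / √2) ^ 2 = v (j + 1) ^ 2 / 2 := by rw [div_pow, Real.sq_sqrt (by norm_num)]
    rw [h j]
    nlinarith [sq_nonneg (v (j + 1) / √2 - 2 * n j)]
  have h2 : ∑ j ∈ range J, v j ^ 2 ≤ 3 / 4 * ∑ j ∈ range J, v (j + 1) ^ 2 + 3 * ∑ j ∈ range J, n j ^ 2 := by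
    rw [mul_sum, mul_sum, ← sum_add_distrib]
    exact sum_le_sum fun j _ => h1 j
  have h3 := sum_range_succ (fun j => v j ^ 2) J
  have h4 := sum_range_succ' (fun j => v j ^ 2) J
  have := sq_nonneg (v 0)
  linarith

theorem sum_two (f : ℕ → ℝ) (S : ℕ) : ∑ j ∈ range (2 * S), f j = ∑ s ∈ range S, f (2 * s) + ∑ s ∈ range S, f (2 * s + 1) := by
  induction S with
  | zero => simp
  | succ S ih =>
    rw [show 2 * (S + 1) = 2 * S + 1 + 1 by ring, sum_range_succ, sum_range_succ, ih, sum_range_succ, sum_range_succ]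
    ring

section
variable {K : Type} [CommRing K]
def ze (t : ℤ) : Hs K := ⟨0, 0, 0, 0, t⟩
variable [Fintype K]

theorem ze_comm (E : Hs K → Bool) (w : ℕ) : (Dd E (ze ((2 * w) ^ 2)) : ℝ) ≤ 4 * w * Pr E := by
  have e : ze (K := K) ((2 * w) ^ 2) = e1 K ^ (2 * w) * e2 K ^ w * ((e1 K ^ (2 * w))⁻¹ * (e2 K ^ w)⁻¹) := by
    simp only [Hs.pow_def, Hs.inv_def, Hs.mul_def, e1, e2, ze]
    ext <;> push_cast <;> ring
  have h : Dd E (ze (K := K) ((2 * w) ^ 2)) ≤ 4 * w * Pr E := by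
    rw [e]
    have g1 := Dd_mul E (e1 K ^ (2 * w) * e2 K ^ w) ((e1 K ^ (2 * w))⁻¹ * (e2 K ^ w)⁻¹)
    have g2 := Dd_mul E (e1 K ^ (2 * w)) (e2 K ^ w)
    have g3 := Dd_mul E (e1 K ^ (2 * w))⁻¹ (e2 K ^ w)⁻¹
    rw [Dd_inv, Dd_inv] at g3
    have g4 := Dd_pow E (e1 K) (2 * w)
    have g5 := Dd_pow E (e2 K) w
    unfold Pr
    nlinarith [Nat.zero_le (w * Dd E (e2 K)), Nat.zero_le (w * Dd E (e3 K)), Nat.zero_le (w * Dd E (e4 K))]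
  exact_mod_cast h

theorem set_sq (l k : ℕ) (hl' : 30 ≤ l) (hk : 8 * (2 ^ l + 512) ≤ 2 ^ k) (E : Hs K → Bool) (N S L : ℕ) (hN : 1 ≤ N) (hL : 0 < L)
    (hS : S ≤ N ^ 2) (hd : ∀ p : ℤ, 0 < p → p < (2 ^ l : ℕ) * (8 * N) + 514 * (8 * N) → 2 * p ∣ L) :
    ∑ j ∈ range (2 * S), ((Dd E (ze (4 * (N * L ^ 2) ^ 2 * 2 ^ j)) : ℝ) / (N * L ^ 2 * √2 ^ j)) ^ 2 ≤
      (48 + 12 * (128 * (2 * c3 l ^ 2 + 8 * c6 l k))) * (Pr E : ℝ) ^ 2 := by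
  have hR : (0:ℝ) < N * L ^ 2 := by
    have : (1:ℝ) ≤ N := by exact_mod_cast hN
    have : (1:ℝ) ≤ L := by exact_mod_cast hL
    positivity
  have hL' : (0:ℤ) < L := by exact_mod_cast hL
  have h2 : (0:ℝ) < √2 := by positivity
  let m : ℕ → ℕ → ℝ := fun r s => (vn E (hl r s) N L : ℝ) + vn (cp E) (hl r s) N L
  let n : ℕ → ℝ := fun j => m (j % 2) (j / 2) / (N * L ^ 2 * √2 ^ j)
  have hze : ∀ r s (h : ℤ), hl (K := K) r s 0 h = ze (4 * h * 2 ^ (2 * s + r)) := by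
    intro r s h
    simp only [hl, ze]
    ext <;> simp <;> ring
  have hv := seq_lem (fun j => (Dd E (ze (4 * (N * L ^ 2) ^ 2 * 2 ^ j)) : ℝ) / (N * L ^ 2 * √2 ^ j)) n (2 * S) (by
    intro j
    have h1 := Dd_sq E (hl (j % 2) (j / 2)) (hl_isel _ _) N L
    rw [hze, hze, hh, Nat.div_add_mod, show (4 * (2 * (N * (L:ℤ) ^ 2) ^ 2) * 2 ^ j : ℤ) = 4 * (N * L ^ 2) ^ 2 * 2 ^ (j + 1) by ring] at h1
    have h3 : 2 * (Dd E (ze (4 * (N * L ^ 2) ^ 2 * 2 ^ j)) : ℝ) = Dd E (ze (4 * (N * L ^ 2) ^ 2 * 2 ^ (j + 1))) + 2 * m (j % 2) (j / 2) := by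
      simp only [m]; exact_mod_cast h1
    simp only [n]
    generalize (Dd E (ze (4 * (N * L ^ 2) ^ 2 * 2 ^ j)) : ℝ) = x at h3
    generalize (Dd E (ze (4 * (N * L ^ 2) ^ 2 * 2 ^ (j + 1))) : ℝ) = y at h3
    generalize m (j % 2) (j / 2) = w at h3
    have : y / (N * L ^ 2 * √2 ^ (j + 1)) / √2 = (y / 2) / (N * L ^ 2 * √2 ^ j) := by
      rw [div_div, div_div, show N * L ^ 2 * √2 ^ (j + 1) * √2 = N * L ^ 2 * √2 ^ j * (√2 * √2) by ring, Real.mul_self_sqrt (by norm_num)]; congr 1; ring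
    rw [this, ← add_div]; congr 1; linarith)
  refine hv.trans ?_
  have hlast : ((Dd E (ze (4 * (N * L ^ 2) ^ 2 * 2 ^ (2 * S))) : ℝ) / (N * L ^ 2 * √2 ^ (2 * S))) ^ 2 ≤ 16 * (Pr E : ℝ) ^ 2 := by
    have h1 := ze_comm E (N * L ^ 2 * 2 ^ S)
    rw [show ((2 * ((N * L ^ 2 * 2 ^ S : ℕ) : ℤ)) ^ 2 : ℤ) = 4 * (N * L ^ 2) ^ 2 * 2 ^ (2 * S) by push_cast; ring] at h1
    rw [pow_mul √2, Real.sq_sqrt (by norm_num)]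
    have : (Dd E (ze (4 * (N * L ^ 2) ^ 2 * 2 ^ (2 * S))) : ℝ) / (N * L ^ 2 * 2 ^ S) ≤ 4 * Pr E := by
      rw [div_le_iff₀ (by positivity)]
      push_cast at h1; linarith
    calc _ ≤ (4 * (Pr E : ℝ)) ^ 2 := by gcongr
      _ = _ := by ring
  have hn : ∑ j ∈ range (2 * S), n j ^ 2 ≤ 128 * (2 * c3 l ^ 2 + 8 * c6 l k) * (Pr E : ℝ) ^ 2 := by
    have hb : ∀ r ≤ 1, ∑ s ∈ range S, (m r s / (N * L ^ 2 * 2 ^ s)) ^ 2 ≤ 64 * (2 * c3 l ^ 2 + 8 * c6 l k) * (Pr E : ℝ) ^ 2 := by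
      intro r hr
      have a1 := (hl_sys E r hr).vn_sum N l k S L hN hL' hl' hk hS hd
      have a2 := (hl_sys (cp E) r hr).vn_sum N l k S L hN hL' hl' hk hS hd
      rw [Pr_cp] at a2
      generalize (2 * c3 l ^ 2 + 8 * c6 l k) = C at *
      push_cast at a1 a2
      calc _ ≤ ∑ s ∈ range S, (2 * ((vn E (hl r s) N L : ℝ) / (N * L ^ 2 * 2 ^ s)) ^ 2 + 2 * ((vn (cp E) (hl r s) N L : ℝ) / (N * L ^ 2 * 2 ^ s)) ^ 2) := by
            refine sum_le_sum fun s _ => ?_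
            simp only [m]
            rw [add_div]
            exact add_sq_le.trans_eq (mul_add _ _ _)
        _ ≤ _ := by
            rw [sum_add_distrib, ← mul_sum, ← mul_sum]
            linarith
    rw [sum_two]
    have b0 := hb 0 (by norm_num)
    have b1 := hb 1 (by norm_num)
    have c0 : ∑ s ∈ range S, n (2 * s) ^ 2 = ∑ s ∈ range S, (m 0 s / (N * L ^ 2 * 2 ^ s)) ^ 2 := by
      refine sum_congr rfl fun s _ => ?_
      simp only [n]
      rw [pow_mul √2, Real.sq_sqrt (by norm_num)]; simp
    have c1 : ∑ s ∈ range S, n (2 * s + 1) ^ 2 ≤ ∑ s ∈ range S, (m 1 s / (N * L ^ 2 * 2 ^ s)) ^ 2 := by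
      refine sum_le_sum fun s _ => ?_
      simp only [n]
      rw [pow_succ √2, pow_mul √2, Real.sq_sqrt (by norm_num), show (2 * s + 1) % 2 = 1 by omega, show (2 * s + 1) / 2 = s by omega]
      have hm : 0 ≤ m 1 s := by positivity
      have : (1:ℝ) ≤ √2 := Real.one_le_sqrt.2 (by norm_num)
      gcongr
      exact le_mul_of_one_le_right (by positivity) this
    generalize (2 * c3 l ^ 2 + 8 * c6 l k) = C at *
    linarith
  generalize (2 * c3 l ^ 2 + 8 * c6 l k) = C at *
  linarith

theorem set_ineq : ∃ C : ℝ, 0 < C ∧ ∀ {K : Type} [CommRing K] [Fintype K] (E : Hs K → Bool) (N S L : ℕ), 1 ≤ N → 0 < L → S ≤ N ^ 2 →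
    (∀ p : ℤ, 0 < p → p < (2 ^ 30 : ℕ) * (8 * N) + 514 * (8 * N) → 2 * p ∣ L) →
    ∑ j ∈ range (2 * S), (Dd E (ze (4 * (N * L ^ 2) ^ 2 * 2 ^ j)) : ℝ) / (N * L ^ 2 * √2 ^ j) ≤ C * √S * Pr E := by
  set C0 : ℝ := (48 + 12 * (128 * (2 * c3 30 ^ 2 + 8 * c6 30 34))) with hC
  have h6 : 0 ≤ c6 30 34 := by
    have h2 : 0 ≤ C2 30 := by unfold C2; positivity
    have h5 : 0 ≤ c5 30 := by unfold c5; positivity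
    unfold c6
    exact mul_nonneg (mul_nonneg (mul_nonneg zero_le_two (sq_nonneg _)) h5) (by positivity)
  have h0 : 0 < C0 := by rw [hC]; generalize c6 30 34 = c at *; positivity
  refine ⟨√(2 * C0), by positivity, ?_⟩
  intro K _ _ E N S L hN hL hS hd
  have h := set_sq 30 34 le_rfl (by norm_num) E N S L hN hL hS hd
  rw [← hC] at h
  clear_value C0
  have cs := sq_sum_le_card_mul_sum_sq (s := range (2 * S)) (f := fun j => (Dd E (ze (4 * (N * L ^ 2) ^ 2 * 2 ^ j)) : ℝ) / (N * L ^ 2 * √2 ^ j))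
  rw [card_range] at cs
  have h1 := cs.trans (mul_le_mul_of_nonneg_left h (by positivity))
  refine (Real.le_sqrt_of_sq_le h1).trans (le_of_eq ?_)
  rw [← Real.sqrt_mul (by positivity), show ((2 * S : ℕ) : ℝ) * (C0 * (Pr E : ℝ) ^ 2) = (2 * C0 * S) * (Pr E : ℝ) ^ 2 by push_cast; ring,
    Real.sqrt_mul (by positivity), Real.sqrt_sq (by positivity)]
end
end
end NY

namespace NY
open Finset
noncomputable section
open scoped Classical
set_option linter.all false

section
variable {G : Type*} [Group G] [Fintype G]
def DF (F : G → ℝ) (g : G) : ℝ := ∑ x, |F x - F (x * g)|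

theorem DF_step (F : G → ℝ) (M m : ℝ) (hm : m ≤ M) (h : ∀ x, F x = M ∨ F x ≤ m) (g : G) :
    DF F g = DF (fun x => min (F x) m) g + (M - m) * Dd (fun x => decide (F x = M)) g := by
  unfold DF Dd
  push_cast
  rw [mul_sum, ← sum_add_distrib]
  refine sum_congr rfl fun x _ => ?_
  have key : ∀ a b : ℝ, (a = M ∨ a ≤ m) → (b = M ∨ b ≤ m) →
      |a - b| = |min a m - min b m| + (M - m) * (ind (decide (a = M) ≠ decide (b = M)) : ℝ) := by
    intro a b ha hb
    rcases hm.eq_or_lt with rfl | hlt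
    · have e1 : min a m = a := by rcases ha with h | h <;> simp [h]
      have e2 : min b m = b := by rcases hb with h | h <;> simp [h]
      rw [e1, e2]; ring
    · rcases ha with rfl | ha <;> rcases hb with rfl | hb
      · simp [ind]
      · have : b ≠ a := by linarith
        rw [min_eq_right hm, min_eq_left hb, abs_of_nonneg (by linarith), abs_of_nonneg (by linarith)]
        simp [ind, this]
      · have : a ≠ b := by linarith
        rw [min_eq_right hm, min_eq_left ha, abs_of_nonpos (by linarith), abs_of_nonpos (by linarith)]
        simp [ind, this]
      · have h1 : a ≠ M := by linarith
        have h2 : b ≠ M := by linarith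
        rw [min_eq_left ha, min_eq_left hb]
        simp [ind, h1, h2]
  exact key _ _ (h x) (h (x * g))

theorem cake (I : Finset ℕ) (α : ℕ → ℝ) (g : ℕ → G) (β : ℝ) (a b c d : G)
    (h : ∀ E : G → Bool, ∑ j ∈ I, α j * Dd E (g j) ≤ β * (Dd E a + Dd E b + Dd E c + Dd E d)) (F : G → ℝ) :
    ∑ j ∈ I, α j * DF F (g j) ≤ β * (DF F a + DF F b + DF F c + DF F d) := by
  have key : ∀ n : ℕ, ∀ F : G → ℝ, #(univ.image F) ≤ n →
      ∑ j ∈ I, α j * DF F (g j) ≤ β * (DF F a + DF F b + DF F c + DF F d) := by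
    intro n
    induction n with
    | zero =>
      intro F hF
      have := card_pos.2 ((univ_nonempty (α := G)).image F)
      omega
    | succ n ih =>
      intro F hF
      set M := (univ.image F).max' (univ_nonempty.image F) with hM
      have hle : ∀ x, F x ≤ M := fun x => le_max' _ _ (mem_image_of_mem F (mem_univ x))
      have hMm : M ∈ univ.image F := max'_mem _ _
      by_cases hne : ((univ.image F).erase M).Nonempty
      · set m := ((univ.image F).erase M).max' hne with hm
        have hmm : m ∈ (univ.image F).erase M := max'_mem _ _
        have h1 : ∀ x, F x = M ∨ F x ≤ m := by
          intro x
          by_cases hx : F x = M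
          · exact Or.inl hx
          · exact Or.inr (le_max' _ _ (mem_erase.2 ⟨hx, mem_image_of_mem F (mem_univ x)⟩))
        have h2 : m ≤ M := le_max' _ _ (mem_of_mem_erase hmm)
        have h3 := ih (fun x => min (F x) m) (by
          refine (card_le_card (t := (univ.image F).erase M) ?_).trans ?_
          · intro y hy
            obtain ⟨x, _, rfl⟩ := mem_image.1 hy
            rcases h1 x with hx | hx
            · rw [hx, min_eq_right h2]; exact hmm
            · rw [min_eq_left hx]
              exact mem_erase.2 ⟨fun e => by
                have := le_antisymm (e ▸ hx) h2
                exact (mem_erase.1 hmm).1 this.symm, mem_image_of_mem F (mem_univ x)⟩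
          · rw [card_erase_of_mem hMm]; omega)
        have h4 := mul_le_mul_of_nonneg_left (h (fun x => decide (F x = M))) (sub_nonneg.2 h2)
        simp only [DF_step F M m h2 h1]
        have e : ∑ j ∈ I, α j * (DF (fun x => min (F x) m) (g j) + (M - m) * Dd (fun x => decide (F x = M)) (g j))
          = ∑ j ∈ I, α j * DF (fun x => min (F x) m) (g j) + (M - m) * ∑ j ∈ I, α j * Dd (fun x => decide (F x = M)) (g j) := by
          rw [mul_sum, ← sum_add_distrib]; exact sum_congr rfl fun j _ => by ring
        rw [e]
        linarith
      · have hc : ∀ x, F x = M := by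
          intro x
          by_contra hx
          exact hne ⟨F x, mem_erase.2 ⟨hx, mem_image_of_mem F (mem_univ x)⟩⟩
        have : ∀ g, DF F g = 0 := fun g => by unfold DF; simp [hc]
        simp [this]
  exact key _ F le_rfl

def DV {m : ℕ} (F : G → PiLp 1 (fun _ : Fin m => ℝ)) (g : G) : ℝ := ∑ x, ‖F x - F (x * g)‖
theorem DV_eq {m : ℕ} (F : G → PiLp 1 (fun _ : Fin m => ℝ)) (g : G) : DV F g = ∑ i, DF (fun x => F x i) g := by
  unfold DV DF
  rw [sum_comm]
  refine sum_congr rfl fun x _ => ?_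
  rw [PiLp.norm_eq_of_nat 1 (by norm_num)]
  simp
theorem cakeV {m : ℕ} (I : Finset ℕ) (α : ℕ → ℝ) (g : ℕ → G) (β : ℝ) (a b c d : G)
    (h : ∀ E : G → Bool, ∑ j ∈ I, α j * Dd E (g j) ≤ β * (Dd E a + Dd E b + Dd E c + Dd E d)) (F : G → PiLp 1 (fun _ : Fin m => ℝ)) :
    ∑ j ∈ I, α j * DV F (g j) ≤ β * (DV F a + DV F b + DV F c + DV F d) := by
  simp only [DV_eq, mul_sum, ← sum_add_distrib]
  rw [sum_comm]
  refine sum_le_sum fun i _ => ?_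
  exact cake I α g β a b c d h _
end

theorem vec_ineq : ∃ C : ℝ, 0 < C ∧ ∀ {K : Type} [CommRing K] [Fintype K] {m : ℕ} (F : Hs K → PiLp 1 (fun _ : Fin m => ℝ)) (N S L : ℕ), 1 ≤ N → 0 < L → S ≤ N ^ 2 →
    (∀ p : ℤ, 0 < p → p < (2 ^ 30 : ℕ) * (8 * N) + 514 * (8 * N) → 2 * p ∣ L) →
    ∑ j ∈ range (2 * S), (N * L ^ 2 * √2 ^ j : ℝ)⁻¹ * DV F (ze (4 * (N * L ^ 2) ^ 2 * 2 ^ j)) ≤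
      C * √S * (DV F (e1 K) + DV F (e2 K) + DV F (e3 K) + DV F (e4 K)) := by
  obtain ⟨C, hC, h⟩ := set_ineq
  refine ⟨C, hC, ?_⟩
  intro K _ _ m F N S L h1 h2 h3 h4
  refine cakeV (range (2 * S)) _ _ _ _ _ _ _ (fun E => ?_) F
  have := h E N S L h1 h2 h3 h4
  simp only [Pr, Nat.cast_add] at this
  refine le_trans (le_of_eq ?_) this
  exact sum_congr rfl fun j _ => by rw [div_eq_mul_inv, mul_comm]
end
end NY

namespace NY
open Finset
noncomputable section
open scoped Classical
set_option linter.all false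

def Nf (n z : ℝ) : ℝ := √((√(n ^ 2 + 4 * z ^ 2) + n) / 2)
theorem Nf_nonneg (n z) : 0 ≤ Nf n z := Real.sqrt_nonneg _
theorem Nf_sq (n z : ℝ) (hn : 0 ≤ n) : Nf n z ^ 2 = (√(n ^ 2 + 4 * z ^ 2) + n) / 2 := Real.sq_sqrt (by positivity)
theorem Nf_eq (n z : ℝ) (hn : 0 ≤ n) : (Nf n z ^ 2) ^ 2 = n * Nf n z ^ 2 + z ^ 2 := by
  rw [Nf_sq n z hn]
  nlinarith [Real.sq_sqrt (show 0 ≤ n ^ 2 + 4 * z ^ 2 by positivity)]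
theorem Nf_le (n z T : ℝ) (hn : 0 ≤ n) (hT : 0 < T) (h : n * T ^ 2 + z ^ 2 ≤ (T ^ 2) ^ 2) : Nf n z ≤ T := by
  by_contra! hlt
  have h1 := Nf_eq n z hn
  have h2 : T ^ 2 < Nf n z ^ 2 := by gcongr
  have hT2 : 0 < T ^ 2 := by positivity
  have h3 : n ≤ T ^ 2 := by
    by_contra! h'
    nlinarith [sq_nonneg z]
  nlinarith
theorem Nf_uniq (n z p : ℝ) (hn : 0 ≤ n) (hp : 0 < p) (h : (p ^ 2) ^ 2 = n * p ^ 2 + z ^ 2) : Nf n z = p := by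
  refine le_antisymm (Nf_le n z p hn hp h.ge) ?_
  by_contra! hlt
  have h1 := Nf_eq n z hn
  have h0 := Nf_nonneg n z
  have h2 : Nf n z ^ 2 < p ^ 2 := by gcongr
  have h3 := sq_nonneg z
  have h4 : 0 < p ^ 2 := by positivity
  have h5 : (p ^ 2 - Nf n z ^ 2) * (p ^ 2 + Nf n z ^ 2 - n) = 0 := by linarith
  have h6 : p ^ 2 + Nf n z ^ 2 - n = 0 := by
    rcases mul_eq_zero.1 h5 with h | h
    · linarith
    · exact h
  have h7 : p ^ 2 ≤ n := by nlinarith [sq_nonneg (Nf n z)]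
  have h8 : z ^ 2 ≤ 0 := by nlinarith
  have h9 : Nf n z ^ 2 = n - p ^ 2 := by linarith
  rw [Nf_sq n z hn] at h9
  have h10 : n ≤ √(n ^ 2 + 4 * z ^ 2) := Real.le_sqrt_of_sq_le (by linarith)
  nlinarith
theorem Nf_pos (n z : ℝ) (hn : 0 ≤ n) (h : 0 < n ∨ z ≠ 0) : 0 < Nf n z := by
  refine lt_of_le_of_ne (Nf_nonneg n z) fun h0 => ?_
  have h1 := Nf_sq n z hn
  rw [← h0] at h1
  have h2 := Real.sqrt_nonneg (n ^ 2 + 4 * z ^ 2)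
  rcases h with h | h
  · nlinarith
  · have h3 : √(n ^ 2 + 4 * z ^ 2) = 0 := by nlinarith
    rw [Real.sqrt_eq_zero (by positivity)] at h3
    have : 0 < z ^ 2 := by positivity
    nlinarith [sq_nonneg n]
theorem Nf_ge (n z : ℝ) (hn : 0 ≤ n) : n ≤ Nf n z ^ 2 ∧ |z| ≤ Nf n z ^ 2 := by
  have h10 : n ≤ √(n ^ 2 + 4 * z ^ 2) := Real.le_sqrt_of_sq_le (by nlinarith [sq_nonneg z])
  have h11 : 2 * |z| ≤ √(n ^ 2 + 4 * z ^ 2) := Real.le_sqrt_of_sq_le (by nlinarith [sq_nonneg n, sq_abs z])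
  rw [Nf_sq n z hn]
  constructor <;> linarith

theorem tri_core (s t n m z y ρ ω : ℝ) (hs : 0 < s) (ht : 0 < t) (hn : 0 ≤ n) (hm : 0 ≤ m)
    (h1 : (s ^ 2) ^ 2 = n * s ^ 2 + z ^ 2) (h2 : (t ^ 2) ^ 2 = m * t ^ 2 + y ^ 2) (hc : ρ ^ 2 + ω ^ 2 ≤ n * m) :
    (n + m + 2 * ρ) * (s + t) ^ 2 + (z + y + ω) ^ 2 ≤ ((s + t) ^ 2) ^ 2 := by
  obtain ⟨A, hA⟩ : ∃ A, z = A * s ^ 2 := ⟨z / s ^ 2, by field_simp⟩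
  obtain ⟨B, hB⟩ : ∃ B, y = B * t ^ 2 := ⟨y / t ^ 2, by field_simp⟩
  have hn' : n = s ^ 2 * (1 - A ^ 2) := by
    have : s ^ 2 * n = s ^ 2 * (s ^ 2 * (1 - A ^ 2)) := by rw [hA] at h1; linarith
    exact mul_left_cancel₀ (by positivity) this
  have hm' : m = t ^ 2 * (1 - B ^ 2) := by
    have : t ^ 2 * m = t ^ 2 * (t ^ 2 * (1 - B ^ 2)) := by rw [hB] at h2; linarith
    exact mul_left_cancel₀ (by positivity) this
  subst hA hB
  have a1 : 0 ≤ 1 - A ^ 2 := by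
    rw [hn'] at hn; exact nonneg_of_mul_nonneg_right hn (by positivity)
  have b1 : 0 ≤ 1 - B ^ 2 := by
    rw [hm'] at hm; exact nonneg_of_mul_nonneg_right hm (by positivity)
  set u := A * s ^ 2 + B * t ^ 2 with hu
  set P := s ^ 2 + s * t + t ^ 2 with hP
  have hst : 0 < s * t := by positivity
  have hP0 : 0 < P := by positivity
  have k1 : (u + ω) ^ 2 ≤ (s + t) ^ 2 * (u ^ 2 / P + ω ^ 2 / (s * t)) := by
    have e : (s + t) ^ 2 * (u ^ 2 / P + ω ^ 2 / (s * t)) - (u + ω) ^ 2 = (s * t * u - P * ω) ^ 2 / (P * (s * t)) := by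
      have : (s + t) ^ 2 = P + s * t := by rw [hP]; ring
      rw [this]; field_simp; ring
    have : 0 ≤ (s * t * u - P * ω) ^ 2 / (P * (s * t)) := by positivity
    linarith
  have k2 : u ^ 2 / P ≤ A ^ 2 * s ^ 2 + B ^ 2 * t ^ 2 := by
    rw [div_le_iff₀ hP0, hu, hP]
    have : 0 ≤ (A ^ 2 * s ^ 2 + B ^ 2 * t ^ 2) * (s * t) := by positivity
    nlinarith [sq_nonneg (A * s * t - B * s * t)]
  have k3 : ω ^ 2 / (s * t) ≤ 2 * (s * t) - 2 * ρ := by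
    rw [div_le_iff₀ hst]
    have : n * m ≤ (s * t) ^ 2 := by
      rw [hn', hm']
      have : (1 - A ^ 2) * (1 - B ^ 2) ≤ 1 := by nlinarith [sq_nonneg A, sq_nonneg B]
      nlinarith [sq_nonneg (s * t)]
    nlinarith [sq_nonneg (ρ - s * t)]
  have k4 : (u + ω) ^ 2 ≤ (s + t) ^ 2 * (A ^ 2 * s ^ 2 + B ^ 2 * t ^ 2 + (2 * (s * t) - 2 * ρ)) :=
    k1.trans (by gcongr)
  rw [hn', hm']
  nlinarith

def n2 (x : Hs ℤ) : ℝ := (x.a : ℝ) ^ 2 + (x.b : ℝ) ^ 2 + (x.c : ℝ) ^ 2 + (x.d : ℝ) ^ 2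
theorem n2_nonneg (x) : 0 ≤ n2 x := by unfold n2; positivity
def NN (x : Hs ℤ) : ℝ := Nf (n2 x) x.z
theorem NN_one : NN 1 = 0 := by simp [NN, Nf, n2, Hs.one_def]
theorem NN_inv (x : Hs ℤ) : NN x⁻¹ = NN x := by simp [NN, Nf, n2, Hs.inv_def]
theorem NN_nonneg (x) : 0 ≤ NN x := Nf_nonneg _ _
theorem NN_pos (x : Hs ℤ) (h : x ≠ 1) : 0 < NN x := by
  refine Nf_pos _ _ (n2_nonneg x) ?_
  by_contra! h'
  apply h
  have h1 := h'.1
  unfold n2 at h1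
  have f : ∀ t : ℤ, (t : ℝ) ^ 2 ≤ 0 → t = 0 := fun t ht => by
    have : (t : ℝ) = 0 := by nlinarith [sq_nonneg (t : ℝ)]
    exact_mod_cast this
  have g1 := sq_nonneg (x.a : ℝ)
  have g2 := sq_nonneg (x.b : ℝ)
  have g3 := sq_nonneg (x.c : ℝ)
  have g4 := sq_nonneg (x.d : ℝ)
  rw [Hs.one_def]
  ext
  · exact f _ (by linarith)
  · exact f _ (by linarith)
  · exact f _ (by linarith)
  · exact f _ (by linarith)
  · exact_mod_cast h'.2
theorem NN_mul (x y : Hs ℤ) : NN (x * y) ≤ NN x + NN y := by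
  by_cases hx : x = 1
  · subst hx; simp [NN_one]
  by_cases hy : y = 1
  · subst hy; simp [NN_one]
  have px := NN_pos x hx
  have py := NN_pos y hy
  refine Nf_le _ _ _ (n2_nonneg _) (by linarith) ?_
  have := tri_core (NN x) (NN y) (n2 x) (n2 y) x.z y.z (x.a * y.a + x.b * y.b + x.c * y.c + x.d * y.d)
    (x.a * y.b - x.b * y.a + x.c * y.d - x.d * y.c) px py (n2_nonneg x) (n2_nonneg y) (Nf_eq _ _ (n2_nonneg x)) (Nf_eq _ _ (n2_nonneg y)) (by
      unfold n2
      nlinarith [sq_nonneg ((x.a : ℝ) * y.c - x.b * y.d - x.c * y.a + x.d * y.b), sq_nonneg ((x.a : ℝ) * y.d + x.b * y.c - x.c * y.b - x.d * y.a)])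
  refine le_trans (le_of_eq ?_) this
  simp only [n2, Hs.mul_def]
  push_cast
  ring

def dd (x y : Hs ℤ) : ℝ := NN (x⁻¹ * y)
theorem dd_self (x) : dd x x = 0 := by simp [dd, NN_one]
theorem dd_pos (x y) (h : x ≠ y) : 0 < dd x y := NN_pos _ fun h' => h (inv_mul_eq_one.1 h')
theorem dd_comm (x y) : dd x y = dd y x := by unfold dd; rw [← NN_inv]; simp
theorem dd_tri (x y z) : dd x z ≤ dd x y + dd y z := by
  unfold dd
  have := NN_mul (x⁻¹ * y) (y⁻¹ * z)
  simpa [mul_assoc] using this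
end
end NY

namespace NY
open Finset
noncomputable section
open scoped Classical
set_option linter.all false
open Complex (I)
open scoped ComplexConjugate

section
variable {ι : Type*} [Fintype ι]
theorem pow_psd (u v : ι → ℂ) (m : ℕ) (D : ι → ℂ) :
    0 ≤ (∑ i, ∑ j, conj (D i) * D j * (conj (u i) * u j + conj (v i) * v j) ^ m).re := by
  induction m generalizing D with
  | zero =>
    have : ∑ i, ∑ j, conj (D i) * D j * (conj (u i) * u j + conj (v i) * v j) ^ 0 = conj (∑ i, D i) * ∑ j, D j := by
      rw [map_sum, sum_mul_sum]; simp
    rw [this, mul_comm, Complex.mul_conj]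
    simpa using Complex.normSq_nonneg _
  | succ m ih =>
    have h1 := ih (fun i => D i * u i)
    have h2 := ih (fun i => D i * v i)
    have h3 := add_nonneg h1 h2
    rw [← Complex.add_re, ← sum_add_distrib] at h3
    refine h3.trans_eq (congrArg _ ?_)
    refine sum_congr rfl fun i _ => ?_
    rw [← sum_add_distrib]
    refine sum_congr rfl fun j _ => ?_
    simp only [map_mul]; ring

theorem exp_psd (u v : ι → ℂ) (μ : ℝ) (hμ : 0 ≤ μ) (D : ι → ℂ) :
    0 ≤ (∑ i, ∑ j, conj (D i) * D j * Complex.exp (μ * (conj (u i) * u j + conj (v i) * v j))).re := by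
  have h : HasSum (fun m : ℕ => ∑ i, ∑ j, conj (D i) * D j * ((μ * (conj (u i) * u j + conj (v i) * v j)) ^ m / (m.factorial : ℂ)))
      (∑ i, ∑ j, conj (D i) * D j * Complex.exp (μ * (conj (u i) * u j + conj (v i) * v j))) := by
    refine hasSum_sum fun i _ => hasSum_sum fun j _ => HasSum.mul_left _ ?_
    rw [Complex.exp_eq_exp_ℂ]
    exact NormedSpace.expSeries_div_hasSum_exp _
  have h2 := Complex.hasSum_re h
  refine h2.nonneg fun m => ?_
  have h3 := mul_nonneg (show 0 ≤ μ ^ m / (m.factorial : ℝ) by positivity) (pow_psd u v m D)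
  rw [← Complex.re_ofReal_mul] at h3
  refine h3.trans_eq (congrArg _ ?_)
  rw [mul_sum]
  refine sum_congr rfl fun i _ => ?_
  rw [mul_sum]
  refine sum_congr rfl fun j _ => ?_
  push_cast
  rw [mul_pow]; ring

def zt (p : Hs ℤ) : ℂ := ⟨n2 p, 2 * p.z⟩
def w1 (p : Hs ℤ) : ℂ := ⟨p.a, p.b⟩
def w2 (p : Hs ℤ) : ℂ := ⟨p.c, p.d⟩
theorem zt_eq (p q : Hs ℤ) : zt (p⁻¹ * q) = conj (zt p) + zt q - 2 * (conj (w1 p) * w1 q + conj (w2 p) * w2 q) := by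
  apply Complex.ext
  · simp [zt, w1, w2, n2, Hs.mul_def, Hs.inv_def]; ring
  · simp [zt, w1, w2, n2, Hs.mul_def, Hs.inv_def]; ring

theorem ker_psd (x : ι → Hs ℤ) (c : ι → ℝ) (t l : ℝ) (hl : 0 ≤ l) :
    0 ≤ ∑ i, ∑ j, c i * c j * (Complex.exp (-(l * (zt ((x i)⁻¹ * x j) + t)))).re := by
  have h := exp_psd (fun i => w1 (x i)) (fun i => w2 (x i)) (2 * l) (by positivity)
    (fun i => c i * Complex.exp (-(l * (zt (x i) + t / 2))))
  refine h.trans_eq ?_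
  rw [Complex.re_sum]
  refine sum_congr rfl fun i _ => ?_
  rw [Complex.re_sum]
  refine sum_congr rfl fun j _ => ?_
  rw [← Complex.re_ofReal_mul]
  congr 1
  rw [zt_eq, map_mul, ← Complex.exp_conj, Complex.conj_ofReal]
  calc _ = ((c i : ℂ) * c j) * (Complex.exp ((starRingEnd ℂ) (-(l * (zt (x i) + t / 2)))) * Complex.exp (-(l * (zt (x j) + t / 2))) *
      Complex.exp (((2 * l : ℝ) : ℂ) * (conj (w1 (x i)) * w1 (x j) + conj (w2 (x i)) * w2 (x j)))) := by ring
    _ = _ := by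
      rw [← Complex.exp_add, ← Complex.exp_add]
      push_cast
      congr 2
      have h2 : conj (2:ℂ) = 2 := map_ofNat _ 2
      simp [h2]
      ring

theorem sqrt_int (b : ℂ) (hb : 0 < b.re) : ∫ x : ℝ, Complex.exp (-((Real.pi * x ^ 2 : ℝ) * b)) = b ^ (-(1 / 2) : ℂ) := by
  have h := integral_gaussian_complex (b := Real.pi * b) (by
    rw [Complex.re_ofReal_mul]; exact mul_pos Real.pi_pos hb)
  have hb0 : b ≠ 0 := by rintro rfl; simp at hb
  have hpi : (Real.pi : ℂ) ≠ 0 := by exact_mod_cast Real.pi_ne_zero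
  rw [show (Real.pi : ℂ) / (Real.pi * b) = b⁻¹ by field_simp, Complex.inv_cpow _ _ (by
    intro h'
    rw [Complex.arg_eq_pi_iff] at h'
    linarith [h'.1]), ← Complex.cpow_neg] at h
  rw [← h]
  congr 1; ext x; congr 1; push_cast; ring
theorem sqrt_int' (b : ℂ) (hb : 0 < b.re) : MeasureTheory.Integrable fun x : ℝ => Complex.exp (-((Real.pi * x ^ 2 : ℝ) * b)) := by
  have h := integrable_cexp_neg_mul_sq (b := Real.pi * b) (by
    rw [Complex.re_ofReal_mul]; exact mul_pos Real.pi_pos hb)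
  refine h.congr (Filter.Eventually.of_forall fun x => ?_)
  simp only
  congr 1; push_cast; ring

theorem half_psd (x : ι → Hs ℤ) (c : ι → ℝ) (t : ℝ) (ht : 0 < t) :
    0 ≤ ∑ i, ∑ j, c i * c j * ((zt ((x i)⁻¹ * x j) + t) ^ (-(1 / 2) : ℂ)).re := by
  have hre : ∀ p, 0 < (zt p + t).re := fun p => by
    have := n2_nonneg p
    simp [zt]; linarith
  have e : ∀ i j, c i * c j * ((zt ((x i)⁻¹ * x j) + t) ^ (-(1 / 2) : ℂ)).re =
      ∫ y : ℝ, c i * c j * (Complex.exp (-((Real.pi * y ^ 2 : ℝ) * (zt ((x i)⁻¹ * x j) + t)))).re := by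
    intro i j
    rw [MeasureTheory.integral_const_mul, ← sqrt_int _ (hre _)]
    congr 1
    exact (integral_re (𝕜 := ℂ) (sqrt_int' _ (hre _))).symm
  have hi : ∀ i j, MeasureTheory.Integrable fun y : ℝ => c i * c j * (Complex.exp (-((Real.pi * y ^ 2 : ℝ) * (zt ((x i)⁻¹ * x j) + t)))).re :=
    fun i j => ((sqrt_int' _ (hre _)).re).const_mul _
  simp only [e]
  have e2 : ∀ i, ∑ j, ∫ y : ℝ, c i * c j * (Complex.exp (-((Real.pi * y ^ 2 : ℝ) * (zt ((x i)⁻¹ * x j) + t)))).re =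
      ∫ y : ℝ, ∑ j, c i * c j * (Complex.exp (-((Real.pi * y ^ 2 : ℝ) * (zt ((x i)⁻¹ * x j) + t)))).re :=
    fun i => (MeasureTheory.integral_finset_sum _ fun j _ => hi i j).symm
  simp only [e2]
  rw [← MeasureTheory.integral_finset_sum _ fun i _ => MeasureTheory.integrable_finset_sum _ fun j _ => hi i j]
  exact MeasureTheory.integral_nonneg fun y => ker_psd x c t _ (by positivity)
end
end
end NY

namespace NY
open Finset
noncomputable section
open scoped Classical
set_option linter.all false

section
variable {ι : Type*} [Fintype ι]
theorem Nf_cpow (b : ℂ) : (b ^ (1 / 2 : ℂ)).re = Nf b.re (b.im / 2) := by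
  rw [one_div, Complex.cpow_inv_two_re, Nf]
  congr 3
  rw [Complex.norm_def, Complex.normSq_apply]
  congr 1; ring

theorem Nf_deriv (n z t : ℝ) (hn : 0 ≤ n) (ht : 0 < t) :
    HasDerivAt (fun t : ℝ => Nf (n + t) z) (1 / 2 * (((⟨n, 2 * z⟩ : ℂ) + t) ^ (-(1 / 2) : ℂ)).re) t := by
  have h : HasDerivAt (fun s : ℂ => ((⟨n, 2 * z⟩ : ℂ) + s) ^ (1 / 2 : ℂ)) ((1 / 2 : ℂ) * ((⟨n, 2 * z⟩ : ℂ) + t) ^ ((1 / 2 : ℂ) - 1) * 1) (t : ℂ) := by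
    refine HasDerivAt.cpow_const ((hasDerivAt_id _).const_add _) ?_
    left; simp; linarith
  have h2 := h.real_of_complex
  simp only [Nf_cpow] at h2
  convert h2 using 1
  · ext s; simp
  · rw [mul_one, show (1 / 2 : ℂ) - 1 = -(1 / 2) by norm_num, show (1 / 2 : ℂ) = ((1 / 2 : ℝ) : ℂ) by push_cast; rfl, Complex.re_ofReal_mul]

theorem Nf_lim (n z : ℝ) (hn : 0 ≤ n) : Filter.Tendsto (fun t : ℝ => Nf (n + t) z - √t) Filter.atTop (nhds 0) := by
  have h1 : Filter.Tendsto (fun t : ℝ => (n + |z|) / √t) Filter.atTop (nhds 0) :=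
    Filter.Tendsto.div_atTop tendsto_const_nhds Real.tendsto_sqrt_atTop
  refine tendsto_of_tendsto_of_tendsto_of_le_of_le' tendsto_const_nhds h1 ?_ ?_
  · filter_upwards [Filter.eventually_gt_atTop 0] with t ht
    have := (Nf_ge (n + t) z (by linarith)).1
    have : √t ≤ Nf (n + t) z := (Real.sqrt_le_left (Nf_nonneg _ _)).2 (by linarith)
    linarith
  · filter_upwards [Filter.eventually_gt_atTop 0] with t ht
    have h2 : 0 < √t := Real.sqrt_pos.2 ht
    have h3 := (Nf_ge (n + t) z (by linarith)).1
    have h4 : √t ≤ Nf (n + t) z := (Real.sqrt_le_left (Nf_nonneg _ _)).2 (by linarith)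
    have h5 : Nf (n + t) z ^ 2 ≤ n + t + |z| := by
      rw [Nf_sq _ _ (by linarith)]
      have : √((n + t) ^ 2 + 4 * z ^ 2) ≤ n + t + 2 * |z| := by
        rw [Real.sqrt_le_left (by positivity)]
        nlinarith [sq_abs z, mul_nonneg (show 0 ≤ n + t by linarith) (abs_nonneg z)]
      linarith
    rw [le_div_iff₀ h2]
    nlinarith [Real.sq_sqrt ht.le]

theorem neg_type (x : ι → Hs ℤ) (c : ι → ℝ) (hc : ∑ i, c i = 0) : ∑ i, ∑ j, c i * c j * dd (x i) (x j) ≤ 0 := by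
  let h : ℝ → ℝ := fun t => ∑ i, ∑ j, c i * c j * Nf (n2 ((x i)⁻¹ * x j) + t) ((x i)⁻¹ * x j).z
  have hder : ∀ t : ℝ, 0 < t → HasDerivAt h (1 / 2 * ∑ i, ∑ j, c i * c j * ((zt ((x i)⁻¹ * x j) + t) ^ (-(1 / 2) : ℂ)).re) t := by
    intro t ht
    rw [mul_sum]
    refine HasDerivAt.fun_sum fun i _ => ?_
    rw [mul_sum]
    refine HasDerivAt.fun_sum fun j _ => ?_
    refine ((Nf_deriv _ _ t (n2_nonneg _) ht).const_mul (c i * c j)).congr_deriv ?_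
    unfold zt; ring
  have hcont : Continuous h := by
    refine continuous_finset_sum _ fun i _ => continuous_finset_sum _ fun j _ => ?_
    unfold Nf
    fun_prop
  have hmono : MonotoneOn h (Set.Ici 0) := by
    refine monotoneOn_of_deriv_nonneg (convex_Ici 0) hcont.continuousOn ?_ ?_
    · rw [interior_Ici]
      exact fun t ht => (hder t ht).differentiableAt.differentiableWithinAt
    · rw [interior_Ici]
      intro t ht
      rw [(hder t ht).deriv]
      have := half_psd x c t ht
      positivity
  have hlim : Filter.Tendsto h Filter.atTop (nhds 0) := by
    have e : h = fun t => ∑ i, ∑ j, c i * c j * (Nf (n2 ((x i)⁻¹ * x j) + t) ((x i)⁻¹ * x j).z - √t) := by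
      ext t
      simp only [h, mul_sub, sum_sub_distrib]
      have : ∑ i, ∑ j, c i * c j * √t = 0 := by
        simp only [← sum_mul, ← mul_sum, hc]; simp
      rw [this, sub_zero]
    rw [e]
    have : (0:ℝ) = ∑ i, ∑ j, c i * c j * 0 := by simp
    rw [this]
    exact tendsto_finset_sum _ fun i _ => tendsto_finset_sum _ fun j _ => (Nf_lim _ _ (n2_nonneg _)).const_mul _
  have h0 : h 0 ≤ 0 := ge_of_tendsto hlim (by
    filter_upwards [Filter.eventually_ge_atTop 0] with t ht
    exact hmono (Set.mem_Ici.2 le_rfl) ht ht)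
  simpa [h, dd, NN] using h0

theorem gram_psd (x : ι → Hs ℤ) (o : ι) (c : ι → ℝ) :
    0 ≤ ∑ i, ∑ j, c i * c j * ((dd (x i) (x o) + dd (x j) (x o) - dd (x i) (x j)) / 2) := by
  set s := ∑ i, c i with hs
  have h := neg_type x (fun i => c i - if i = o then s else 0) (by simp [hs])
  have e1 : ∀ i j, (c i - if i = o then s else 0) * (c j - if j = o then s else 0) * dd (x i) (x j) =
      c i * c j * dd (x i) (x j) - (if i = o then s * c j * dd (x i) (x j) else 0) - (if j = o then s * c i * dd (x i) (x j) else 0)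
        + (if i = o then if j = o then s * s * dd (x i) (x j) else 0 else 0) := by
    intro i j; split_ifs <;> ring
  simp only [e1, sum_add_distrib, sum_sub_distrib] at h
  have e2 : ∑ i, ∑ j, (if i = o then s * c j * dd (x i) (x j) else 0) = s * ∑ j, c j * dd (x j) (x o) := by
    rw [sum_comm]
    simp only [sum_ite_eq', mem_univ, if_true, mul_sum]
    exact sum_congr rfl fun j _ => by rw [dd_comm]; ring
  have e3 : ∑ i, ∑ j, (if j = o then s * c i * dd (x i) (x j) else 0) = s * ∑ j, c j * dd (x j) (x o) := by
    simp only [sum_ite_eq', mem_univ, if_true, mul_sum]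
    exact sum_congr rfl fun j _ => by ring
  have e4 : ∑ i, ∑ j, (if i = o then if j = o then s * s * dd (x i) (x j) else 0 else 0) = 0 := by
    rw [sum_comm]; simp [dd_self]
  rw [e2, e3, e4] at h
  have e5 : ∑ i, ∑ j, c i * c j * ((dd (x i) (x o) + dd (x j) (x o) - dd (x i) (x j)) / 2) =
      (s * ∑ j, c j * dd (x j) (x o)) - (∑ i, ∑ j, c i * c j * dd (x i) (x j)) / 2 := by
    have : ∀ i j, c i * c j * ((dd (x i) (x o) + dd (x j) (x o) - dd (x i) (x j)) / 2) =
      (c i * dd (x i) (x o)) * c j / 2 + c i * (c j * dd (x j) (x o)) / 2 - c i * c j * dd (x i) (x j) / 2 := fun i j => by ring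
    simp only [this, sum_sub_distrib, sum_add_distrib, ← sum_div]
    rw [← sum_mul_sum, ← sum_mul_sum, ← hs]; ring
  rw [e5]; linarith
end

theorem hilbert {n : ℕ} (x : Fin n → Hs ℤ) (o : Fin n) :
    ∃ g : Fin n → lp (fun _ : ℕ => ℝ) 2, ∀ i j, ‖g i - g j‖ = √(dd (x i) (x j)) := by
  let M : Matrix (Fin n) (Fin n) ℝ := fun i j => (dd (x i) (x o) + dd (x j) (x o) - dd (x i) (x j)) / 2
  have hM : M.PosSemidef := by
    refine Matrix.PosSemidef.of_dotProduct_mulVec_nonneg ?_ fun c => ?_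
    · ext i j; rw [Matrix.conjTranspose_apply]; simp only [M, star_trivial]; rw [dd_comm (x j) (x i)]; ring
    · refine (gram_psd x o c).trans_eq ?_
      simp only [dotProduct, Matrix.mulVec, mul_sum]
      exact sum_congr rfl fun i _ => sum_congr rfl fun j _ => by simp [M]; ring
  obtain ⟨B, hB⟩ : ∃ B : Matrix (Fin n) (Fin n) ℝ, M = B.conjTranspose * B := by
    open scoped MatrixOrder in
    exact (CStarAlgebra.nonneg_iff_eq_star_mul_self).1 hM.nonneg
  have hG : ∀ i j, ∑ k, B k i * B k j = M i j := by
    intro i j; rw [hB]; simp [Matrix.mul_apply]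
  let g0 : Fin n → ℕ → ℝ := fun i k => if h : k < n then B ⟨k, h⟩ i else 0
  have hs : ∀ u : ℕ → ℝ, (∀ k, n ≤ k → u k = 0) → ∀ k ∉ range n, u k = 0 := fun u hu k hk => hu k (by simpa using hk)
  have hg : ∀ i, Memℓp (g0 i) 2 := fun i => by
    refine memℓp_gen (summable_of_ne_finset_zero (s := range n) (hs _ fun k hk => ?_))
    simp [g0, not_lt.2 hk]
  let G : Fin n → lp (fun _ : ℕ => ℝ) 2 := fun i => ⟨g0 i, hg i⟩
  refine ⟨G, fun i j => ?_⟩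
  have h2 : (2 : ENNReal).toReal = 2 := by simp
  have h3 := lp.norm_rpow_eq_tsum (p := 2) (by simp) (G i - G j)
  rw [h2, Real.rpow_two] at h3
  have e : ∀ k, ‖(G i - G j : lp (fun _ : ℕ => ℝ) 2) k‖ ^ (2:ℝ) = (g0 i k - g0 j k) ^ 2 := by
    intro k; rw [Real.rpow_two, Real.norm_eq_abs, sq_abs]; rfl
  simp only [e] at h3
  suffices ‖G i - G j‖ ^ 2 = dd (x i) (x j) by rw [← this, Real.sqrt_sq (norm_nonneg _)]
  rw [h3]
  rw [tsum_eq_sum (s := range n) (hs _ fun k hk => by simp [g0, not_lt.2 hk]), ← Fin.sum_univ_eq_sum_range (fun k => (g0 i k - g0 j k) ^ 2)]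
  have : ∀ k : Fin n, (g0 i k - g0 j k) ^ 2 = B k i * B k i + B k j * B k j - 2 * (B k i * B k j) := by
    intro k; simp [g0]; ring
  simp only [this, sum_sub_distrib, sum_add_distrib, ← mul_sum, hG, M, dd_self]
  ring
end
end NY

namespace NY
open Finset
noncomputable section
open scoped Classical
set_option linter.all false

def prj (q : ℕ) (x : Hs ℤ) : Hs (ZMod q) := ⟨x.a, x.b, x.c, x.d, x.z⟩
theorem prj_mul (q : ℕ) (x y : Hs ℤ) : prj q (x * y) = prj q x * prj q y := by
  simp only [prj, Hs.mul_def]; push_cast; rfl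

theorem push {m : ℕ} (q : ℕ) [NeZero q] (T : Finset (Hs ℤ)) (F0 : Hs ℤ → PiLp 1 (fun _ : Fin m => ℝ))
    (hT : ∀ x, F0 x ≠ 0 → x ∈ T) (hq : Set.InjOn (prj q) T) : ∃ F : Hs (ZMod q) → PiLp 1 (fun _ : Fin m => ℝ),
    (∀ g, (∀ x, F0 x ≠ 0 → x * g⁻¹ ∈ T) → DV F (prj q g) ≤ ∑ x ∈ T, ‖F0 x - F0 (x * g)‖) ∧
    (∀ g, ∀ P ⊆ T, (∀ x ∈ P, x * g ∈ T) → ∑ x ∈ P, ‖F0 x - F0 (x * g)‖ ≤ DV F (prj q g)) := by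
  let F : Hs (ZMod q) → PiLp 1 (fun _ : Fin m => ℝ) := fun y => ∑' x, if prj q x = y then F0 x else 0
  have h1 : ∀ y, F y = ∑ x ∈ T, if prj q x = y then F0 x else 0 := fun y =>
    tsum_eq_sum fun x hx => by
      rw [not_not.1 (mt (hT x) hx)]; simp
  have h2 : ∀ x ∈ T, F (prj q x) = F0 x := by
    intro x hx
    rw [h1, sum_eq_single x]
    · simp
    · intro b hb hne
      rw [if_neg fun h => hne (hq hb hx h)]
    · exact fun h => (h hx).elim
  refine ⟨F, fun g hg => ?_, fun g P hP hg => ?_⟩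
  · have h3 : ∀ y, F (y * prj q g) = ∑ x ∈ T, if prj q x = y then F0 (x * g) else 0 := by
      intro y
      have : F (y * prj q g) = ∑' x, if prj q (x * g) = y * prj q g then F0 (x * g) else 0 :=
        ((Equiv.mulRight g).tsum_eq (fun x => if prj q x = y * prj q g then F0 x else 0)).symm
      rw [this, tsum_eq_sum (s := T)]
      · simp only [prj_mul, mul_left_inj]
      · intro x hx
        have : F0 (x * g) = 0 := by
          by_contra h; exact hx (by simpa using hg _ h)
        rw [this]; simp
    unfold DV
    calc ∑ y, ‖F y - F (y * prj q g)‖ ≤ ∑ y, ∑ x ∈ T, if prj q x = y then ‖F0 x - F0 (x * g)‖ else 0 := by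
          refine sum_le_sum fun y _ => ?_
          rw [h1, h3, ← sum_sub_distrib]
          refine (norm_sum_le _ _).trans (sum_le_sum fun x _ => ?_)
          split_ifs <;> simp
      _ = _ := by rw [sum_comm]; simp
  · unfold DV
    calc ∑ x ∈ P, ‖F0 x - F0 (x * g)‖ = ∑ y ∈ P.image (prj q), ‖F y - F (y * prj q g)‖ := by
          rw [sum_image (hq.mono (by simpa using hP))]
          refine sum_congr rfl fun x hx => ?_
          rw [h2 x (hP hx), ← prj_mul, h2 _ (hg x hx)]
      _ ≤ _ := sum_le_sum_of_subset_of_nonneg (subset_univ _) fun _ _ _ => norm_nonneg _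

def box (s h : ℕ) : Finset (Hs ℤ) :=
  (Icc (-s : ℤ) s ×ˢ Icc (-s : ℤ) s ×ˢ Icc (-s : ℤ) s ×ˢ Icc (-s : ℤ) s ×ˢ Icc (-h : ℤ) h).image fun p => ⟨p.1, p.2.1, p.2.2.1, p.2.2.2.1, p.2.2.2.2⟩
theorem mem_box (s h : ℕ) (x : Hs ℤ) : x ∈ box s h ↔ |x.a| ≤ s ∧ |x.b| ≤ s ∧ |x.c| ≤ s ∧ |x.d| ≤ s ∧ |x.z| ≤ h := by
  simp only [box, mem_image, mem_product, mem_Icc, abs_le, Prod.exists]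
  constructor
  · rintro ⟨a, b, c, d, z, h, rfl⟩; exact h
  · intro h; exact ⟨_, _, _, _, _, h, rfl⟩
theorem card_box (s h : ℕ) : #(box s h) = (2 * s + 1) ^ 4 * (2 * h + 1) := by
  have e : ∀ s : ℕ, ((s : ℤ) + 1 - -s).toNat = 2 * s + 1 := by intro s; omega
  rw [box, card_image_of_injective]
  · simp only [card_product, Int.card_Icc, e]; ring
  · rintro ⟨a, b, c, d, z⟩ ⟨a', b', c', d', z'⟩ h; simpa using h
theorem inj_box (s h : ℕ) (hs : s ≤ h) : Set.InjOn (prj (2 * h + 1)) (box s h) := by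
  have key : ∀ a b : ℤ, |a| ≤ h → |b| ≤ h → (a : ZMod (2 * h + 1)) = b → a = b := by
    intro a b ha hb hab
    rw [ZMod.intCast_eq_intCast_iff_dvd_sub] at hab
    rw [abs_le] at ha hb
    have := Int.eq_zero_of_abs_lt_dvd hab (by rw [abs_lt]; push_cast; omega)
    omega
  have hs' : (s : ℤ) ≤ h := by exact_mod_cast hs
  intro x hx y hy hxy
  rw [mem_coe, mem_box] at hx hy
  obtain ⟨x1, x2, x3, x4, x5⟩ := hx
  obtain ⟨y1, y2, y3, y4, y5⟩ := hy
  simp only [prj, Hs.mk.injEq] at hxy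
  obtain ⟨u1, u2, u3, u4, u5⟩ := hxy
  ext
  · exact key _ _ (x1.trans hs') (y1.trans hs') u1
  · exact key _ _ (x2.trans hs') (y2.trans hs') u2
  · exact key _ _ (x3.trans hs') (y3.trans hs') u3
  · exact key _ _ (x4.trans hs') (y4.trans hs') u4
  · exact key _ _ x5 y5 u5
theorem ball_box (s : ℕ) (x : Hs ℤ) (h : NN x ≤ s) : x ∈ box s (s ^ 2) := by
  have h1 := Nf_ge (n2 x) x.z (n2_nonneg x)
  have h2 : NN x ^ 2 ≤ (s : ℝ) ^ 2 := pow_le_pow_left₀ (NN_nonneg x) h 2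
  change n2 x ≤ NN x ^ 2 ∧ |(x.z : ℝ)| ≤ NN x ^ 2 at h1
  have h3 := h1.1.trans h2
  have h4 := h1.2.trans h2
  have key : ∀ a : ℤ, (a : ℝ) ^ 2 ≤ (s : ℝ) ^ 2 → |a| ≤ s := by
    intro a ha
    have : a ^ 2 ≤ (s : ℤ) ^ 2 := by exact_mod_cast ha
    exact abs_le_of_sq_le_sq this (by positivity)
  unfold n2 at h3
  rw [mem_box]
  refine ⟨key _ ?_, key _ ?_, key _ ?_, key _ ?_, by exact_mod_cast h4⟩ <;> nlinarith [sq_nonneg (x.a : ℝ), sq_nonneg (x.b : ℝ), sq_nonneg (x.c : ℝ), sq_nonneg (x.d : ℝ)]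
theorem box_ball (M : ℕ) (hM : 0 < M) (x : Hs ℤ) (h : x ∈ box (2 * M) (16 * M ^ 2)) : NN x ≤ 8 * M := by
  have hM' : (0:ℝ) < M := by exact_mod_cast hM
  rw [mem_box] at h
  obtain ⟨h1, h2, h3, h4, h5⟩ := h
  have key : ∀ a : ℤ, |a| ≤ ((2 * M : ℕ) : ℤ) → (a : ℝ) ^ 2 ≤ 4 * (M : ℝ) ^ 2 := by
    intro a ha
    have : |(a : ℝ)| ≤ 2 * M := by exact_mod_cast ha
    rw [← sq_abs]; nlinarith [abs_nonneg (a : ℝ)]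
  have hz : (x.z : ℝ) ^ 2 ≤ (16 * (M : ℝ) ^ 2) ^ 2 := by
    have : |(x.z : ℝ)| ≤ 16 * M ^ 2 := by exact_mod_cast h5
    rw [← sq_abs]; exact pow_le_pow_left₀ (abs_nonneg _) this 2
  have hn : n2 x ≤ 16 * (M : ℝ) ^ 2 := by
    have := key _ h1; have := key _ h2; have := key _ h3; have := key _ h4
    unfold n2; linarith
  refine Nf_le _ _ _ (n2_nonneg x) (by positivity) ?_
  nlinarith [mul_le_mul_of_nonneg_right hn (sq_nonneg (8 * (M:ℝ))), sq_nonneg ((M:ℝ) ^ 2)]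
theorem NN_ze (t : ℤ) (ht : 0 < t) : NN (ze t) = √t := by
  have ht' : (0 : ℝ) < t := by exact_mod_cast ht
  refine Nf_uniq _ _ _ (n2_nonneg _) (Real.sqrt_pos.2 ht') ?_
  rw [Real.sq_sqrt ht'.le]; simp [ze, n2]
theorem NN_e : NN (e1 ℤ) = 1 ∧ NN (e2 ℤ) = 1 ∧ NN (e3 ℤ) = 1 ∧ NN (e4 ℤ) = 1 := by
  refine ⟨?_, ?_, ?_, ?_⟩ <;> exact Nf_uniq _ _ _ (n2_nonneg _) one_pos (by simp [e1, e2, e3, e4, n2])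
theorem prj_e (q : ℕ) : prj q (e1 ℤ) = e1 _ ∧ prj q (e2 ℤ) = e2 _ ∧ prj q (e3 ℤ) = e3 _ ∧ prj q (e4 ℤ) = e4 _ := by
  simp [prj, e1, e2, e3, e4]
theorem prj_ze (q : ℕ) (t : ℤ) : prj q (ze t) = ze t := by simp [prj, ze]
end
end NY

namespace NY
open Finset
noncomputable section
open scoped Classical
set_option linter.all false

def chi (Q t : ℝ) : ℝ := max 0 (min 1 (2 - t / Q))
theorem chi_nonneg (Q t) : 0 ≤ chi Q t := le_max_left _ _
theorem chi_le (Q t) : chi Q t ≤ 1 := max_le zero_le_one (min_le_left _ _)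
theorem chi_one (Q t : ℝ) (hQ : 0 < Q) (h : t ≤ Q) : chi Q t = 1 := by
  have : t / Q ≤ 1 := (div_le_one hQ).2 h
  rw [chi, min_eq_left (by linarith), max_eq_right zero_le_one]
theorem chi_zero (Q t : ℝ) (hQ : 0 < Q) (h : chi Q t ≠ 0) : t ≤ 2 * Q := by
  by_contra! h'
  have : 2 < t / Q := (lt_div_iff₀ hQ).2 h'
  exact h (max_eq_left ((min_le_right _ _).trans (by linarith)))
theorem chi_lip (Q s t : ℝ) (hQ : 0 < Q) (h : |s - t| ≤ 1) : |chi Q s - chi Q t| ≤ 1 / Q := by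
  have e : |(2 - s / Q) - (2 - t / Q)| ≤ 1 / Q := by
    rw [show (2 - s / Q) - (2 - t / Q) = -((s - t) / Q) by ring, abs_neg, abs_div, abs_of_pos hQ]
    gcongr
  unfold chi
  refine (abs_max_sub_max_le_max _ _ _ _).trans (max_le (by simp; positivity) ?_)
  exact (abs_min_sub_min_le_max _ _ _ _).trans (max_le (by simp; positivity) e)

theorem cut_diff {V : Type*} [NormedAddCommGroup V] [NormedSpace ℝ V] (χ χ' Q c : ℝ) (v v' : V) (hQ : 0 < Q) (hc : 0 ≤ c)
    (h0 : 0 ≤ χ) (h1 : χ ≤ 1) (hl : |χ - χ'| ≤ 1 / Q) (hv : χ ≠ 0 → ‖v‖ ≤ c * (2 * Q)) (hv' : χ' ≠ 0 → ‖v'‖ ≤ c * (2 * Q))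
    (hvv : χ ≠ 0 → χ' ≠ 0 → ‖v - v'‖ ≤ c) : ‖χ • v - χ' • v'‖ ≤ 3 * c := by
  have hQ' : 1 / Q * (c * (2 * Q)) = 2 * c := by field_simp
  by_cases a : χ = 0
  · by_cases b : χ' = 0
    · simp [a, b]; exact hc
    · have : ‖χ' • v'‖ ≤ 1 / Q * (c * (2 * Q)) := by
        rw [norm_smul]
        refine mul_le_mul ?_ (hv' b) (norm_nonneg _) (by positivity)
        simpa [a] using hl
      rw [a, zero_smul, zero_sub, norm_neg]; linarith
  · by_cases b : χ' = 0
    · have : ‖χ • v‖ ≤ 1 / Q * (c * (2 * Q)) := by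
        rw [norm_smul]
        refine mul_le_mul ?_ (hv a) (norm_nonneg _) (by positivity)
        simpa [b] using hl
      rw [b, zero_smul, sub_zero]; linarith
    · have e : χ • v - χ' • v' = χ • (v - v') + (χ - χ') • v' := by
        rw [smul_sub, sub_smul]; abel
      have h2 : ‖(χ - χ') • v'‖ ≤ 1 / Q * (c * (2 * Q)) := by
        rw [norm_smul]
        exact mul_le_mul hl (hv' b) (norm_nonneg _) (by positivity)
      have h3 : ‖χ • (v - v')‖ ≤ 1 * c := by
        rw [norm_smul, Real.norm_of_nonneg h0]
        exact mul_le_mul h1 (hvv a b) (norm_nonneg _) (by norm_num)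
      rw [e]
      refine (norm_add_le _ _).trans ?_
      linarith

theorem sqrt_tau (R j : ℕ) : √(((4 * (R : ℤ) ^ 2 * 2 ^ j : ℤ) : ℝ)) = 2 * R * √2 ^ j := by
  rw [Real.sqrt_eq_iff_mul_self_eq (by positivity) (by positivity)]
  push_cast
  rw [show 2 * (R:ℝ) * √2 ^ j * (2 * R * √2 ^ j) = 4 * R ^ 2 * (√2 ^ 2) ^ j by ring, Real.sq_sqrt (by norm_num)]

theorem dist_lb : ∃ κ : ℝ, 0 < κ ∧ ∀ (m N L M : ℕ), 1 ≤ N → 0 < L → M = N * L ^ 2 * 2 ^ (N ^ 2) →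
    (∀ p : ℤ, 0 < p → p < (2 ^ 30 : ℕ) * (8 * N) + 514 * (8 * N) → 2 * p ∣ L) →
    ∀ (f : Hs ℤ → PiLp 1 (fun _ : Fin m => ℝ)) (c' : ℝ),
    (∀ x ∈ box (33 * M) ((33 * M) ^ 2), ∀ y ∈ box (33 * M) ((33 * M) ^ 2), dd x y ≤ ‖f x - f y‖ ∧ ‖f x - f y‖ ≤ c' * dd x y) →
    κ * N ≤ c' := by
  obtain ⟨C, hC, hmain⟩ := vec_ineq
  obtain ⟨K0, hK0⟩ : ∃ K0 : ℕ, K0 = 67 ^ 4 * 2179 := ⟨_, rfl⟩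
  refine ⟨(3 * C * K0)⁻¹, by rw [hK0]; positivity, ?_⟩
  intro m N L M hN hL hM hdiv f c' hf
  set T := box (33 * M) ((33 * M) ^ 2) with hT
  set P := box (2 * M) (16 * M ^ 2) with hP
  have hM1 : 1 ≤ M := by rw [hM]; exact Nat.one_le_iff_ne_zero.2 (by positivity)
  have hMr : (1:ℝ) ≤ M := by exact_mod_cast hM1
  set Q : ℝ := 16 * M with hQ
  have hQ0 : 0 < Q := by positivity
  have hball : ∀ x, NN x ≤ 2 * Q + 1 → x ∈ T := by
    intro x hx
    refine ball_box _ _ (hx.trans ?_)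
    push_cast; linarith
  have hPb : ∀ x ∈ P, NN x ≤ Q / 2 := fun x hx => (box_ball M hM1 x hx).trans (by rw [hQ]; linarith)
  have h1T : (1 : Hs ℤ) ∈ T := hball 1 (by rw [NN_one]; positivity)
  have hd1 : ∀ x, dd x 1 = NN x := fun x => by rw [dd_comm]; simp [dd]
  have hdg : ∀ x g, dd x (x * g) = NN g := fun x g => by simp [dd]
  have hc : 0 ≤ c' := by
    have h2 := hf (e1 ℤ) (hball _ (by rw [NN_e.1]; linarith)) 1 h1T
    rw [hd1, NN_e.1] at h2
    linarith
  let F0 : Hs ℤ → PiLp 1 (fun _ : Fin m => ℝ) := fun x => chi Q (NN x) • (f x - f 1)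
  have hF0 : ∀ x, F0 x ≠ 0 → NN x ≤ 2 * Q := fun x hx => chi_zero _ _ hQ0 fun h => hx (by simp [F0, h])
  have hstep : ∀ g, NN g = 1 → ∀ x, ‖F0 x - F0 (x * g)‖ ≤ 3 * c' := by
    intro g hg x
    have a1 := NN_mul x g
    have a2 := NN_mul (x * g) g⁻¹
    rw [mul_inv_cancel_right, NN_inv] at a2
    have hv : ∀ y, chi Q (NN y) ≠ 0 → y ∈ T ∧ ‖f y - f 1‖ ≤ c' * (2 * Q) := by
      intro y hy
      have h3 := chi_zero _ _ hQ0 hy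
      have h4 := hball y (by linarith)
      refine ⟨h4, (hf y h4 1 h1T).2.trans ?_⟩
      rw [hd1]; gcongr
    refine cut_diff _ _ Q c' _ _ hQ0 hc (chi_nonneg _ _) (chi_le _ _) (chi_lip _ _ _ hQ0 (by rw [abs_le]; constructor <;> linarith)) (fun h => (hv _ h).2) (fun h => (hv _ h).2) fun h h' => ?_
    rw [sub_sub_sub_cancel_right]
    refine (hf _ (hv _ h).1 _ (hv _ h').1).2.trans ?_
    rw [hdg, hg, mul_one]
  obtain ⟨F, hF1, hF2⟩ := push (2 * (33 * M) ^ 2 + 1) T F0 (fun x hx => hball x (by linarith [hF0 x hx])) (inj_box _ _ (by nlinarith))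
  have hup : ∀ g, NN g = 1 → DV F (prj _ g) ≤ #T * (3 * c') := by
    intro g hg
    refine (hF1 g fun x hx => hball _ ?_).trans ((sum_le_card_nsmul _ _ _ fun x _ => hstep g hg x).trans_eq (nsmul_eq_mul _ _))
    have := NN_mul x g⁻¹
    rw [NN_inv, hg] at this
    linarith [hF0 x hx]
  have hlow : ∀ j ∈ range (2 * N ^ 2), (4 * #P : ℝ) / 2 ≤ (N * L ^ 2 * √2 ^ j : ℝ)⁻¹ * DV F (ze (4 * (N * L ^ 2) ^ 2 * 2 ^ j)) := by
    intro j hj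
    have hR : 0 < N * L ^ 2 := by positivity
    have hRr : (0:ℝ) < N * L ^ 2 := by exact_mod_cast hR
    have hnn : NN (ze (4 * (N * L ^ 2) ^ 2 * 2 ^ j)) = 2 * (N * L ^ 2) * √2 ^ j := by
      rw [NN_ze _ (by positivity)]
      have := sqrt_tau (N * L ^ 2) j
      push_cast at this ⊢
      exact this
    have hle : 2 * (N * L ^ 2) * √2 ^ j ≤ Q / 2 := by
      have : √2 ^ j ≤ 2 ^ (N ^ 2) := by
        calc √2 ^ j ≤ √2 ^ (2 * N ^ 2) := pow_le_pow_right₀ (by simp) (mem_range.1 hj).le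
          _ = _ := by rw [pow_mul, Real.sq_sqrt (by norm_num)]
      have h5 : (M : ℝ) = N * L ^ 2 * 2 ^ (N ^ 2) := by rw [hM]; push_cast; rfl
      have h6 := mul_le_mul_of_nonneg_left this hRr.le
      rw [hQ]; nlinarith
    have h7 := hF2 (ze (4 * (N * L ^ 2) ^ 2 * 2 ^ j)) P (fun x hx => hball x (by linarith [hPb x hx])) fun x hx => hball _ (by
      have := NN_mul x (ze (4 * (N * L ^ 2) ^ 2 * 2 ^ j)); rw [hnn] at this; linarith [hPb x hx])
    rw [prj_ze] at h7
    have h8 : #P • (2 * (N * L ^ 2) * √2 ^ j) ≤ ∑ x ∈ P, ‖F0 x - F0 (x * ze (4 * (N * L ^ 2) ^ 2 * 2 ^ j))‖ := by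
      refine card_nsmul_le_sum _ _ _ fun x hx => ?_
      have h9 := NN_mul x (ze (4 * (N * L ^ 2) ^ 2 * 2 ^ j))
      rw [hnn] at h9
      have h10 := hPb x hx
      simp only [F0]
      rw [chi_one _ _ hQ0 (by linarith), chi_one _ _ hQ0 (by linarith), one_smul, one_smul, sub_sub_sub_cancel_right]
      refine le_trans (by rw [hdg, hnn]) (hf x (hball x (by linarith)) _ (hball _ (by linarith))).1
    rw [nsmul_eq_mul] at h8
    have h11 := h8.trans h7
    have hpos : (0:ℝ) < N * L ^ 2 * √2 ^ j := by positivity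
    rw [inv_mul_eq_div, le_div_iff₀ hpos]
    refine le_trans (le_of_eq ?_) h11
    ring
  have hm := hmain F N (N ^ 2) L hN hL le_rfl hdiv
  have hlow2 := card_nsmul_le_sum _ _ _ hlow
  rw [card_range, nsmul_eq_mul] at hlow2
  obtain ⟨p1, p2, p3, p4⟩ := prj_e (2 * (33 * M) ^ 2 + 1)
  obtain ⟨n1, n2, n3, n4⟩ := NN_e
  have u1 := hup _ n1
  have u2 := hup _ n2
  have u3 := hup _ n3
  have u4 := hup _ n4
  rw [p1] at u1; rw [p2] at u2; rw [p3] at u3; rw [p4] at u4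
  have hcard : (#T : ℝ) ≤ K0 * #P := by
    have : #T ≤ K0 * #P := by
      rw [hT, hP, card_box, card_box, hK0]
      calc (2 * (33 * M) + 1) ^ 4 * (2 * (33 * M) ^ 2 + 1) ≤ (67 * M) ^ 4 * (2179 * M ^ 2) := by
            gcongr
            · omega
            · nlinarith
        _ = 67 ^ 4 * 2179 * (M ^ 4 * M ^ 2) := by ring
        _ ≤ _ := by
            gcongr
            · omega
            · nlinarith
    exact_mod_cast this
  have hPpos : (0:ℝ) < #P := by
    rw [hP, card_box]; positivity
  have hNr : (1:ℝ) ≤ N := by exact_mod_cast hN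
  have hsq : √((N ^ 2 : ℕ) : ℝ) = N := by push_cast; exact Real.sqrt_sq (by positivity)
  rw [hsq] at hm
  have hK : (0:ℝ) < K0 := by rw [hK0]; positivity
  have hfin : ((2 * N ^ 2 : ℕ) : ℝ) * ((4 * #P : ℝ) / 2) ≤ C * N * (4 * ((K0 * #P) * (3 * c'))) := by
    refine hlow2.trans (hm.trans ?_)
    have : (#T : ℝ) * (3 * c') ≤ (K0 * #P) * (3 * c') := mul_le_mul_of_nonneg_right hcard (by positivity)
    refine mul_le_mul_of_nonneg_left ?_ (by positivity)
    linarith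
  push_cast at hfin
  rw [inv_mul_le_iff₀ (by positivity)]
  have : (4 * N * #P : ℝ) * N ≤ (4 * N * #P : ℝ) * (3 * C * K0 * c') := by nlinarith
  exact le_of_mul_le_mul_left this (by positivity)
end
end NY

namespace NY
open Finset
noncomputable section
open scoped Classical
set_option linter.all false

theorem size_bd (k : ℕ) (hk : 1 ≤ k) : ∃ K : ℕ, 1 ≤ K ∧ ∀ N M : ℕ, 1 ≤ N → M = N * ((k * N).factorial) ^ 2 * 2 ^ (N ^ 2) →
    #(box (33 * M) ((33 * M) ^ 2)) ≤ 2 ^ (K * N ^ 2) := by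
  refine ⟨36 + (2 + 2 * k ^ 2) * 6, by omega, fun N M hN hM => ?_⟩
  have hNN : N ≤ N ^ 2 := by nlinarith
  have h1N : 1 ≤ N ^ 2 := by nlinarith
  have hL : (k * N).factorial ≤ 2 ^ (k ^ 2 * N ^ 2) := by
    calc (k * N).factorial ≤ (k * N) ^ (k * N) := Nat.factorial_le_pow _
      _ ≤ (2 ^ (k * N)) ^ (k * N) := Nat.pow_le_pow_left Nat.lt_two_pow_self.le _
      _ = _ := by rw [← pow_mul]; congr 1; ring
  have hMb : M ≤ 2 ^ ((2 + 2 * k ^ 2) * N ^ 2) := by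
    rw [hM]
    calc N * ((k * N).factorial) ^ 2 * 2 ^ (N ^ 2) ≤ 2 ^ (N ^ 2) * (2 ^ (k ^ 2 * N ^ 2)) ^ 2 * 2 ^ (N ^ 2) := by
          gcongr
          exact hNN.trans Nat.lt_two_pow_self.le
      _ = _ := by rw [← pow_mul, ← pow_add, ← pow_add]; congr 1; ring
  have hM1 : 1 ≤ M := by rw [hM]; exact Nat.one_le_iff_ne_zero.2 (by positivity)
  rw [card_box]
  calc (2 * (33 * M) + 1) ^ 4 * (2 * (33 * M) ^ 2 + 1) ≤ (67 * M) ^ 4 * (2179 * M ^ 2) := by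
        gcongr
        · omega
        · nlinarith
    _ = 67 ^ 4 * 2179 * M ^ 6 := by ring
    _ ≤ (2 ^ (N ^ 2)) ^ 36 * (2 ^ ((2 + 2 * k ^ 2) * N ^ 2)) ^ 6 := by
        gcongr
        calc 67 ^ 4 * 2179 ≤ (2 ^ 1) ^ 36 := by norm_num
          _ ≤ _ := by gcongr; norm_num
    _ = _ := by rw [← pow_mul, ← pow_mul, ← pow_add]; congr 1; ring

instance : Infinite (Hs ℤ) := Infinite.of_injective (fun t : ℤ => (⟨0, 0, 0, 0, t⟩ : Hs ℤ)) fun s t h => by simpa using h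

theorem final : ∃ c : ℝ, 0 < c ∧ ∃ N₀ : ℕ, ∀ n : ℕ, N₀ ≤ n → ∃ x : Fin n → Hs ℤ, Function.Injective x ∧ 0 < n ∧
    ∀ (m : ℕ) (f : Fin n → PiLp 1 (fun _ : Fin m => ℝ)) (c' : ℝ),
      (∀ i j, dd (x i) (x j) ≤ ‖f i - f j‖ ∧ ‖f i - f j‖ ≤ c' * dd (x i) (x j)) → c * √(Real.log n) ≤ c' := by
  obtain ⟨κ, hκ, hlb⟩ := dist_lb
  obtain ⟨k, hk⟩ : ∃ k : ℕ, k = 16 * (2 ^ 30 + 514) := ⟨_, rfl⟩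
  obtain ⟨K, hK, hsz⟩ := size_bd k (by omega)
  have hKr : (1:ℝ) ≤ K := by exact_mod_cast hK
  refine ⟨κ / (2 * √K), by positivity, 2 ^ K, fun n hn => ?_⟩
  have hn0 : n ≠ 0 := by
    have : 0 < 2 ^ K := by positivity
    omega
  set l := Nat.log 2 n with hl
  set N := Nat.sqrt (l / K) with hNdef
  have hKl : K ≤ l := (Nat.le_log_iff_pow_le (by norm_num) hn0).2 hn
  have hN : 1 ≤ N := Nat.le_sqrt.2 (Nat.div_pos hKl hK)
  have hN1 : K * N ^ 2 ≤ l := by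
    have : N ^ 2 ≤ l / K := Nat.sqrt_le' _
    calc K * N ^ 2 ≤ K * (l / K) := by gcongr
      _ ≤ l := Nat.mul_div_le l K
  have hN2 : l + 1 ≤ K * (N + 1) ^ 2 := by
    have : l / K < (N + 1) ^ 2 := Nat.lt_succ_sqrt' _
    rw [Nat.div_lt_iff_lt_mul hK] at this
    rw [mul_comm]; exact this
  obtain ⟨M, hM⟩ : ∃ M, M = N * ((k * N).factorial) ^ 2 * 2 ^ (N ^ 2) := ⟨_, rfl⟩
  set T := box (33 * M) ((33 * M) ^ 2) with hT
  have hTn : #T ≤ n := by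
    calc #T ≤ 2 ^ (K * N ^ 2) := hsz N M hN hM
      _ ≤ 2 ^ l := Nat.pow_le_pow_right (by norm_num) hN1
      _ ≤ n := Nat.pow_log_le_self 2 hn0
  obtain ⟨X, hTX, hXn⟩ := Infinite.exists_superset_card_eq T n hTn
  let e := X.equivFinOfCardEq hXn
  refine ⟨fun i => (e.symm i : Hs ℤ), fun i j h => e.symm.injective (Subtype.ext h), Nat.pos_of_ne_zero hn0, fun m f c' hf => ?_⟩
  have h1 := hlb m N (k * N).factorial M hN (Nat.factorial_pos _) hM (fun p hp hpN => by
    lift p to ℕ using hp.le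
    have : 2 * p ∣ (k * N).factorial := Nat.dvd_factorial (by omega) (by
      have h3 : (2 * p : ℤ) ≤ k * N := by
        rw [hk]; push_cast at hpN ⊢; nlinarith
      exact_mod_cast h3)
    exact_mod_cast this) (fun y => if h : y ∈ X then f (e ⟨y, h⟩) else 0) c' (fun x hx y hy => by
      have := hf (e ⟨x, hTX hx⟩) (e ⟨y, hTX hy⟩)
      simp only [Equiv.symm_apply_apply] at this
      simpa only [dif_pos (hTX hx), dif_pos (hTX hy)] using this)
  refine le_trans ?_ h1
  have hNr : (1:ℝ) ≤ N := by exact_mod_cast hN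
  have hlog : Real.log n ≤ (2 * √K * N) ^ 2 := by
    have h2 : (n : ℝ) ≤ 2 ^ (K * (N + 1) ^ 2) := by
      have : n ≤ 2 ^ (K * (N + 1) ^ 2) := (Nat.lt_pow_succ_log_self (by norm_num) n).le.trans (Nat.pow_le_pow_right (by norm_num) hN2)
      exact_mod_cast this
    have h3 := Real.log_le_log (by positivity) h2
    rw [Real.log_pow] at h3
    push_cast at h3
    have h4 : Real.log 2 ≤ 1 := by linarith [Real.log_two_lt_d9]
    calc Real.log n ≤ K * (N + 1) ^ 2 * Real.log 2 := h3
      _ ≤ K * (N + 1) ^ 2 * 1 := by gcongr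
      _ ≤ K * (2 * N) ^ 2 * 1 := by gcongr; linarith
      _ = _ := by rw [mul_pow (2 * √(K:ℝ)), mul_pow 2 √(K:ℝ), Real.sq_sqrt (by positivity)]; ring
  have h5 : √(Real.log n) ≤ 2 * √K * N := Real.sqrt_le_iff.2 ⟨by positivity, hlog⟩
  calc κ / (2 * √K) * √(Real.log n) ≤ κ / (2 * √K) * (2 * √K * N) := by gcongr
    _ = κ * N := by have : √(K:ℝ) ≠ 0 := by positivity
                    field_simp
end
end NY

theorem naor_young :
    ∃ c : ℝ, 0 < c ∧
      ∃ N₀ : ℕ, ∀ n : ℕ, N₀ ≤ n →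
        ∃ d : Fin n → Fin n → ℝ,
          (∀ x, d x x = 0) ∧
          (∀ x y, x ≠ y → 0 < d x y) ∧
          (∀ x y, d x y = d y x) ∧
          (∀ x y z, d x z ≤ d x y + d y z) ∧
          (∃ g : Fin n → lp (fun _ : ℕ => ℝ) 2,
            ∀ x y, ‖g x - g y‖ = Real.sqrt (d x y)) ∧
          ∀ (m : ℕ) (f : Fin n → PiLp 1 (fun _ : Fin m => ℝ)) (c' : ℝ),
            (∀ x y, d x y ≤ ‖f x - f y‖ ∧ ‖f x - f y‖ ≤ c' * d x y) →
            c * Real.sqrt (Real.log n) ≤ c' := by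
  obtain ⟨c, hc, N₀, h⟩ := NY.final
  refine ⟨c, hc, N₀, fun n hn => ?_⟩
  obtain ⟨x, hx, hn0, hf⟩ := h n hn
  exact ⟨fun i j => NY.dd (x i) (x j), fun i => NY.dd_self _, fun i j hij => NY.dd_pos _ _ fun h => hij (hx h),
    fun i j => NY.dd_comm _ _, fun i j k => NY.dd_tri _ _ _, NY.hilbert x ⟨0, hn0⟩, hf⟩
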